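/- Let H be a finite group with normal subgroup Q which is similar to a 3-centralizer in a group of type F₂. Let r be an element of H of order 2 whose image in H/Q lies in O₂(H/Q) but not in the center Z(O₂(H/Q)). Set X = C_H(r)/O₂(C_H(r)). Then O₃(X) is extraspecial of order 3⁵, O₂(X/O₃(X)) is extraspecial of order 2⁵, and, writing O_{3,2}(X) for the preimage in X of O₂(X/O₃(X)), the quotient X/O_{3,2}(X) is isomorphic to the alternating group Alt(5). (That is, X is similar to a 3-centralizer in Co₂.) -/

import Mathlib

/-- `O_p(X)`: the largest normal `p`-subgroup of the group `X` (for finite `X` this is the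
`p`-core), defined as the join of all normal `p`-subgroups. -/
def Op (p : ℕ) (X : Type*) [Group X] : Subgroup X :=
  sSup {P : Subgroup X | P.Normal ∧ IsPGroup p P}

theorem map_conjAut_eq_of_normal {X : Type*} [Group X] (g : X) {P : Subgroup X}
    (hP : P.Normal) : Subgroup.map (MulAut.conj g).toMonoidHom P = P := by
  ext x
  simp only [Subgroup.mem_map, MulEquiv.coe_toMonoidHom, MulAut.conj_apply]
  constructor
  · rintro ⟨y, hy, rfl⟩
    exact hP.conj_mem y hy g
  · intro hx
    refine ⟨g⁻¹ * x * g, by simpa using hP.conj_mem x hx g⁻¹, by group⟩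

instance Op.normal (p : ℕ) (X : Type*) [Group X] : (Op p X).Normal := by
  constructor
  intro n hn g
  have key : Subgroup.map (MulAut.conj g).toMonoidHom (Op p X) = Op p X := by
    unfold Op
    rw [(Subgroup.gc_map_comap _).l_sSup]
    apply le_antisymm
    · refine iSup_le fun P => iSup_le fun hP => ?_
      rw [map_conjAut_eq_of_normal g hP.1]
      exact le_sSup hP
    · refine sSup_le fun P hP => ?_
      refine le_trans (le_of_eq (map_conjAut_eq_of_normal g hP.1).symm) ?_
      exact le_iSup₂_of_le P hP le_rfl
  rw [← key]
  exact Subgroup.mem_map.mpr ⟨n, hn, by simp⟩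

/-- A finite `p`-group is extraspecial if its center, derived subgroup and Frattini subgroup
coincide and have order `p`. -/
def IsExtraspecial (p : ℕ) (P : Type*) [Group P] : Prop :=
  IsPGroup p P ∧ Subgroup.center P = commutator P ∧ Subgroup.center P = frattini P ∧
    Nat.card (Subgroup.center P) = p

/-- The symplectic group `Sp₄(GF(3))`. -/
abbrev Sp43 := Matrix.symplecticGroup (Fin 2) (ZMod 3)

/-- `PSp₄(3) ≅ Ω₆⁻(2)`, the quotient of `Sp₄(GF(3))` by its center. -/
abbrev PSp43 := Sp43 ⧸ Subgroup.center Sp43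

/-- A finite group `H` with a normal subgroup `Q` is similar to a 3-centralizer in a group of
type `M(23)` or `F₂` (Definitions 1.1 and 1.2 of the paper): `Q = F*(H) = O₃(H) ≅ 3^{1+8}_+`
with `Z(Q) = Z(H)`, `O₂(H/Q) ≅ 2^{1+6}_-` with `F*(H/Q) = O₂(H/Q)`, and `(H/Q)/O₂(H/Q)` is
isomorphic to `PSp₄(3)` (type `F₂`) or to the centralizer of a 3-central element of `PSp₄(3)`
(type `M(23)`). -/
structure SimilarToM23orF2Centralizer (H : Type*) [Group H] [Finite H]
    (Q : Subgroup H) [Q.Normal] : Prop where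
  extraspecial : IsExtraspecial 3 Q
  card_eq : Nat.card Q = 3 ^ 9
  exponent3 : ∀ x ∈ Q, x ^ 3 = 1
  centralizer_eq : Subgroup.centralizer (Q : Set H) = Subgroup.center H
  center_le : Subgroup.center H ≤ Q
  O2_extraspecial : IsExtraspecial 2 (Op 2 (H ⧸ Q))
  O2_card : Nat.card (Op 2 (H ⧸ Q)) = 2 ^ 7
  O2_minusType : ∀ A : Subgroup (H ⧸ Q), A ≤ Op 2 (H ⧸ Q) → (∀ x ∈ A, x ^ 2 = 1) →
    Nat.card A ≤ 2 ^ 3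
  O2_selfCentralizing :
    Subgroup.centralizer ((Op 2 (H ⧸ Q)) : Set (H ⧸ Q)) ≤ Op 2 (H ⧸ Q)
  quotient_iso :
    Nonempty (((H ⧸ Q) ⧸ Op 2 (H ⧸ Q)) ≃* PSp43) ∨
    ∃ (z : PSp43) (S : Sylow 3 PSp43), orderOf z = 3 ∧ z ∈ (S : Subgroup PSp43) ∧
      z ∈ Subgroup.centralizer ((S : Subgroup PSp43) : Set PSp43) ∧
      Nonempty (((H ⧸ Q) ⧸ Op 2 (H ⧸ Q)) ≃* Subgroup.centralizer {z})

/-- A finite group `H` with a normal subgroup `Q` is similar to a 3-centralizer in a group of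
type `F₂` (Definition 1.2 of the paper). -/
structure SimilarToF2Centralizer (H : Type*) [Group H] [Finite H]
    (Q : Subgroup H) [Q.Normal] : Prop where
  extraspecial : IsExtraspecial 3 Q
  card_eq : Nat.card Q = 3 ^ 9
  exponent3 : ∀ x ∈ Q, x ^ 3 = 1
  centralizer_eq : Subgroup.centralizer (Q : Set H) = Subgroup.center H
  center_le : Subgroup.center H ≤ Q
  O2_extraspecial : IsExtraspecial 2 (Op 2 (H ⧸ Q))
  O2_card : Nat.card (Op 2 (H ⧸ Q)) = 2 ^ 7
  O2_minusType : ∀ A : Subgroup (H ⧸ Q), A ≤ Op 2 (H ⧸ Q) → (∀ x ∈ A, x ^ 2 = 1) →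
    Nat.card A ≤ 2 ^ 3
  O2_selfCentralizing :
    Subgroup.centralizer ((Op 2 (H ⧸ Q)) : Set (H ⧸ Q)) ≤ Op 2 (H ⧸ Q)
  quotient_iso : Nonempty (((H ⧸ Q) ⧸ Op 2 (H ⧸ Q)) ≃* PSp43)


section


set_option linter.all false

/-- vectors of length four over the field with three elements, and their standard
symplectic form -/
def sympl (x y : Fin 2 ⊕ Fin 2 → ZMod 3) : ZMod 3 :=
  x (Sum.inr 0) * y (Sum.inl 0) + x (Sum.inr 1) * y (Sum.inl 1)
    - x (Sum.inl 0) * y (Sum.inr 0) - x (Sum.inl 1) * y (Sum.inr 1)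

theorem sympl_matrix (A : Matrix (Fin 2 ⊕ Fin 2) (Fin 2 ⊕ Fin 2) (ZMod 3)) (i j) :
    (A * Matrix.J (Fin 2) (ZMod 3) * A.transpose) i j = sympl (A i) (A j) := by
  simp [Matrix.mul_apply, Matrix.J, sympl, Fin.sum_univ_two, Matrix.fromBlocks, Matrix.one_apply]
  ring

theorem sympl_add_right (x y z) : sympl x (y + z) = sympl x y + sympl x z := by
  simp [sympl]; ring

theorem sympl_smul_right (x y) (c : ZMod 3) : sympl x (c • y) = c * sympl x y := by
  simp [sympl]; ring

theorem sympl_swap (x y) : sympl x y = - sympl y x := by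
  simp [sympl]; ring

theorem sympl_self (x) : sympl x x = 0 := by
  simp [sympl]; ring

theorem sympl_nondeg {x} (hx : x ≠ 0) : ∃ y, sympl x y = 1 := by
  have key : ∃ y, sympl x y ≠ 0 := by
    by_contra! h
    apply hx
    have h1 := h (Pi.single (Sum.inl 0) 1)
    have h2 := h (Pi.single (Sum.inl 1) 1)
    have h3 := h (Pi.single (Sum.inr 0) 1)
    have h4 := h (Pi.single (Sum.inr 1) 1)
    simp [sympl, Pi.single_apply] at h1 h2 h3 h4
    funext i
    rcases i with i | i <;> fin_cases i <;> simp_all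
  obtain ⟨y, hy⟩ := key
  refine ⟨(sympl x y)⁻¹ • y, ?_⟩
  rw [sympl_smul_right, inv_mul_cancel₀ hy]

/-- the form as an additive map in the second variable -/
def symplHom (x : Fin 2 ⊕ Fin 2 → ZMod 3) : (Fin 2 ⊕ Fin 2 → ZMod 3) →+ ZMod 3 :=
  AddMonoidHom.mk' (sympl x) (sympl_add_right x)

theorem card_fiber_of_surj {V M : Type*} [AddGroup V] [AddGroup M] [Finite V] [Finite M]
    (f : V →+ M) (hf : Function.Surjective f) (m : M) :
    Nat.card {v // f v = m} * Nat.card M = Nat.card V := by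
  have h1 : Nat.card {v // f v = m} = Nat.card f.ker :=
    Nat.card_congr (AddMonoidHom.fiberEquivKerOfSurjective hf m)
  rw [h1, mul_comm, ← AddSubgroup.card_mul_index f.ker, mul_comm]
  congr 1
  rw [AddSubgroup.index_ker, AddMonoidHom.range_eq_top.mpr hf]
  simp

theorem card_vec : Nat.card (Fin 2 ⊕ Fin 2 → ZMod 3) = 81 := by
  simp

theorem count1 : Nat.card {a : Fin 2 ⊕ Fin 2 → ZMod 3 // a ≠ 0} = 80 := by
  rw [Nat.card_eq_fintype_card, Fintype.card_subtype_compl]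
  simp

theorem count2 {a : Fin 2 ⊕ Fin 2 → ZMod 3} (ha : a ≠ 0) :
    Nat.card {c // sympl a c = -1} = 27 := by
  have := card_fiber_of_surj (symplHom a) (by
    intro m
    obtain ⟨y, hy⟩ := sympl_nondeg ha
    exact ⟨m • y, by simp [symplHom, sympl_smul_right, hy]⟩) (-1)
  have h : Nat.card {c // sympl a c = -1} * Nat.card (ZMod 3) = 81 := this.trans card_vec
  rw [Nat.card_zmod] at h
  omega

theorem count3 {a c : Fin 2 ⊕ Fin 2 → ZMod 3} (hac : sympl a c = -1) :
    Nat.card {b // b ≠ 0 ∧ sympl a b = 0 ∧ sympl c b = 0} = 8 := by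
  have hca : sympl c a = 1 := by rw [sympl_swap, hac]; simp
  have := card_fiber_of_surj ((symplHom a).prod (symplHom c)) (by
    rintro ⟨m, n⟩
    refine ⟨n • a + (-m) • c, ?_⟩
    simp only [symplHom, AddMonoidHom.prod_apply, AddMonoidHom.mk'_apply, sympl_smul_right,
      sympl_add_right, sympl_self, hac, hca]
    simp [symplHom, sympl_smul_right, sympl_add_right, sympl_self, hac, hca]) (0, 0)
  have e0 : {v // sympl a v = 0 ∧ sympl c v = 0} ≃
      {v // ((symplHom a).prod (symplHom c)) v = (0, 0)} :=
    Equiv.subtypeEquivRight (fun v => by simp [symplHom])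
  rw [card_vec, ← Nat.card_congr e0, Nat.card_prod, Nat.card_zmod] at this
  have h2 : Nat.card {v // sympl a v = 0 ∧ sympl c v = 0} = 9 := by omega
  have e : {b // b ≠ 0 ∧ sympl a b = 0 ∧ sympl c b = 0} ≃
      {x : {v // sympl a v = 0 ∧ sympl c v = 0} // ¬ (x = ⟨0, by simp [sympl]⟩)} :=
    { toFun := fun b => ⟨⟨b.1, b.2.2⟩, fun h => b.2.1 (congrArg Subtype.val h)⟩
      invFun := fun x => ⟨x.1.1, fun h => x.2 (Subtype.ext h), x.1.2⟩
      left_inv := fun _ => rfl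
      right_inv := fun _ => rfl }
  classical
  rw [Nat.card_congr e, Nat.card_eq_fintype_card, Fintype.card_subtype_compl,
    ← Nat.card_eq_fintype_card, h2]
  simp

theorem count4 {a c b : Fin 2 ⊕ Fin 2 → ZMod 3} (hac : sympl a c = -1) (hb : b ≠ 0)
    (hab : sympl a b = 0) (hcb : sympl c b = 0) :
    Nat.card {d // sympl a d = 0 ∧ sympl c d = 0 ∧ sympl b d = -1} = 3 := by
  have hca : sympl c a = 1 := by rw [sympl_swap, hac]; simp
  have hba : sympl b a = 0 := by rw [sympl_swap, hab]; simp
  have hbc : sympl b c = 0 := by rw [sympl_swap, hcb]; simp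
  obtain ⟨y, hy⟩ := sympl_nondeg hb
  have := card_fiber_of_surj ((symplHom a).prod ((symplHom c).prod (symplHom b))) (by
    rintro ⟨m, n, k⟩
    refine ⟨(n - k * sympl c y) • a + (-(m - k * sympl a y)) • c + k • y, ?_⟩
    simp only [symplHom, AddMonoidHom.prod_apply, AddMonoidHom.mk'_apply, sympl_smul_right,
      sympl_add_right, sympl_self, hac, hca, hba, hbc, hy]
    simp [symplHom, sympl_smul_right, sympl_add_right, sympl_self, hac, hca, hba, hbc, hy])
      (0, 0, -1)
  have e0 : {d // sympl a d = 0 ∧ sympl c d = 0 ∧ sympl b d = -1} ≃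
      {v // ((symplHom a).prod ((symplHom c).prod (symplHom b))) v = (0, 0, -1)} :=
    Equiv.subtypeEquivRight (fun v => by simp [symplHom])
  rw [card_vec, ← Nat.card_congr e0, Nat.card_prod, Nat.card_prod, Nat.card_zmod] at this
  omega

theorem sp43_mem_iff (A : Matrix (Fin 2 ⊕ Fin 2) (Fin 2 ⊕ Fin 2) (ZMod 3)) :
    A ∈ Matrix.symplecticGroup (Fin 2) (ZMod 3) ↔
      sympl (A (Sum.inl 0)) (A (Sum.inr 0)) = -1 ∧
      sympl (A (Sum.inl 0)) (A (Sum.inl 1)) = 0 ∧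
      sympl (A (Sum.inr 0)) (A (Sum.inl 1)) = 0 ∧
      sympl (A (Sum.inl 0)) (A (Sum.inr 1)) = 0 ∧
      sympl (A (Sum.inr 0)) (A (Sum.inr 1)) = 0 ∧
      sympl (A (Sum.inl 1)) (A (Sum.inr 1)) = -1 := by
  rw [SymplecticGroup.mem_iff, ← Matrix.ext_iff]
  simp only [sympl_matrix]
  constructor
  · intro h
    refine ⟨?_, ?_, ?_, ?_, ?_, ?_⟩ <;> rw [h] <;> simp [Matrix.J]
  · rintro ⟨h1, h2, h3, h4, h5, h6⟩ i j
    have h1' := sympl_swap (A (Sum.inr 0)) (A (Sum.inl 0))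
    have h2' := sympl_swap (A (Sum.inl 1)) (A (Sum.inl 0))
    have h3' := sympl_swap (A (Sum.inl 1)) (A (Sum.inr 0))
    have h4' := sympl_swap (A (Sum.inr 1)) (A (Sum.inl 0))
    have h5' := sympl_swap (A (Sum.inr 1)) (A (Sum.inr 0))
    have h6' := sympl_swap (A (Sum.inr 1)) (A (Sum.inl 1))
    rw [h1] at h1'
    rw [h2] at h2'
    rw [h3] at h3'
    rw [h4] at h4'
    rw [h5] at h5'
    rw [h6] at h6'
    rcases i with i | i <;> rcases j with j | j <;> fin_cases i <;> fin_cases j <;>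
      simp [Matrix.J, h1', h2', h3', h4', h5', h6', h1, h2, h3, h4, h5, h6, sympl_self]

/-- symplectic matrices are symplectic bases -/
def sp43Equiv : Sp43 ≃ Σ a : {a : Fin 2 ⊕ Fin 2 → ZMod 3 // a ≠ 0},
    Σ c : {c // sympl a.1 c = -1},
    Σ b : {b // b ≠ 0 ∧ sympl a.1 b = 0 ∧ sympl c.1 b = 0},
    {d // sympl a.1 d = 0 ∧ sympl c.1 d = 0 ∧ sympl b.1 d = -1} where
  toFun A := by
    have h := (sp43_mem_iff A.1).1 A.2
    refine ⟨⟨A.1 (Sum.inl 0), ?_⟩, ⟨A.1 (Sum.inr 0), h.1⟩,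
      ⟨A.1 (Sum.inl 1), ?_, h.2.1, h.2.2.1⟩,
      ⟨A.1 (Sum.inr 1), h.2.2.2.1, h.2.2.2.2.1, h.2.2.2.2.2⟩⟩
    · intro h0
      have := h.1
      rw [h0] at this
      simp [sympl] at this
    · intro h0
      have := h.2.2.2.2.2
      rw [h0] at this
      simp [sympl] at this
  invFun x := ⟨Matrix.of fun i => Sum.elim ![x.1.1, x.2.2.1.1] ![x.2.1.1, x.2.2.2.1] i, by
    apply (sp43_mem_iff _).2
    obtain ⟨a, c, b, d⟩ := x
    exact ⟨c.2, b.2.2.1, b.2.2.2, d.2.1, d.2.2.1, d.2.2.2⟩⟩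
  left_inv A := by
    apply Subtype.ext
    funext i
    rcases i with i | i <;> fin_cases i <;> rfl
  right_inv x := rfl

theorem card_sp43 : Nat.card Sp43 = 51840 := by
  rw [Nat.card_congr sp43Equiv, Nat.card_sigma]
  have h1 : ∀ a : {a : Fin 2 ⊕ Fin 2 → ZMod 3 // a ≠ 0},
    Nat.card (Σ c : {c // sympl a.1 c = -1},
    Σ b : {b // b ≠ 0 ∧ sympl a.1 b = 0 ∧ sympl c.1 b = 0},
    {d // sympl a.1 d = 0 ∧ sympl c.1 d = 0 ∧ sympl b.1 d = -1}) = 27 * (8 * 3) := by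
    intro a
    rw [Nat.card_sigma]
    have h2 : ∀ c : {c // sympl a.1 c = -1},
      Nat.card (Σ b : {b // b ≠ 0 ∧ sympl a.1 b = 0 ∧ sympl c.1 b = 0},
      {d // sympl a.1 d = 0 ∧ sympl c.1 d = 0 ∧ sympl b.1 d = -1}) = 8 * 3 := by
      intro c
      rw [Nat.card_sigma, Finset.sum_congr rfl
        (fun b _ => count4 c.2 b.2.1 b.2.2.1 b.2.2.2), Finset.sum_const, Finset.card_univ,
        ← Nat.card_eq_fintype_card, count3 c.2]
      rfl
    rw [Finset.sum_congr rfl (fun c _ => h2 c), Finset.sum_const, Finset.card_univ,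
        ← Nat.card_eq_fintype_card, count2 a.2]
    rfl
  rw [Finset.sum_congr rfl (fun a _ => h1 a), Finset.sum_const, Finset.card_univ,
        ← Nat.card_eq_fintype_card, count1]
  norm_num

/-- the upper unitriangular block matrices -/
def upperBlock (E : Matrix (Fin 2) (Fin 2) (ZMod 3)) (hE : E.transpose = E) : Sp43 :=
  ⟨Matrix.fromBlocks 1 E 0 1, by
    apply SymplecticGroup.mem_iff.2
    simp [Matrix.J, Matrix.fromBlocks_transpose, Matrix.fromBlocks_multiply, hE]⟩

/-- minus one as an element of the symplectic group -/
def negOneSp : Sp43 := ⟨-1, SymplecticGroup.neg_mem (Submonoid.one_mem _)⟩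

theorem mem_center_sp43 (A : Sp43) (hA : A ∈ Subgroup.center Sp43) : A = 1 ∨ A = negOneSp := by
  rw [Subgroup.mem_center_iff] at hA
  have hU : ∀ E : Matrix (Fin 2) (Fin 2) (ZMod 3), E.transpose = E →
      Matrix.fromBlocks 1 E 0 1 * A.1 = A.1 * Matrix.fromBlocks 1 E 0 1 := by
    intro E hE
    exact congrArg Subtype.val (hA (upperBlock E hE))
  have hJ : Matrix.J (Fin 2) (ZMod 3) * A.1 = A.1 * Matrix.J (Fin 2) (ZMod 3) :=
    congrArg Subtype.val (hA (SymplecticGroup.symJ (Fin 2) (ZMod 3)))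
  have hm := A.2
  have hm' := SymplecticGroup.mem_iff.1 hm
  obtain ⟨M, hM⟩ := A
  simp only at hU hJ hm'
  clear hm hA
  obtain ⟨a, b, c, d, rfl⟩ : ∃ a b c d, M = Matrix.fromBlocks a b c d :=
    ⟨_, _, _, _, (Matrix.fromBlocks_toBlocks M).symm⟩
  simp only [Matrix.fromBlocks_multiply, Matrix.fromBlocks_inj, Matrix.J,
    Matrix.fromBlocks_transpose] at hU hJ hm'
  have h1 := hU 1 (by simp)
  have h2 := hU !![1, 0; 0, 0] (by ext i j; fin_cases i <;> fin_cases j <;> rfl)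
  have h3 := hU !![0, 1; 1, 0] (by ext i j; fin_cases i <;> fin_cases j <;> rfl)
  simp only [one_mul, zero_mul, mul_zero, mul_one, add_zero, zero_add] at h1 h2 h3 hJ hm'
  obtain ⟨hc, had, -, -⟩ := h1
  have hc : c = 0 := by simpa using hc
  subst hc
  have had : d = a := by
    rw [add_comm] at had
    exact add_right_cancel had
  subst had
  have hb : b = 0 := by simpa using hJ.1.symm
  subst hb
  have e2 := h2.2.1
  have e3 := h3.2.1
  have e4 := hm'.2.1
  rw [add_comm] at e2 e3
  replace e2 := add_right_cancel e2
  replace e3 := add_right_cancel e3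
  have f1 := congrFun (congrFun e2 0) 1
  have f2 := congrFun (congrFun e2 1) 0
  have f3 := congrFun (congrFun e3 0) 1
  have f4 := congrFun (congrFun e4 0) 0
  simp [Matrix.mul_apply, Fin.sum_univ_two] at f1 f2 f3 f4
  have f5 : d 0 0 = 1 ∨ d 0 0 = -1 := by
    rw [f1] at f4
    simp at f4
    exact mul_self_eq_one_iff.1 f4
  have hd : d = d 0 0 • (1 : Matrix (Fin 2) (Fin 2) (ZMod 3)) := by
    ext i j
    fin_cases i <;> fin_cases j <;> simp [f1, f2.symm, f3]
  rcases f5 with f5 | f5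
  · left
    apply Subtype.ext
    rw [f5, one_smul] at hd
    subst hd
    exact Matrix.fromBlocks_one
  · right
    apply Subtype.ext
    rw [f5] at hd
    have hd' : d = -1 := by rw [hd]; simp
    subst hd'
    change _ = -1
    rw [← Matrix.fromBlocks_one, Matrix.fromBlocks_neg]
    simp

theorem card_center_sp43 : Nat.card (Subgroup.center Sp43) = 2 := by
  have hne : negOneSp ≠ 1 := by
    intro h
    have h' := congrArg (fun A : Sp43 => A.1 (Sum.inl 0) (Sum.inl 0)) h
    simp [negOneSp] at h'
    revert h'
    decide
  have hmem : negOneSp ∈ Subgroup.center Sp43 := by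
    rw [Subgroup.mem_center_iff]
    intro g
    apply Subtype.ext
    change g.1 * (-1) = (-1) * g.1
    simp
  have : (Subgroup.center Sp43 : Set Sp43) = {1, negOneSp} := by
    ext A
    constructor
    · intro h
      exact mem_center_sp43 A h
    · rintro (rfl | rfl)
      · exact Subgroup.one_mem _
      · exact hmem
  have h2 : Nat.card (Subgroup.center Sp43) = Set.ncard (Subgroup.center Sp43 : Set Sp43) := rfl
  rw [h2, this, Set.ncard_pair hne.symm]

theorem card_psp43 : Nat.card PSp43 = 25920 := by
  have h := Subgroup.card_mul_index (Subgroup.center Sp43)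
  rw [card_center_sp43, card_sp43] at h
  have : Nat.card PSp43 = (Subgroup.center Sp43).index := rfl
  omega

end

section


set_option linter.all false
open scoped commutatorElement

theorem frattini_le_of_crit {p : ℕ} [hpp : Fact p.Prime] {L : Type*} [Group L] [Finite L]
    (z : L) (hcomm : ∀ x y : L, ⁅x, y⁆ ∈ Subgroup.zpowers z)
    (hpow : ∀ x : L, x ^ p ∈ Subgroup.zpowers z) : frattini L ≤ Subgroup.zpowers z := by
  intro x hx
  by_contra hxz
  obtain ⟨K, hK⟩ := Set.Finite.exists_maximal
    (Set.toFinite {K : Subgroup L | Subgroup.zpowers z ≤ K ∧ x ∉ K})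
    ⟨Subgroup.zpowers z, le_rfl, hxz⟩
  have hzK : Subgroup.zpowers z ≤ K := hK.1.1
  have hxK : x ∉ K := hK.1.2
  have hKn : K.Normal := by
    constructor
    intro n hn g
    have : g * n * g⁻¹ = ⁅g, n⁆ * n := by simp [commutatorElement_def]
    rw [this]
    exact K.mul_mem (hzK (hcomm g n)) hn
  have hco : IsCoatom K := by
    constructor
    · rintro rfl
      exact hxK (Subgroup.mem_top x)
    · intro M hM
      have hxM : x ∈ M := by
        by_contra hxM
        exact hM.not_ge (hK.2 ⟨hzK.trans hM.le, hxM⟩ hM.le)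
      rw [eq_top_iff]
      intro g _
      by_cases hg : g ∈ K
      · exact hM.le hg
      have hxg : x ∈ K ⊔ Subgroup.zpowers g := by
        by_contra hxg
        have hle := hK.2 ⟨hzK.trans le_sup_left, hxg⟩ le_sup_left
        exact hg (hle (Subgroup.mem_sup_right (Subgroup.mem_zpowers g)))
      obtain ⟨k, hk, y, hy, hxy⟩ := Subgroup.mem_sup_of_normal_left.1 hxg
      obtain ⟨i, rfl⟩ := Subgroup.mem_zpowers_iff.1 hy
      have hgi : g ^ i ∈ M := by
        have : g ^ i = k⁻¹ * x := by rw [← hxy]; group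
        rw [this]
        exact M.mul_mem (M.inv_mem (hM.le hk)) hxM
      have hgp : g ^ p ∈ M := hM.le (hzK (hpow g))
      have hcop : IsCoprime i (p : ℤ) := by
        rw [isCoprime_comm]
        rw [Prime.coprime_iff_not_dvd (Nat.prime_iff_prime_int.1 hpp.out)]
        rintro ⟨j, rfl⟩
        apply hxK
        rw [← hxy]
        refine K.mul_mem hk ?_
        rw [zpow_mul]
        refine K.zpow_mem ?_ _
        exact_mod_cast hzK (hpow g)
      obtain ⟨a, b, hab⟩ := hcop
      have : g = (g ^ i) ^ a * (g ^ p) ^ b := by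
        rw [← zpow_natCast g p, ← zpow_mul, ← zpow_mul, ← zpow_add]
        rw [show i * a + (p : ℤ) * b = 1 by linarith, zpow_one]
      rw [this]
      exact M.mul_mem (M.zpow_mem hgi _) (M.zpow_mem hgp _)
  exact hxK (frattini_le_coatom hco hx)

theorem extraspecial_crit {p : ℕ} [hpp : Fact p.Prime] {L : Type*} [Group L] [Finite L]
    (hL : IsPGroup p L) (z : L) (hz1 : z ≠ 1) (hzp : z ^ p = 1)
    (hcomm : ∀ x y : L, ⁅x, y⁆ ∈ Subgroup.zpowers z)
    (hpow : ∀ x : L, x ^ p ∈ Subgroup.zpowers z)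
    (hzc : ∀ x : L, x * z = z * x)
    (hnd : ∀ x : L, x ∉ Subgroup.zpowers z → ∃ y, x * y ≠ y * x)
    (hex : ∃ x : L, x ∉ Subgroup.zpowers z) : IsExtraspecial p L := by
  have hcard : Nat.card (Subgroup.zpowers z) = p := by
    rw [Nat.card_zpowers]
    exact orderOf_eq_prime hzp hz1
  have hcenter : Subgroup.center L = Subgroup.zpowers z := by
    apply le_antisymm
    · intro x hx
      by_contra hxz
      obtain ⟨y, hy⟩ := hnd x hxz
      exact hy (Subgroup.mem_center_iff.1 hx y).symm
    · rw [Subgroup.zpowers_le]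
      exact Subgroup.mem_center_iff.2 hzc
  have hcle : commutator L ≤ Subgroup.zpowers z := by
    rw [commutator_def, Subgroup.commutator_le]
    intro x _ y _
    exact hcomm x y
  have hc : commutator L = Subgroup.zpowers z := by
    apply Subgroup.eq_of_le_of_card_ge hcle
    rw [hcard]
    have hdvd := Subgroup.card_dvd_of_le hcle
    rw [hcard] at hdvd
    rcases (Nat.dvd_prime hpp.out).1 hdvd with h1 | h1
    · exfalso
      obtain ⟨x, hx⟩ := hex
      obtain ⟨y, hy⟩ := hnd x hx
      have hb := Subgroup.card_eq_one.1 h1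
      have hm : ⁅x, y⁆ ∈ commutator L :=
        Subgroup.commutator_mem_commutator (Subgroup.mem_top _) (Subgroup.mem_top _)
      rw [hb, Subgroup.mem_bot, commutatorElement_eq_one_iff_mul_comm] at hm
      exact hy hm
    · exact h1.ge
  refine ⟨hL, by rw [hcenter, hc], ?_, by rw [hcenter, hcard]⟩
  rw [hcenter]
  apply le_antisymm
  · rw [Subgroup.zpowers_le]
    rw [frattini, Order.radical]
    simp only [Subgroup.mem_iInf]
    intro M hM
    by_contra hzM
    have htop : M ⊔ Subgroup.zpowers z = ⊤ := by
      apply hM.2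
      refine lt_of_le_of_ne le_sup_left ?_
      intro h
      apply hzM
      rw [h]
      exact Subgroup.mem_sup_right (Subgroup.mem_zpowers z)
    have hn : (Subgroup.zpowers z).Normal := by
      rw [← hcenter]
      infer_instance
    have hle : commutator L ≤ M := by
      rw [commutator_def, Subgroup.commutator_le]
      intro x _ y _
      obtain ⟨m, hm, c, hcc, rfl⟩ := Subgroup.mem_sup_of_normal_right.1
        (htop.symm ▸ Subgroup.mem_top x : x ∈ M ⊔ Subgroup.zpowers z)
      obtain ⟨n, hn, d, hd, rfl⟩ := Subgroup.mem_sup_of_normal_right.1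
        (htop.symm ▸ Subgroup.mem_top y : y ∈ M ⊔ Subgroup.zpowers z)
      rw [← hcenter, Subgroup.mem_center_iff] at hcc hd
      have : ⁅m * c, n * d⁆ = ⁅m, n⁆ := by
        simp only [commutatorElement_def, mul_inv_rev]
        calc m * c * (n * d) * (c⁻¹ * m⁻¹) * (d⁻¹ * n⁻¹)
            = m * (c * n) * d * c⁻¹ * m⁻¹ * d⁻¹ * n⁻¹ := by group
          _ = m * (n * c) * d * c⁻¹ * m⁻¹ * d⁻¹ * n⁻¹ := by rw [hcc]
          _ = m * n * (c * d) * c⁻¹ * m⁻¹ * d⁻¹ * n⁻¹ := by group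
          _ = m * n * (d * c) * c⁻¹ * m⁻¹ * d⁻¹ * n⁻¹ := by rw [hcc]
          _ = m * n * (d * m⁻¹) * d⁻¹ * n⁻¹ := by group
          _ = m * n * (m⁻¹ * d) * d⁻¹ * n⁻¹ := by rw [hd]
          _ = m * n * m⁻¹ * n⁻¹ := by group
      rw [this]
      exact M.mul_mem (M.mul_mem (M.mul_mem hm hn) (M.inv_mem hm)) (M.inv_mem hn)
    apply hzM
    apply hle
    rw [hc]
    exact Subgroup.mem_zpowers z
  · exact frattini_le_of_crit z hcomm hpow

theorem isPGroup_Op (p : ℕ) [hp : Fact p.Prime] (X : Type*) [Group X] [Finite X] :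
    IsPGroup p (Op p X) := by
  obtain ⟨S⟩ : Nonempty (Sylow p X) := inferInstance
  refine S.2.to_le ?_
  apply sSup_le
  rintro P ⟨hn, hP⟩
  have h := hP.to_sup_of_normal_left S.2
  have := S.3 h le_sup_right
  rw [← this]
  exact le_sup_left

theorem le_Op {p : ℕ} {X : Type*} [Group X] {P : Subgroup X} (hn : P.Normal)
    (hP : IsPGroup p P) : P ≤ Op p X := le_sSup ⟨hn, hP⟩

theorem Op_map_le (p : ℕ) {X : Type*} {Y : Type*} [Group X] [Group Y] (f : X →* Y)
    (hf : Function.Surjective f) : (Op p X).map f ≤ Op p Y := by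
  unfold Op
  rw [(Subgroup.gc_map_comap _).l_sSup]
  refine iSup_le fun P => iSup_le fun hP => ?_
  exact le_sSup ⟨hP.1.map _ hf, hP.2.map _⟩

theorem Op_map_equiv (p : ℕ) {X : Type*} {Y : Type*} [Group X] [Group Y] (e : X ≃* Y) :
    (Op p X).map e.toMonoidHom = Op p Y := by
  apply le_antisymm (Op_map_le p _ e.surjective)
  intro y hy
  refine ⟨e.symm y, ?_, by simp⟩
  apply Op_map_le p e.symm.toMonoidHom e.symm.surjective
  exact ⟨y, hy, rfl⟩

end

section


set_option linter.all false

/-- basic data for an extraspecial 2-group -/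
structure Ext2 (L : Type*) [Group L] (z : L) : Prop where
  z1 : z ≠ 1
  zz : z * z = 1
  zc : ∀ x, z * x = x * z
  comm : ∀ x y : L, x * y = y * x ∨ x * y = y * x * z
  sq : ∀ x : L, x * x = 1 ∨ x * x = z
  nd : ∀ x : L, (∀ y, x * y = y * x) → x = 1 ∨ x = z

open Classical in
/-- commutator form -/
noncomputable def bt {L : Type*} [Group L] (x y : L) : ZMod 2 := if x * y = y * x then 0 else 1
open Classical in
/-- squaring form -/
noncomputable def sqf {L : Type*} [Group L] (x : L) : ZMod 2 := if x * x = 1 then 0 else 1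

theorem bt_eq_zero {L : Type*} [Group L] {x y : L} : bt x y = 0 ↔ x * y = y * x := by
  unfold bt; split_ifs with h <;> simp [h]
theorem sqf_eq_zero {L : Type*} [Group L] {x : L} : sqf x = 0 ↔ x * x = 1 := by
  unfold sqf; split_ifs with h <;> simp [h]
theorem zmod2_cases (a : ZMod 2) : a = 0 ∨ a = 1 := by
  revert a; decide
theorem zmod2_ne {a : ZMod 2} (h : a ≠ 0) : a = 1 := (zmod2_cases a).resolve_left h

theorem bt_symm {L : Type*} [Group L] (x y : L) : bt x y = bt y x := by
  by_cases h : x * y = y * x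
  · simp [bt, h]
  · simp [bt, h, Ne.symm h]
theorem bt_self {L : Type*} [Group L] (x : L) : bt x x = 0 := bt_eq_zero.2 rfl

namespace Ext2
variable {L : Type*} [Group L] {z : L}

theorem comm' (h : Ext2 L z) (x y : L) : x * y = y * x * (if bt x y = 0 then 1 else z) := by
  split_ifs with h0
  · rw [bt_eq_zero] at h0; simp [h0]
  · rw [bt_eq_zero] at h0; exact (h.comm x y).resolve_left h0

theorem of_comm' (h : Ext2 L z) (x y : L) (a : ZMod 2)
    (hh : x * y = y * x * (if a = 0 then 1 else z)) : bt x y = a := by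
  rcases zmod2_cases a with rfl | rfl
  · simp at hh; exact bt_eq_zero.2 hh
  · apply zmod2_ne
    rw [Ne, bt_eq_zero]
    intro h2
    simp at hh
    rw [h2] at hh
    exact h.z1 (mul_eq_left.1 hh.symm)

theorem zpow_add (h : Ext2 L z) (a b : ZMod 2) :
    (if a = 0 then (1 : L) else z) * (if b = 0 then 1 else z) = if a + b = 0 then 1 else z := by
  rcases zmod2_cases a with rfl | rfl <;> rcases zmod2_cases b with rfl | rfl <;> simp [h.zz]
  intro h; exact absurd (by decide) h

theorem zpow_c (h : Ext2 L z) (a : ZMod 2) (x : L) :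
    (if a = 0 then (1 : L) else z) * x = x * (if a = 0 then 1 else z) := by
  split_ifs <;> simp [h.zc]

theorem bt_mul_left (h : Ext2 L z) (x y w : L) : bt (x * y) w = bt x w + bt y w := by
  apply h.of_comm'
  rw [← h.zpow_add]
  have h1 := h.comm' x w
  have h2 := h.comm' y w
  calc x * y * w = x * (y * w) := by group
    _ = (x * w) * y * (if bt y w = 0 then 1 else z) := by nth_rw 1 [h2]; simp only [mul_assoc]
    _ = w * x * ((if bt x w = 0 then 1 else z) * y) * (if bt y w = 0 then 1 else z) := by
        nth_rw 1 [h1]; simp only [mul_assoc]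
    _ = _ := by rw [h.zpow_c]; simp only [mul_assoc]

theorem bt_mul_right (h : Ext2 L z) (x y w : L) : bt w (x * y) = bt w x + bt w y := by
  rw [bt_symm, h.bt_mul_left, bt_symm x, bt_symm y]

theorem sq' (h : Ext2 L z) (x : L) : x * x = (if sqf x = 0 then 1 else z) := by
  split_ifs with h0
  · rw [sqf_eq_zero] at h0; exact h0
  · rw [sqf_eq_zero] at h0; exact (h.sq x).resolve_left h0

theorem of_sq' (h : Ext2 L z) (x : L) (a : ZMod 2)
    (hh : x * x = (if a = 0 then 1 else z)) : sqf x = a := by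
  rcases zmod2_cases a with rfl | rfl
  · simp at hh; exact sqf_eq_zero.2 hh
  · apply zmod2_ne
    rw [Ne, sqf_eq_zero]
    intro h2
    simp at hh
    rw [h2] at hh
    exact h.z1 hh.symm

theorem sqf_mul (h : Ext2 L z) (x y : L) : sqf (x * y) = sqf x + sqf y + bt x y := by
  apply h.of_sq'
  rw [← h.zpow_add, ← h.zpow_add, ← h.sq', ← h.sq', bt_symm]
  calc x * y * (x * y) = x * (y * x) * y := by group
    _ = x * x * (y * ((if bt y x = 0 then 1 else z) * y)) := by rw [h.comm' y x]; simp only [mul_assoc]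
    _ = _ := by rw [h.zpow_c]; simp only [mul_assoc]

theorem bt_z (h : Ext2 L z) (x : L) : bt z x = 0 := bt_eq_zero.2 (h.zc x)
theorem bt_z' (h : Ext2 L z) (x : L) : bt x z = 0 := bt_eq_zero.2 (h.zc x).symm
theorem sqf_z (h : Ext2 L z) : sqf z = 0 := sqf_eq_zero.2 h.zz

theorem exists_bt (h : Ext2 L z) (x : L) (hx : ¬ (x = 1 ∨ x = z)) : ∃ y, bt x y = 1 := by
  by_contra hc
  push Not at hc
  apply hx
  apply h.nd
  intro y
  rw [← bt_eq_zero]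
  exact (zmod2_cases _).resolve_right (hc y)

theorem exists_ker (h : Ext2 L z) (hL : Nat.card L = 128) {A : Type*} [AddCommGroup A] [Finite A]
    (hA : Nat.card A < 64) (f : L → A) (hf : ∀ x y, f (x * y) = f x + f y) :
    ∃ w, ¬ (w = 1 ∨ w = z) ∧ f w = 0 := by
  have : Finite L := Nat.finite_of_card_ne_zero (by rw [hL]; norm_num)
  let F : L →* Multiplicative A := MonoidHom.mk' (fun x => Multiplicative.ofAdd (f x)) (by
    intro x y; simp [hf])
  by_contra hc
  push Not at hc
  have hk : (F.ker : Set L) ⊆ {1, z} := by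
    intro x hx
    by_contra h2
    simp only [Set.mem_insert_iff, Set.mem_singleton_iff] at h2
    apply hc x (not_or.1 h2)
    have : F x = 1 := hx
    exact this
  have h1 : Nat.card F.ker ≤ 2 := by
    have := Set.ncard_le_ncard hk
    have h3 : Set.ncard ({1, z} : Set L) = 2 := Set.ncard_pair h.z1.symm
    rw [h3] at this
    exact this
  have h2 := F.ker.card_mul_index
  rw [Subgroup.index_ker, hL] at h2
  have h3 : Nat.card F.range ≤ Nat.card A := Subgroup.card_le_card_group _
  nlinarith

end Ext2

end

section


set_option linter.all false

/-- power by an element of `ZMod 2` -/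
def pw {L : Type*} [Group L] (g : L) (a : ZMod 2) : L := if a = 0 then 1 else g

theorem zmod2_add_self (a : ZMod 2) : a + a = 0 := by revert a; decide

namespace Ext2
variable {L : Type*} [Group L] {z : L}

theorem bt_one (h : Ext2 L z) (x : L) : bt 1 x = 0 := bt_eq_zero.2 (by simp)
theorem sqf_one (h : Ext2 L z) : sqf (1 : L) = 0 := sqf_eq_zero.2 (by simp)
theorem bt_inv (h : Ext2 L z) (x y : L) : bt x⁻¹ y = bt x y := by
  have h1 := h.bt_mul_left x x⁻¹ y
  rw [mul_inv_cancel, h.bt_one] at h1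
  have h2 := zmod2_add_self (bt x y)
  rw [← h2] at h1
  exact (add_left_cancel h1).symm

theorem bt_pw (h : Ext2 L z) (g y : L) (a : ZMod 2) : bt (pw g a) y = a * bt g y := by
  rcases zmod2_cases a with rfl | rfl <;> simp [pw, h.bt_one]
theorem bt_pw' (h : Ext2 L z) (g y : L) (a : ZMod 2) : bt y (pw g a) = a * bt y g := by
  rw [bt_symm, h.bt_pw, bt_symm g]
theorem sqf_pw (h : Ext2 L z) (g : L) (a : ZMod 2) : sqf (pw g a) = a * sqf g := by
  rcases zmod2_cases a with rfl | rfl <;> simp [pw, h.sqf_one]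

theorem adjust (h : Ext2 L z) (a b : L) (hab : bt a b = 1) (u : L) :
    ∃ u', bt u' a = 0 ∧ bt u' b = 0 ∧ ∀ v, bt a v = 0 → bt b v = 0 → bt u' v = bt u v := by
  refine ⟨u * pw a (bt u b) * pw b (bt u a), ?_, ?_, ?_⟩
  · simp [h.bt_mul_left, h.bt_pw, bt_self, bt_symm b a, hab, zmod2_add_self]
  · simp [h.bt_mul_left, h.bt_pw, bt_self, hab, zmod2_add_self]
  · intro v h1 h2
    simp [h.bt_mul_left, h.bt_pw, h1, h2]

theorem noncentral_of_bt (h : Ext2 L z) {x y : L} (hxy : bt x y = 1) : ¬ (x = 1 ∨ x = z) := by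
  rintro (rfl | rfl)
  · rw [h.bt_one] at hxy; exact zero_ne_one hxy
  · rw [h.bt_z] at hxy; exact zero_ne_one hxy

theorem minus (h : Ext2 L z) (hL : Nat.card L = 128)
    (hm : ∀ A : Subgroup L, (∀ x ∈ A, x * x = 1) → Nat.card A ≤ 8)
    (r s w1 w2 v v' : L) (h1 : sqf r = 0) (h2 : sqf w1 = 0) (h3 : sqf v = 0)
    (h4 : bt r s = 1) (h5 : bt w1 w2 = 1) (h6 : bt v v' = 1)
    (h7 : bt r w1 = 0) (h8 : bt r v = 0) (h9 : bt w1 v = 0)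
    (h10 : bt r w2 = 0) (h11 : bt r v' = 0) (h12 : bt w1 s = 0) (h13 : bt w1 v' = 0)
    (h14 : bt v s = 0) (h15 : bt v w2 = 0) : False := by
  have : Finite L := Nat.finite_of_card_ne_zero (by rw [hL]; norm_num)
  set S : Set L := {z, r, w1, v} with hS
  let A := Subgroup.closure S
  have gen : ∀ g : L, (∀ x ∈ S, bt x g = 0) → ∀ x ∈ A, bt x g = 0 := by
    intro g hg x hx
    induction hx using Subgroup.closure_induction with
    | mem x hx => exact hg x hx
    | one => exact h.bt_one _
    | mul x y _ _ hx hy => rw [h.bt_mul_left, hx, hy, add_zero]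
    | inv x _ hx => rw [h.bt_inv, hx]
  have c1 : ∀ g ∈ S, ∀ x ∈ A, bt x g = 0 := by
    intro g hg
    apply gen
    simp only [hS, Set.mem_insert_iff, Set.mem_singleton_iff] at hg ⊢
    rintro x (rfl | rfl | rfl | rfl) <;> rcases hg with rfl | rfl | rfl | rfl <;>
      first | exact bt_self _ | exact h.bt_z _ | exact h.bt_z' _ | assumption |
        (rw [bt_symm]; assumption)
  have c2 : ∀ g ∈ A, ∀ x ∈ A, bt x g = 0 := by
    intro g hg
    apply gen
    intro x hx
    rw [bt_symm]
    exact c1 x hx g hg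
  have c3 : ∀ x ∈ A, sqf x = 0 := by
    intro x hx
    induction hx using Subgroup.closure_induction with
    | mem x hx =>
      simp only [hS, Set.mem_insert_iff, Set.mem_singleton_iff] at hx
      rcases hx with rfl | rfl | rfl | rfl
      · exact h.sqf_z
      all_goals assumption
    | one => exact h.sqf_one
    | mul x y hx0 hy0 hx hy => rw [h.sqf_mul, hx, hy, c2 y hy0 x hx0]; simp
    | inv x _ hx =>
      rw [sqf_eq_zero] at hx ⊢
      rw [← mul_inv_rev, hx, inv_one]
  have hA := hm A (fun x hx => sqf_eq_zero.1 (c3 x hx))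
  let F : A →* Multiplicative (ZMod 2 × ZMod 2 × ZMod 2) :=
    MonoidHom.mk' (fun x => Multiplicative.ofAdd (bt x.1 s, bt x.1 w2, bt x.1 v')) (by
      intro x y; simp [h.bt_mul_left, ← ofAdd_add])
  have hsurj : Function.Surjective F := by
    intro t
    obtain ⟨⟨a, b, c⟩, rfl⟩ := Multiplicative.ofAdd.surjective t
    have hp : ∀ g ∈ S, ∀ a, pw g a ∈ A := by
      intro g hg a
      unfold pw
      split_ifs
      · exact A.one_mem
      · exact Subgroup.subset_closure hg
    refine ⟨⟨pw r a * pw w1 b * pw v c, A.mul_mem (A.mul_mem (hp _ ?_ _) (hp _ ?_ _)) (hp _ ?_ _)⟩, ?_⟩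
    · simp [hS]
    · simp [hS]
    · simp [hS]
    · simp [F, h.bt_mul_left, h.bt_pw, h4, h5, h6, h10, h11, h12, h13, h14, h15]
  have hcard := F.ker.card_mul_index
  rw [Subgroup.index_ker, MonoidHom.range_eq_top.2 hsurj] at hcard
  have e8 : Nat.card (⊤ : Subgroup (Multiplicative (ZMod 2 × ZMod 2 × ZMod 2))) = 8 := by
    rw [Subgroup.card_top]; simp
  rw [e8] at hcard
  have hk : 1 < Nat.card F.ker := by
    rw [Subgroup.one_lt_card_iff_ne_bot]
    intro hb
    have hz : (⟨z, Subgroup.subset_closure (by simp [hS])⟩ : A) ∈ F.ker := by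
      rw [MonoidHom.mem_ker]
      simp [F, h.bt_z]
    rw [hb, Subgroup.mem_bot] at hz
    exact h.z1 (congrArg Subtype.val hz)
  omega

theorem exists_frame (h : Ext2 L z) (hL : Nat.card L = 128)
    (hm : ∀ A : Subgroup L, (∀ x ∈ A, x * x = 1) → Nat.card A ≤ 8)
    (r : L) (hr : ¬ (r = 1 ∨ r = z)) (hr2 : r * r = 1) :
    ∃ s w1 w2 w3 w4 : L, sqf r = 0 ∧ sqf s = 0 ∧ sqf w1 = 0 ∧ sqf w2 = 0 ∧ sqf w3 = 1 ∧ sqf w4 = 1 ∧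
      bt r s = 1 ∧ bt w1 w2 = 1 ∧ bt w3 w4 = 1 ∧ bt w1 r = 0 ∧ bt w1 s = 0 ∧ bt w2 r = 0 ∧ bt w2 s = 0 ∧
      bt w3 r = 0 ∧ bt w3 s = 0 ∧ bt w3 w1 = 0 ∧ bt w3 w2 = 0 ∧
      bt w4 r = 0 ∧ bt w4 s = 0 ∧ bt w4 w1 = 0 ∧ bt w4 w2 = 0 := by
  have hr2 := sqf_eq_zero.2 hr2
  obtain ⟨s, hs, hrs⟩ : ∃ s, sqf s = 0 ∧ bt r s = 1 := by
    obtain ⟨y, hy⟩ := h.exists_bt r hr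
    rcases zmod2_cases (sqf y) with h0 | h0
    · exact ⟨y, h0, hy⟩
    · refine ⟨y * r, ?_, ?_⟩
      · rw [h.sqf_mul, h0, hr2, bt_symm, hy]; decide
      · rw [h.bt_mul_right, hy, bt_self]; simp
  obtain ⟨x, hx, hx0⟩ := h.exists_ker hL (A := ZMod 2 × ZMod 2) (by simp)
    (fun x => (bt x r, bt x s)) (by intro x y; simp [h.bt_mul_left])
  obtain ⟨hxr, hxs⟩ := Prod.mk.inj hx0
  obtain ⟨u0, hu0⟩ := h.exists_bt x hx
  obtain ⟨u, hur, hus, hu⟩ := h.adjust r s hrs u0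
  have hxu : bt x u = 1 := by rw [bt_symm, hu _ (by rw [bt_symm, hxr]) (by rw [bt_symm, hxs]), bt_symm, hu0]
  obtain ⟨y, hy, hy0⟩ := h.exists_ker hL (A := ZMod 2 × ZMod 2 × ZMod 2 × ZMod 2) (by simp)
    (fun y => (bt y r, bt y s, bt y x, bt y u)) (by intro x y; simp [h.bt_mul_left])
  simp only [Prod.mk_eq_zero] at hy0
  obtain ⟨hyr, hys, hyx, hyu⟩ := hy0
  obtain ⟨w1, hw1, hw1s, hw1r, hw1ss⟩ : ∃ w1, ¬ (w1 = 1 ∨ w1 = z) ∧ sqf w1 = 0 ∧ bt w1 r = 0 ∧ bt w1 s = 0 := by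
    rcases zmod2_cases (sqf x) with h0 | h0
    · exact ⟨x, hx, h0, hxr, hxs⟩
    rcases zmod2_cases (sqf y) with h1 | h1
    · exact ⟨y, hy, h1, hyr, hys⟩
    refine ⟨x * y, h.noncentral_of_bt (y := u) ?_, ?_, ?_, ?_⟩
    · rw [h.bt_mul_left, hxu, hyu, add_zero]
    · rw [h.sqf_mul, h0, h1, bt_symm, hyx]; decide
    · rw [h.bt_mul_left, hxr, hyr, add_zero]
    · rw [h.bt_mul_left, hxs, hys, add_zero]
  obtain ⟨w2, h12, h2s, h2r, h2ss⟩ : ∃ w2, bt w1 w2 = 1 ∧ sqf w2 = 0 ∧ bt w2 r = 0 ∧ bt w2 s = 0 := by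
    obtain ⟨y0, hy0⟩ := h.exists_bt w1 hw1
    obtain ⟨y, hyr, hys, hy⟩ := h.adjust r s hrs y0
    have hy1 : bt w1 y = 1 := by
      rw [bt_symm, hy _ (by rw [bt_symm, hw1r]) (by rw [bt_symm, hw1ss]), bt_symm, hy0]
    rcases zmod2_cases (sqf y) with h0 | h0
    · exact ⟨y, hy1, h0, hyr, hys⟩
    · refine ⟨y * w1, ?_, ?_, ?_, ?_⟩
      · rw [h.bt_mul_right, hy1, bt_self]; simp
      · rw [h.sqf_mul, h0, hw1s, bt_symm, hy1]; decide
      · rw [h.bt_mul_left, hyr, hw1r, add_zero]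
      · rw [h.bt_mul_left, hys, hw1ss, add_zero]
  obtain ⟨w3, hw3, hw30⟩ := h.exists_ker hL (A := ZMod 2 × ZMod 2 × ZMod 2 × ZMod 2) (by simp)
    (fun y => (bt y r, bt y s, bt y w1, bt y w2)) (by intro x y; simp [h.bt_mul_left])
  simp only [Prod.mk_eq_zero] at hw30
  obtain ⟨h3r, h3s, h31, h32⟩ := hw30
  obtain ⟨w4, h34, h4r, h4s, h41, h42⟩ : ∃ w4, bt w3 w4 = 1 ∧ bt w4 r = 0 ∧ bt w4 s = 0 ∧ bt w4 w1 = 0 ∧ bt w4 w2 = 0 := by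
    obtain ⟨y0, hy0⟩ := h.exists_bt w3 hw3
    obtain ⟨y, hyr, hys, hy⟩ := h.adjust r s hrs y0
    obtain ⟨y', hy1, hy2, hy'⟩ := h.adjust w1 w2 h12 y
    refine ⟨y', ?_, ?_, ?_, hy1, hy2⟩
    · rw [bt_symm, hy' _ (by rw [bt_symm, h31]) (by rw [bt_symm, h32]),
        hy _ (by rw [bt_symm, h3r]) (by rw [bt_symm, h3s]), bt_symm, hy0]
    · rw [hy' _ hw1r h2r, hyr]
    · rw [hy' _ hw1ss h2ss, hys]
  have h3sq : sqf w3 = 1 := by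
    apply zmod2_ne
    intro h0
    exact h.minus hL hm r s w1 w2 w3 w4 hr2 hw1s h0 hrs h12 h34 (by rw [bt_symm, hw1r])
      (by rw [bt_symm, h3r]) (by rw [bt_symm, h31]) (by rw [bt_symm, h2r]) (by rw [bt_symm, h4r])
      hw1ss (by rw [bt_symm, h41]) h3s h32
  have h4sq : sqf w4 = 1 := by
    apply zmod2_ne
    intro h0
    exact h.minus hL hm r s w1 w2 w4 w3 hr2 hw1s h0 hrs h12 (by rw [bt_symm, h34]) (by rw [bt_symm, hw1r])
      (by rw [bt_symm, h4r]) (by rw [bt_symm, h41]) (by rw [bt_symm, h2r]) (by rw [bt_symm, h3r])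
      hw1ss (by rw [bt_symm, h31]) h4s h42
  exact ⟨s, w1, w2, w3, w4, hr2, hs, hw1s, h2s, h3sq, h4sq, hrs, h12, h34, hw1r, hw1ss, h2r, h2ss,
    h3r, h3s, h31, h32, h4r, h4s, h41, h42⟩

end Ext2

end

section


set_option linter.all false
open scoped commutatorElement

theorem exists_ext2 {L : Type*} [Group L] (h : IsExtraspecial 2 L) : ∃ z : L, Ext2 L z := by
  obtain ⟨_, hc, _, h2⟩ := h
  have : Finite (Subgroup.center L) := Nat.finite_of_card_ne_zero (by rw [h2]; norm_num)
  obtain ⟨⟨z, hzc⟩, hz1⟩ : ∃ z : Subgroup.center L, z ≠ 1 := by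
    have : Nontrivial (Subgroup.center L) := Finite.one_lt_card_iff_nontrivial.1 (by omega)
    exact exists_ne 1
  have hz1' : z ≠ 1 := fun h => hz1 (Subtype.ext h)
  have hzc' := Subgroup.mem_center_iff.1 hzc
  have all : ∀ x ∈ Subgroup.center L, x = 1 ∨ x = z := by
    intro x hx
    by_contra hcon
    push Not at hcon
    have hs : ({1, z, x} : Set L) ⊆ Subgroup.center L := by
      rintro y (rfl | rfl | rfl)
      · exact Subgroup.one_mem _
      · exact hzc
      · exact hx
    have h3 : Set.ncard ({1, z, x} : Set L) = 3 :=
      Set.ncard_eq_three.2 ⟨1, z, x, hz1'.symm, hcon.1.symm, hcon.2.symm, rfl⟩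
    have := Set.ncard_le_ncard hs (Set.toFinite _)
    rw [h3] at this
    have h4 : Set.ncard (Subgroup.center L : Set L) = 2 := h2
    omega
  have hzz : z * z = 1 := by
    have h1 : (⟨z, hzc⟩ : Subgroup.center L) ^ 2 = 1 := by
      rw [← h2]; exact pow_card_eq_one'
    have := congrArg Subtype.val h1
    simpa [pow_two] using this
  have hcomm : ∀ x y : L, x * y = y * x ∨ x * y = y * x * z := by
    intro x y
    have hm : ⁅x, y⁆ ∈ Subgroup.center L := by
      rw [hc]
      exact Subgroup.commutator_mem_commutator (Subgroup.mem_top _) (Subgroup.mem_top _)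
    have e : x * y = ⁅x, y⁆ * (y * x) := by simp [commutatorElement_def, mul_assoc]
    rcases all _ hm with h1 | h1
    · left; rw [e, h1, one_mul]
    · right; rw [e, h1]; exact (hzc' _).symm
  refine ⟨z, hz1', hzz, fun x => (hzc' x).symm, hcomm, ?_, ?_⟩
  · intro x
    apply all
    rw [Subgroup.mem_center_iff]
    intro y
    rcases hcomm y x with h1 | h1
    · rw [← mul_assoc, h1, mul_assoc, h1, mul_assoc]
    · calc y * (x * x) = (y * x) * x := by group
        _ = x * y * (z * x) := by rw [h1]; group
        _ = x * (y * x) * z := by rw [← hzc' x]; group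
        _ = x * x * y * (z * z) := by rw [h1]; group
        _ = x * x * y := by rw [hzz, mul_one]
  · intro x hx
    apply all
    rw [Subgroup.mem_center_iff]
    intro y
    exact (hx y).symm

abbrev WW := ZMod 2 × ZMod 2 × ZMod 2 × ZMod 2
/-- the bilinear form -/
def B4 (u v : WW) : ZMod 2 :=
  u.1 * v.2.1 + u.2.1 * v.1 + u.2.2.1 * v.2.2.2 + u.2.2.2 * v.2.2.1
/-- the quadratic form of minus type -/
def q4 (u : WW) : ZMod 2 := u.1 * u.2.1 + u.2.2.1 + u.2.2.1 * u.2.2.2 + u.2.2.2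

structure Fr (K : Type*) [Group K] (R : Subgroup K) (z r : K) (α β : K → ZMod 2)
    (φ : K → WW) : Prop where
  Rn : R.Normal
  z1 : z ≠ 1
  zR : z ∈ R
  zz : z * z = 1
  rR : r ∈ R
  rr : r * r = 1
  zK : ∀ g, z * g = g * z
  αmul : ∀ x ∈ R, ∀ y ∈ R, α (x * y) = α x + α y
  βmul : ∀ x ∈ R, ∀ y ∈ R, β (x * y) = β x + β y
  φmul : ∀ x ∈ R, ∀ y ∈ R, φ (x * y) = φ x + φ y
  ker : ∀ x ∈ R, α x = 0 → β x = 0 → φ x = 0 → x = 1 ∨ x = z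
  αz : α z = 0
  βz : β z = 0
  φz : φ z = 0
  αr : α r = 1
  βr : β r = 0
  φr : φ r = 0
  surj : ∀ a b w, ∃ x ∈ R, α x = a ∧ β x = b ∧ φ x = w
  comm : ∀ x ∈ R, ∀ y ∈ R,
    x * y = y * x * (if α x * β y + β x * α y + B4 (φ x) (φ y) = 0 then 1 else z)
  sq : ∀ x ∈ R, x * x = if α x * β x + q4 (φ x) = 0 then 1 else z
  selfc : ∀ g, (∀ x ∈ R, g * x = x * g) → g ∈ R

theorem exists_Fr {K : Type*} [Group K] [Finite K] (R : Subgroup K) [hRn : R.Normal]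
    (hex : IsExtraspecial 2 R) (hcard : Nat.card R = 2 ^ 7)
    (hm : ∀ A : Subgroup K, A ≤ R → (∀ x ∈ A, x ^ 2 = 1) → Nat.card A ≤ 2 ^ 3)
    (hsc : Subgroup.centralizer (R : Set K) ≤ R) (r : K) (hrR : r ∈ R) (hr2 : r * r = 1)
    (hrn : r ∉ Subgroup.centralizer (R : Set K)) :
    ∃ z α β φ, Fr K R z r α β φ := by
  obtain ⟨z, h⟩ := exists_ext2 hex
  have hL : Nat.card R = 128 := hcard
  have hm' : ∀ A : Subgroup R, (∀ x ∈ A, x * x = 1) → Nat.card A ≤ 8 := by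
    intro A hA
    have := hm (A.map R.subtype) (by rintro x ⟨y, _, rfl⟩; exact y.2) (by
      rintro x ⟨y, hy, rfl⟩
      have := congrArg Subtype.val (hA y hy)
      simpa [pow_two] using this)
    rwa [Subgroup.card_map_of_injective R.subtype_injective] at this
  have hcen : ∀ x : R, (x = 1 ∨ x = z) → ∀ y : R, x * y = y * x := by
    rintro x (rfl | rfl) y
    · simp
    · exact h.zc y
  have hrnc : ¬ ((⟨r, hrR⟩ : R) = 1 ∨ (⟨r, hrR⟩ : R) = z) := by
    intro h1
    apply hrn
    rw [Subgroup.mem_centralizer_iff]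
    intro y hy
    exact (congrArg Subtype.val (hcen _ h1 ⟨y, hy⟩)).symm
  obtain ⟨s, w1, w2, w3, w4, hr, hs, h1, h2, h3, h4, hrs, h12, h34, h1r, h1s, h2r, h2s, h3r, h3s, h31,
    h32, h4r, h4s, h41, h42⟩ := h.exists_frame hL hm' ⟨r, hrR⟩ hrnc (Subtype.ext hr2)
  generalize hr' : (⟨r, hrR⟩ : R) = r' at *
  have hsr : bt s r' = 1 := by rw [bt_symm, hrs]
  have h21 : bt w2 w1 = 1 := by rw [bt_symm, h12]
  have h43 : bt w4 w3 = 1 := by rw [bt_symm, h34]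
  have hr1 : bt r' w1 = 0 := by rw [bt_symm, h1r]
  have hr2' : bt r' w2 = 0 := by rw [bt_symm, h2r]
  have hr3 : bt r' w3 = 0 := by rw [bt_symm, h3r]
  have hr4 : bt r' w4 = 0 := by rw [bt_symm, h4r]
  have hs1 : bt s w1 = 0 := by rw [bt_symm, h1s]
  have hs2 : bt s w2 = 0 := by rw [bt_symm, h2s]
  have hs3 : bt s w3 = 0 := by rw [bt_symm, h3s]
  have hs4 : bt s w4 = 0 := by rw [bt_symm, h4s]
  have h13 : bt w1 w3 = 0 := by rw [bt_symm, h31]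
  have h14 : bt w1 w4 = 0 := by rw [bt_symm, h41]
  have h23 : bt w2 w3 = 0 := by rw [bt_symm, h32]
  have h24 : bt w2 w4 = 0 := by rw [bt_symm, h42]
  let e : ZMod 2 × ZMod 2 × WW → R := fun v => pw r' v.1 * pw s v.2.1 * pw w1 v.2.2.1 *
    pw w2 v.2.2.2.1 * pw w3 v.2.2.2.2.1 * pw w4 v.2.2.2.2.2
  let Φ : R → ZMod 2 × ZMod 2 × WW := fun x =>
    (bt x s, bt x r', bt x w2, bt x w1, bt x w4, bt x w3)
  have Φe : ∀ v, Φ (e v) = v := by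
    rintro ⟨a, b, c, d, f, g⟩
    simp [Φ, e, h.bt_mul_left, h.bt_pw, bt_self, *]
  have Φmul : ∀ x y, Φ (x * y) = Φ x + Φ y := by
    intro x y; simp [Φ, h.bt_mul_left]
  have Φz : Φ z = 0 := by simp [Φ, h.bt_z]
  let F : R →* Multiplicative (ZMod 2 × ZMod 2 × WW) :=
    MonoidHom.mk' (fun x => Multiplicative.ofAdd (Φ x)) (by
      intro x y; simp [Φmul, ← ofAdd_add])
  have hsurj : Function.Surjective F := by
    intro t
    obtain ⟨v, rfl⟩ := Multiplicative.ofAdd.surjective t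
    exact ⟨e v, by simp [F, Φe]⟩
  have hcardk := F.ker.card_mul_index
  rw [Subgroup.index_ker, MonoidHom.range_eq_top.2 hsurj, hL] at hcardk
  have e8 : Nat.card (⊤ : Subgroup (Multiplicative (ZMod 2 × ZMod 2 × WW))) = 64 := by
    rw [Subgroup.card_top]; simp
  rw [e8] at hcardk
  have hk2 : Nat.card F.ker = 2 := by omega
  have hker : ∀ x : R, Φ x = 0 → x = 1 ∨ x = z := by
    intro x hx
    by_contra hcon
    push Not at hcon
    have hs : ({1, z, x} : Set R) ⊆ F.ker := by
      rintro y (rfl | rfl | rfl)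
      · exact Subgroup.one_mem _
      · exact Φz
      · exact hx
    have h3 : Set.ncard ({1, z, x} : Set R) = 3 :=
      Set.ncard_eq_three.2 ⟨1, z, x, h.z1.symm, hcon.1.symm, hcon.2.symm, rfl⟩
    have := Set.ncard_le_ncard hs (Set.toFinite _)
    rw [h3] at this
    have h4 : Set.ncard (F.ker : Set R) = 2 := hk2
    omega
  have hdec : ∀ x : R, ∃ k, (k = 1 ∨ k = z) ∧ x = e (Φ x) * k := by
    intro x
    refine ⟨(e (Φ x))⁻¹ * x, hker _ ?_, by group⟩
    have := Φmul (e (Φ x)) ((e (Φ x))⁻¹ * x)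
    rw [mul_inv_cancel_left, Φe] at this
    exact (left_eq_add.1 this)
  have hB : ∀ x y : R, bt x y = (Φ x).1 * (Φ y).2.1 + (Φ x).2.1 * (Φ y).1 + B4 (Φ x).2.2 (Φ y).2.2 := by
    intro x y
    obtain ⟨k, hk, hy⟩ := hdec y
    have hxk : bt x k = 0 := by
      rw [bt_symm, bt_eq_zero]; exact hcen k hk x
    generalize Φ y = v at hy
    have hy' : Φ y = v := by
      rw [hy, Φmul, Φe]
      rcases hk with rfl | rfl
      · have : Φ 1 = 0 := by simp [Φ, h.bt_one]
        rw [this, add_zero]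
      · rw [Φz, add_zero]
    obtain ⟨a, b, c, d, f, g⟩ := v
    rw [hy, h.bt_mul_right, hxk]
    simp only [e, h.bt_mul_right, h.bt_pw', B4, Φ]
    ring
  have hq : ∀ x : R, sqf x = (Φ x).1 * (Φ x).2.1 + q4 (Φ x).2.2 := by
    clear hB
    intro x
    obtain ⟨k, hk, hy⟩ := hdec x
    have hxk : ∀ x, bt x k = 0 := by
      intro x
      rw [bt_symm, bt_eq_zero]; exact hcen k hk x
    have hkq : sqf k = 0 := by
      rcases hk with rfl | rfl
      · exact h.sqf_one
      · exact h.sqf_z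
    generalize Φ x = v at hy
    obtain ⟨a, b, c, d, f, g⟩ := v
    rw [hy, h.sqf_mul, hxk, hkq]
    simp only [e, h.sqf_mul, h.bt_mul_left, h.sqf_pw, h.bt_pw, h.bt_pw', q4, hr, hs, h1, h2, h3, h4,
      hrs, hr1, hr2', hr3, hr4, hs1, hs2, hs3, hs4, h12, h13, h14, h23, h24, h34]
    ring
  classical
  let Ψ : K → ZMod 2 × ZMod 2 × WW := fun x => if hx : x ∈ R then Φ ⟨x, hx⟩ else 0
  have Ψ' : ∀ x (hx : x ∈ R), Ψ x = Φ ⟨x, hx⟩ := fun x hx => dif_pos hx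
  have hΨm : ∀ x ∈ R, ∀ y ∈ R, Ψ (x * y) = Ψ x + Ψ y := by
    intro x hx y hy
    rw [Ψ' _ hx, Ψ' _ hy, Ψ' _ (R.mul_mem hx hy), ← Φmul]; rfl
  have hΨz : Ψ z = 0 := by rw [Ψ' _ z.2]; exact Φz
  have hΨr : Ψ r = (1, 0, 0) := by
    rw [Ψ' _ hrR, hr']
    simp [Φ, bt_self, hrs, hr1, hr2', hr3, hr4]
  refine ⟨z, fun x => (Ψ x).1, fun x => (Ψ x).2.1, fun x => (Ψ x).2.2, hRn,
    fun h0 => h.z1 (Subtype.ext h0), z.2, congrArg Subtype.val h.zz, hrR, hr2, ?_, ?_, ?_, ?_, ?_,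
    by simp only [hΨz]; rfl, by simp only [hΨz]; rfl, by simp only [hΨz]; rfl,
    by simp only [hΨr], by simp only [hΨr], by simp only [hΨr], ?_, ?_, ?_, ?_⟩
  · intro g
    have h1 : g * z * g⁻¹ ∈ R := hRn.conj_mem _ z.2 g
    have h2 : (⟨g * z * g⁻¹, h1⟩ : R) = 1 ∨ (⟨g * z * g⁻¹, h1⟩ : R) = z := by
      apply h.nd
      intro y
      have h3 : g⁻¹ * y * g ∈ R := by simpa using hRn.conj_mem _ y.2 g⁻¹
      have h4 := congrArg Subtype.val (h.zc ⟨_, h3⟩)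
      simp only [Subgroup.coe_mul] at h4
      apply Subtype.ext
      simp only [Subgroup.coe_mul]
      calc g * z * g⁻¹ * y = g * (z * (g⁻¹ * y * g)) * g⁻¹ := by group
        _ = _ := by rw [h4]; group
    rcases h2 with h2 | h2
    · exfalso
      have h2 := congrArg Subtype.val h2
      simp only [Subgroup.coe_one] at h2
      apply h.z1
      apply Subtype.ext
      simpa using h2
    · have h2 := congrArg Subtype.val h2
      simp only at h2
      exact (mul_inv_eq_iff_eq_mul.1 h2).symm
  · intro x hx y hy
    simp only [hΨm x hx y hy]; rfl
  · intro x hx y hy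
    simp only [hΨm x hx y hy]; rfl
  · intro x hx y hy
    simp only [hΨm x hx y hy]; rfl
  · intro x hx h1 h2 h3
    simp only [Ψ' _ hx] at h1 h2 h3
    rcases hker ⟨x, hx⟩ (Prod.ext h1 (Prod.ext h2 h3)) with h | h
    · left; exact congrArg Subtype.val h
    · right; exact congrArg Subtype.val h
  · intro a b w
    refine ⟨e (a, b, w), (e _).2, ?_⟩
    simp only [Ψ' _ (e (a, b, w)).2, Subtype.coe_eta, Φe, and_self]
  · intro x hx y hy
    have h1 := h.comm' ⟨x, hx⟩ ⟨y, hy⟩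
    rw [hB] at h1
    simp only [Ψ' _ hx, Ψ' _ hy]
    have h1 := congrArg Subtype.val h1
    split_ifs at h1 ⊢ <;> simpa using h1
  · intro x hx
    have h1 := h.sq' ⟨x, hx⟩
    rw [hq] at h1
    simp only [Ψ' _ hx]
    have h1 := congrArg Subtype.val h1
    split_ifs at h1 ⊢ <;> simpa using h1
  · intro g hg
    apply hsc
    rw [Subgroup.mem_centralizer_iff]
    intro x hx
    exact (hg x hx).symm

end

section


set_option linter.all false

theorem B4_polar : ∀ u v : WW, B4 u v = q4 (u + v) + q4 u + q4 v := by decide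
theorem B4_add_left (u v w : WW) : B4 (u + v) w = B4 u w + B4 v w := by
  simp only [B4, Prod.fst_add, Prod.snd_add]; ring
theorem B4_add_right (u v w : WW) : B4 w (u + v) = B4 w u + B4 w v := by
  simp only [B4, Prod.fst_add, Prod.snd_add]; ring
theorem B4_zero_left (w : WW) : B4 0 w = 0 := by simp [B4]
theorem B4_zero_right (w : WW) : B4 w 0 = 0 := by simp [B4]
theorem q4_zero : q4 0 = 0 := by decide
theorem B4_nondeg (u : WW) (h : ∀ w, B4 u w = 0) : u = 0 := by
  revert u; decide

theorem exists_B4 (h : WW → ZMod 2) (ha : ∀ u v, h (u + v) = h u + h v) :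
    ∃ c, ∀ w, h w = B4 c w := by
  refine ⟨(h (0, 1, 0, 0), h (1, 0, 0, 0), h (0, 0, 0, 1), h (0, 0, 1, 0)), ?_⟩
  have hz : h 0 = 0 := by
    have := ha 0 0
    rw [add_zero] at this
    exact left_eq_add.1 this
  have hsm : ∀ (a : ZMod 2) (w : WW), h (a • w) = a * h w := by
    intro a w
    rcases zmod2_cases a with rfl | rfl
    · simp [hz]
    · simp
  rintro ⟨a, b, c, d⟩
  have e : ((a, b, c, d) : WW) = a • ((1, 0, 0, 0) : WW) + b • ((0, 1, 0, 0) : WW) +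
    c • ((0, 0, 1, 0) : WW) + d • ((0, 0, 0, 1) : WW) := by simp
  rw [e, ha, ha, ha, hsm, hsm, hsm, hsm]
  simp [B4]
  ring

theorem pw_add {L : Type*} [Group L] {g : L} (hg : g * g = 1) (a b : ZMod 2) :
    pw g (a + b) = pw g a * pw g b := by
  rcases zmod2_cases a with rfl | rfl <;> rcases zmod2_cases b with rfl | rfl <;>
    simp [pw, hg]
  intro h; exact absurd (by decide) h

namespace Fr
variable {K : Type*} [Group K] {R : Subgroup K} {z r : K} {α β : K → ZMod 2} {φ : K → WW}

/-- membership in the subgroup `F` -/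
def MF (R : Subgroup K) (β : K → ZMod 2) (x : K) : Prop := x ∈ R ∧ β x = 0

theorem conjR (f : Fr K R z r α β φ) (g : K) {x : K} (hx : x ∈ R) : g * x * g⁻¹ ∈ R :=
  f.Rn.conj_mem x hx g
theorem zpw (f : Fr K R z r α β φ) (a : ZMod 2) : (if a = 0 then (1 : K) else z) = pw z a := rfl
theorem zpwK (f : Fr K R z r α β φ) (a : ZMod 2) (g : K) : pw z a * g = g * pw z a := by
  unfold pw; split_ifs <;> simp [f.zK]
theorem comm'' (f : Fr K R z r α β φ) {x y : K} (hx : x ∈ R) (hy : y ∈ R) :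
    x * y = y * x * pw z (α x * β y + β x * α y + B4 (φ x) (φ y)) := f.comm x hx y hy
theorem pwz_inj (f : Fr K R z r α β φ) {a b : ZMod 2} (h : pw z a = pw z b) : a = b := by
  rcases zmod2_cases a with rfl | rfl <;> rcases zmod2_cases b with rfl | rfl <;> simp [pw] at h ⊢
  · exact f.z1 h.symm
  · exact f.z1 h
theorem comm_iff (f : Fr K R z r α β φ) {x y : K} (hx : x ∈ R) (hy : y ∈ R) :
    x * y = y * x ↔ α x * β y + β x * α y + B4 (φ x) (φ y) = 0 := by
  rw [f.comm'' hx hy, mul_eq_left]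
  constructor
  · intro h
    apply f.pwz_inj
    rw [h]; simp [pw]
  · intro h
    rw [h]; simp [pw]
theorem commr_iff (f : Fr K R z r α β φ) {x : K} (hx : x ∈ R) : x * r = r * x ↔ β x = 0 := by
  rw [f.comm_iff hx f.rR, f.βr, f.αr, f.φr, B4_zero_right]; simp
theorem α1 (f : Fr K R z r α β φ) : α 1 = 0 := by
  have := f.αmul 1 R.one_mem 1 R.one_mem
  rw [mul_one] at this
  exact left_eq_add.1 this
theorem β1 (f : Fr K R z r α β φ) : β 1 = 0 := by
  have := f.βmul 1 R.one_mem 1 R.one_mem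
  rw [mul_one] at this
  exact left_eq_add.1 this
theorem φ1 (f : Fr K R z r α β φ) : φ 1 = 0 := by
  have := f.φmul 1 R.one_mem 1 R.one_mem
  rw [mul_one] at this
  exact left_eq_add.1 this
theorem MF_mul (f : Fr K R z r α β φ) {x y : K} (hx : MF R β x) (hy : MF R β y) : MF R β (x * y) :=
  ⟨R.mul_mem hx.1 hy.1, by rw [f.βmul _ hx.1 _ hy.1, hx.2, hy.2, add_zero]⟩
theorem MF_r (f : Fr K R z r α β φ) : MF R β r := ⟨f.rR, f.βr⟩
theorem MF_z (f : Fr K R z r α β φ) : MF R β z := ⟨f.zR, f.βz⟩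
theorem MF_one (f : Fr K R z r α β φ) : MF R β 1 := ⟨R.one_mem, f.β1⟩
theorem MF_comm (f : Fr K R z r α β φ) {x : K} (hx : MF R β x) : x * r = r * x :=
  (f.commr_iff hx.1).2 hx.2
theorem MF_conj (f : Fr K R z r α β φ) {g x : K} (hg : g * r = r * g) (hx : MF R β x) :
    MF R β (g * x * g⁻¹) := by
  refine ⟨f.conjR g hx.1, ?_⟩
  rw [← f.commr_iff (f.conjR g hx.1)]
  have h1 : g⁻¹ * r = r * g⁻¹ := by
    rw [inv_mul_eq_iff_eq_mul, ← mul_assoc, hg, mul_inv_cancel_right]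
  have h2 := f.MF_comm hx
  calc g * x * g⁻¹ * r = g * x * (g⁻¹ * r) := by group
    _ = g * (x * r) * g⁻¹ := by rw [h1]; group
    _ = (g * r) * x * g⁻¹ := by rw [h2]; group
    _ = _ := by rw [hg]; group
theorem sq_inv (f : Fr K R z r α β φ) {x y : K} (hx : MF R β x) (hy : MF R β y) : True := trivial
theorem MF_inv (f : Fr K R z r α β φ) {x : K} (hx : MF R β x) : MF R β x⁻¹ := by
  refine ⟨R.inv_mem hx.1, ?_⟩
  rw [← f.commr_iff (R.inv_mem hx.1), inv_mul_eq_iff_eq_mul, ← mul_assoc, f.MF_comm hx,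
    mul_inv_cancel_right]
theorem neg_eq (a : WW) : -a = a := by revert a; decide
theorem φinv (f : Fr K R z r α β φ) {x : K} (hx : x ∈ R) : φ x⁻¹ = φ x := by
  have := f.φmul x hx x⁻¹ (R.inv_mem hx)
  rw [mul_inv_cancel, f.φ1] at this
  rw [← neg_eq (φ x)]
  exact (neg_eq_of_add_eq_zero_right this.symm).symm
theorem αinv (f : Fr K R z r α β φ) {x : K} (hx : x ∈ R) : α x⁻¹ = α x := by
  have := f.αmul x hx x⁻¹ (R.inv_mem hx)
  rw [mul_inv_cancel, f.α1] at this
  have h2 := zmod2_add_self (α x)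
  rw [← h2] at this
  exact (add_left_cancel this).symm

/-- elements of Z4 -/
theorem Z4_eq (f : Fr K R z r α β φ) {x : K} (hx : MF R β x) (h : φ x = 0) :
    ∃ b, x = pw r (α x) * pw z b := by
  have h1 : ∀ y ∈ R, α y = 0 → β y = 0 → φ y = 0 → ∃ b, y = pw z b := by
    intro y hy a b c
    rcases f.ker y hy a b c with h | h
    · exact ⟨0, by simp [pw, h]⟩
    · exact ⟨1, by simp [pw, h]⟩
  rcases zmod2_cases (α x) with h0 | h0
  · obtain ⟨b, hb⟩ := h1 x hx.1 h0 hx.2 h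
    exact ⟨b, by rw [h0, ← hb]; simp [pw]⟩
  · obtain ⟨b, hb⟩ := h1 (r * x) (R.mul_mem f.rR hx.1)
      (by rw [f.αmul _ f.rR _ hx.1, f.αr, h0]; decide)
      (by rw [f.βmul _ f.rR _ hx.1, f.βr, hx.2]; decide)
      (by rw [f.φmul _ f.rR _ hx.1, f.φr, h]; decide)
    refine ⟨b, ?_⟩
    rw [← hb, h0]
    simp only [pw, one_ne_zero, if_false]
    rw [← mul_assoc, f.rr, one_mul]

theorem pw_comm {g x : K} (h : g * x = x * g) (a : ZMod 2) : g * pw x a = pw x a * g := by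
  unfold pw; split_ifs <;> simp [h]

theorem Z4_comm (f : Fr K R z r α β φ) {x g : K} (hx : MF R β x) (h : φ x = 0) (hg : g * r = r * g) :
    g * x = x * g := by
  obtain ⟨b, hb⟩ := f.Z4_eq hx h
  rw [hb, ← mul_assoc, pw_comm hg, mul_assoc, pw_comm (f.zK g).symm, mul_assoc]

theorem φ_congr (f : Fr K R z r α β φ) {g x y : K} (hg : g * r = r * g) (hx : MF R β x) (hy : MF R β y)
    (h : φ x = φ y) : φ (g * x * g⁻¹) = φ (g * y * g⁻¹) ∧
      α (g * x * g⁻¹) + α x = α (g * y * g⁻¹) + α y := by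
  have h1 : MF R β (y⁻¹ * x) := f.MF_mul (f.MF_inv hy) hx
  have h2 : φ (y⁻¹ * x) = 0 := by
    rw [f.φmul _ (R.inv_mem hy.1) _ hx.1, f.φinv hy.1, h]
    nth_rw 1 [← neg_eq (φ y)]
    exact neg_add_cancel _
  have h3 := f.Z4_comm h1 h2 hg
  have h4 : g * x * g⁻¹ = (g * y * g⁻¹) * (y⁻¹ * x) := by
    calc g * x * g⁻¹ = g * y * ((y⁻¹ * x) * g⁻¹) := by group
      _ = g * y * (g⁻¹ * (g * (y⁻¹ * x)) * g⁻¹) := by group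
      _ = _ := by rw [h3]; group
  have h5 : x = y * (y⁻¹ * x) := by group
  constructor
  · rw [h4, f.φmul _ (f.conjR g hy.1) _ h1.1, h2, add_zero]
  · rw [h4, f.αmul _ (f.conjR g hy.1) _ h1.1]
    nth_rw 2 [h5]
    rw [f.αmul _ hy.1 _ h1.1]
    have := zmod2_add_self (α (y⁻¹ * x))
    linear_combination this

open Classical in
/-- a lift of a vector to `F` -/
noncomputable def lft (R : Subgroup K) (β : K → ZMod 2) (φ : K → WW) (w : WW) : K :=
  if h : ∃ x, MF R β x ∧ φ x = w then h.choose else 1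

theorem lft_spec (f : Fr K R z r α β φ) (w : WW) : MF R β (lft R β φ w) ∧ φ (lft R β φ w) = w := by
  have h : ∃ x, MF R β x ∧ φ x = w := by
    obtain ⟨x, h1, h2, h3, h4⟩ := f.surj 0 0 w
    exact ⟨x, ⟨h1, h3⟩, h4⟩
  unfold lft
  rw [dif_pos h]
  exact h.choose_spec

/-- action on `WW` -/
noncomputable def wact (R : Subgroup K) (β : K → ZMod 2) (φ : K → WW) (g : K) (w : WW) : WW :=
  φ (g * lft R β φ w * g⁻¹)

theorem wact_φ (f : Fr K R z r α β φ) {g x : K} (hg : g * r = r * g) (hx : MF R β x) :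
    wact R β φ g (φ x) = φ (g * x * g⁻¹) :=
  (f.φ_congr hg (f.lft_spec _).1 hx (f.lft_spec _).2).1

theorem wact_add (f : Fr K R z r α β φ) {g : K} (hg : g * r = r * g) (u v : WW) :
    wact R β φ g (u + v) = wact R β φ g u + wact R β φ g v := by
  obtain ⟨h1, h2⟩ := f.lft_spec u
  obtain ⟨h3, h4⟩ := f.lft_spec v
  have h5 := f.wact_φ hg (f.MF_mul h1 h3)
  rw [f.φmul _ h1.1 _ h3.1, h2, h4] at h5
  rw [h5, wact, wact, ← f.φmul _ (f.conjR g h1.1) _ (f.conjR g h3.1)]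
  congr 1; group

theorem wact_mul (f : Fr K R z r α β φ) {g k : K} (hg : g * r = r * g) (hk : k * r = r * k) (u : WW) :
    wact R β φ (g * k) u = wact R β φ g (wact R β φ k u) := by
  obtain ⟨h1, h2⟩ := f.lft_spec u
  rw [wact, wact.eq_1 R β φ k, f.wact_φ hg (f.MF_conj hk h1)]
  congr 1; group

theorem wact_one (f : Fr K R z r α β φ) (u : WW) : wact R β φ 1 u = u := by
  simp [wact, (f.lft_spec u).2]

theorem wact_zero (f : Fr K R z r α β φ) {g : K} (hg : g * r = r * g) : wact R β φ g 0 = 0 := by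
  have := f.wact_add hg 0 0
  rw [add_zero] at this
  exact left_eq_add.1 this

theorem wact_q (f : Fr K R z r α β φ) {g : K} (hg : g * r = r * g) (u : WW) :
    q4 (wact R β φ g u) = q4 u := by
  obtain ⟨h1, h2⟩ := f.lft_spec u
  have h3 := f.sq _ h1.1
  have h4 := f.sq _ (f.MF_conj hg h1).1
  rw [h1.2, h2, f.zpw] at h3
  rw [(f.MF_conj hg h1).2, f.zpw] at h4
  simp only [mul_zero, zero_add] at h3 h4
  apply f.pwz_inj
  rw [wact, ← h4]
  calc _ = g * (lft R β φ u * lft R β φ u) * g⁻¹ := by group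
    _ = _ := by rw [h3, ← f.zpwK]; group

theorem wact_B (f : Fr K R z r α β φ) {g : K} (hg : g * r = r * g) (u v : WW) :
    B4 (wact R β φ g u) (wact R β φ g v) = B4 u v := by
  rw [B4_polar, B4_polar, ← f.wact_add hg, f.wact_q hg, f.wact_q hg, f.wact_q hg]

theorem exists_functional (f : Fr K R z r α β φ) (h : K → ZMod 2)
    (ha : ∀ x y, MF R β x → MF R β y → h (x * y) = h x + h y) (hz : h z = 0) (hr : h r = 0) :
    ∃ c, ∀ x, MF R β x → h x = B4 c (φ x) := by
  have h1 : h 1 = 0 := by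
    have := ha 1 1 f.MF_one f.MF_one
    rw [mul_one] at this
    exact left_eq_add.1 this
  have hpz : ∀ a, h (pw z a) = 0 := by intro a; unfold pw; split_ifs <;> assumption
  have hpr : ∀ a, h (pw r a) = 0 := by intro a; unfold pw; split_ifs <;> assumption
  have mpz : ∀ a, MF R β (pw z a) := by
    intro a; unfold pw; split_ifs; exacts [f.MF_one, f.MF_z]
  have mpr : ∀ a, MF R β (pw r a) := by
    intro a; unfold pw; split_ifs; exacts [f.MF_one, f.MF_r]
  have hc : ∀ x y, MF R β x → MF R β y → φ x = φ y → h x = h y := by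
    intro x y hx hy hxy
    have h1 : MF R β (y⁻¹ * x) := f.MF_mul (f.MF_inv hy) hx
    have h2 : φ (y⁻¹ * x) = 0 := by
      rw [f.φmul _ (R.inv_mem hy.1) _ hx.1, f.φinv hy.1, hxy]
      nth_rw 1 [← neg_eq (φ y)]
      exact neg_add_cancel _
    obtain ⟨b, hb⟩ := f.Z4_eq h1 h2
    have h5 : x = y * (y⁻¹ * x) := by group
    rw [h5, ha _ _ hy h1, hb, ha _ _ (mpr _) (mpz _), hpz, hpr]; simp
  obtain ⟨c, hc'⟩ := exists_B4 (fun w => h (lft R β φ w)) (by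
    intro u v
    obtain ⟨h1, h2⟩ := f.lft_spec u
    obtain ⟨h3, h4⟩ := f.lft_spec v
    rw [← ha _ _ h1 h3]
    apply hc _ _ (f.lft_spec _).1 (f.MF_mul h1 h3)
    rw [(f.lft_spec _).2, f.φmul _ h1.1 _ h3.1, h2, h4])
  refine ⟨c, fun x hx => ?_⟩
  rw [← hc' (φ x)]
  exact hc _ _ hx (f.lft_spec _).1 (f.lft_spec _).2.symm

end Fr

end

section


set_option linter.all false

namespace Fr
variable {K : Type*} [Group K] {R : Subgroup K} {z r : K} {α β : K → ZMod 2} {φ : K → WW}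

theorem exists_s (f : Fr K R z r α β φ) : ∃ s ∈ R, α s = 0 ∧ β s = 1 ∧ φ s = 0 ∧ s * s = 1 ∧
    r * s = s * r * z := by
  obtain ⟨s, hs, h1, h2, h3⟩ := f.surj 0 1 0
  refine ⟨s, hs, h1, h2, h3, ?_, ?_⟩
  · rw [f.sq _ hs, h1, h2, h3]; simp [q4_zero]
  · rw [f.comm'' f.rR hs, f.αr, h2, f.βr, h3, B4_zero_right]; simp [pw]

theorem cent_R (f : Fr K R z r α β φ) {g s : K} (hsR : s ∈ R) (hs1 : β s = 1) (hgs : g * s = s * g)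
    (hg : ∀ x, MF R β x → g * x = x * g) : g = 1 ∨ g = z := by
  have hall : ∀ x ∈ R, g * x = x * g := by
    intro x hx
    rcases zmod2_cases (β x) with h | h
    · exact hg x ⟨hx, h⟩
    · have h1 : MF R β (x * s) := ⟨R.mul_mem hx hsR, by
        rw [f.βmul _ hx _ hsR, h, hs1]; decide⟩
      have h2 := hg _ h1
      have : g * x * s = x * g * s := by
        rw [mul_assoc, h2, mul_assoc, mul_assoc, hgs]
      exact mul_right_cancel this
  have hgR := f.selfc g hall
  have hform : ∀ a b w, α g * b + β g * a + B4 (φ g) w = 0 := by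
    intro a b w
    obtain ⟨x, hx, h1, h2, h3⟩ := f.surj a b w
    have := (f.comm_iff hgR hx).1 (hall x hx)
    rw [h1, h2, h3] at this
    exact this
  apply f.ker g hgR
  · have := hform 0 1 0; simpa [B4_zero_right] using this
  · have := hform 1 0 0; simpa [B4_zero_right] using this
  · apply B4_nondeg
    intro w
    have := hform 0 0 w; simpa using this

theorem cent_F (f : Fr K R z r α β φ) {g : K} (hg : ∀ x, MF R β x → g * x = x * g) :
    MF R β g ∧ φ g = 0 := by
  obtain ⟨s, hs, hsα, hsβ, hsφ, hss, hrs⟩ := f.exists_s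
  have hgr : g * r = r * g := hg r f.MF_r
  set y := g * s * g⁻¹ with hy
  have hyR : y ∈ R := f.conjR g hs
  have hyx : ∀ x, MF R β x → y * x = x * y * pw z (α x) := by
    intro x hx
    have h1 := hg x hx
    have h2 : s * x = x * s * pw z (α x) := by
      rw [f.comm'' hs hx.1, hsα, hx.2, hsβ, hsφ, B4_zero_left]; simp
    have h3 : g⁻¹ * x = x * g⁻¹ := by
      rw [inv_mul_eq_iff_eq_mul, ← mul_assoc, h1, mul_inv_cancel_right]
    calc y * x = g * s * (g⁻¹ * x) := by rw [hy]; group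
      _ = g * (s * x) * g⁻¹ := by rw [h3]; group
      _ = (g * x) * s * (pw z (α x) * g⁻¹) := by rw [h2]; group
      _ = x * g * s * (g⁻¹ * pw z (α x)) := by rw [h1, f.zpwK]
      _ = _ := by rw [hy]; group
  have hform : ∀ x, MF R β x → α y * β x + β y * α x + B4 (φ y) (φ x) = α x := by
    intro x hx
    have h1 := hyx x hx
    rw [f.comm'' hyR hx.1] at h1
    exact f.pwz_inj (mul_left_cancel h1)
  have hyβ : β y = 1 := by
    have := hform r f.MF_r
    rw [f.βr, f.αr, f.φr, B4_zero_right] at this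
    simpa using this
  have hyφ : φ y = 0 := by
    apply B4_nondeg
    intro w
    obtain ⟨h1, h2⟩ := f.lft_spec w
    have := hform _ h1
    rw [h1.2, h2, hyβ] at this
    simpa using this
  have hyα : α y = 0 := by
    have h1 : y * y = 1 := by
      calc y * y = g * (s * s) * g⁻¹ := by rw [hy]; group
        _ = 1 := by rw [hss]; group
    rw [f.sq _ hyR, hyβ, hyφ, q4_zero, f.zpw] at h1
    have : α y * 1 + 0 = 0 := f.pwz_inj (by rw [h1]; simp [pw])
    simpa using this
  have hk : y * s = 1 ∨ y * s = z := by
    apply f.ker _ (R.mul_mem hyR hs)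
    · rw [f.αmul _ hyR _ hs, hyα, hsα, add_zero]
    · rw [f.βmul _ hyR _ hs, hyβ, hsβ]; decide
    · rw [f.φmul _ hyR _ hs, hyφ, hsφ, add_zero]
  have hgs : g * s = y * s * s * g := by
    rw [mul_assoc y, hss, hy]; group
  rcases hk with hk | hk
  · rw [hk, one_mul] at hgs
    rcases f.cent_R hs hsβ hgs hg with rfl | rfl
    · exact ⟨f.MF_one, f.φ1⟩
    · exact ⟨f.MF_z, f.φz⟩
  · rw [hk] at hgs
    have h1 : r * g = 1 ∨ r * g = z := by
      apply f.cent_R hs hsβ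
      · calc r * g * s = r * (g * s) := by group
          _ = r * (z * s) * g := by rw [hgs]; group
          _ = (r * s) * z * g := by rw [f.zK]; group
          _ = s * r * (z * z) * g := by rw [hrs]; group
          _ = _ := by rw [f.zz]; group
      · intro x hx
        calc r * g * x = r * (g * x) := by group
          _ = (r * x) * g := by rw [hg x hx]; group
          _ = _ := by rw [← f.MF_comm hx]; group
    have h2 : g = r * (r * g) := by rw [← mul_assoc, f.rr, one_mul]
    rcases h1 with h1 | h1
    · rw [h2, h1, mul_one]
      exact ⟨f.MF_r, f.φr⟩
    · rw [h2, h1]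
      exact ⟨f.MF_mul f.MF_r f.MF_z, by rw [f.φmul _ f.rR _ f.zR, f.φr, f.φz, add_zero]⟩

/-- the kernel of the action on `WW` -/
def InN (R : Subgroup K) (r : K) (β : K → ZMod 2) (φ : K → WW) (g : K) : Prop :=
  g * r = r * g ∧ ∀ x, MF R β x → φ (g * x * g⁻¹) = φ x

theorem pwr_pwz_inj (f : Fr K R z r α β φ) {a b c d : ZMod 2} (h : pw r a * pw z b = pw r c * pw z d) :
    a = c ∧ b = d := by
  have h1 : ∀ a b, α (pw r a * pw z b) = a := by
    intro a b
    rcases zmod2_cases a with rfl | rfl <;> rcases zmod2_cases b with rfl | rfl <;>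
      simp [pw, f.α1, f.αr, f.αz, f.αmul _ f.rR _ f.zR]
  have h2 : a = c := by rw [← h1 a b, h, h1]
  subst h2
  exact ⟨rfl, f.pwz_inj (mul_left_cancel h)⟩

theorem InN_diff (f : Fr K R z r α β φ) {g x : K} (hg : InN R r β φ g) (hx : MF R β x) :
    ∃ b, g * x * g⁻¹ = x * (pw r (α (g * x * g⁻¹) + α x) * pw z b) := by
  have h1 : MF R β (x⁻¹ * (g * x * g⁻¹)) := f.MF_mul (f.MF_inv hx) (f.MF_conj hg.1 hx)
  obtain ⟨b, hb⟩ := f.Z4_eq h1 (by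
    rw [f.φmul _ (R.inv_mem hx.1) _ (f.conjR g hx.1), f.φinv hx.1, hg.2 x hx]
    nth_rw 1 [← neg_eq (φ x)]
    exact neg_add_cancel _)
  refine ⟨b, ?_⟩
  rw [f.αmul _ (R.inv_mem hx.1) _ (f.conjR g hx.1), f.αinv hx.1, add_comm] at hb
  rw [← hb]; group

theorem InN_F (f : Fr K R z r α β φ) {g : K} (hg : MF R β g) : InN R r β φ g ∧
    ∀ x, MF R β x → g * x * g⁻¹ = x * pw z (B4 (φ g) (φ x)) := by
  have h1 : ∀ x, MF R β x → g * x * g⁻¹ = x * pw z (B4 (φ g) (φ x)) := by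
    intro x hx
    have h2 := f.comm'' hg.1 hx.1
    rw [hg.2, hx.2] at h2
    simp only [mul_zero, zero_mul, zero_add] at h2
    rw [h2, mul_assoc, f.zpwK]; group
  refine ⟨⟨f.MF_comm hg, ?_⟩, h1⟩
  intro x hx
  rw [h1 x hx]
  unfold pw
  split_ifs
  · rw [mul_one]
  · rw [f.φmul _ hx.1 _ f.zR, f.φz, add_zero]

theorem mid (f : Fr K R z r α β φ) {g : K} (hg : InN R r β φ g) :
    ∃ k, MF R β k ∧ ∀ x, MF R β x →
      (k⁻¹ * g) * x * (k⁻¹ * g)⁻¹ = x * pw r (α (g * x * g⁻¹) + α x) := by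
  choose b hb using fun x (hx : MF R β x) => f.InN_diff hg hx
  classical
  obtain ⟨c, hc⟩ := f.exists_functional (fun x => if hx : MF R β x then b x hx else 0) (by
    intro x y hx hy
    have hxy := f.MF_mul hx hy
    rw [dif_pos hx, dif_pos hy, dif_pos hxy]
    have e1 := hb _ hx
    have e2 := hb _ hy
    have e3 := hb _ hxy
    set A := α (g * x * g⁻¹) + α x
    set B := α (g * y * g⁻¹) + α y
    set C := α (g * (x * y) * g⁻¹) + α (x * y)
    have e4 : g * (x * y) * g⁻¹ = (g * x * g⁻¹) * (g * y * g⁻¹) := by group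
    rw [e3, e1, e2] at e4
    clear_value A B C
    have hry : y * pw r A = pw r A * y := pw_comm (f.MF_comm hy) A
    have e5 : x * (pw r A * pw z (b x hx)) * (y * (pw r B * pw z (b y hy))) =
        (x * y) * (pw r (A + B) * pw z (b x hx + b y hy)) := by
      rw [pw_add f.rr A B, pw_add f.zz]
      calc _ = x * pw r A * (pw z (b x hx) * y) * pw r B * pw z (b y hy) := by group
        _ = x * (pw r A * y) * (pw z (b x hx) * pw r B) * pw z (b y hy) := by rw [f.zpwK]; group
        _ = _ := by rw [← hry, f.zpwK]; group
    rw [e5] at e4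
    exact (f.pwr_pwz_inj (mul_left_cancel e4)).2) (by
    rw [dif_pos f.MF_z]
    have h1 := hb z f.MF_z
    have h2 : g * z * g⁻¹ = z := by rw [← f.zK]; group
    rw [h2] at h1
    have h3 : pw r (α z + α z) * pw z (b z f.MF_z) = pw r 0 * pw z 0 := by
      rw [← mul_right_inj z, ← h1]; simp [pw]
    exact (f.pwr_pwz_inj h3).2) (by
    rw [dif_pos f.MF_r]
    have h1 := hb r f.MF_r
    have h2 : g * r * g⁻¹ = r := by rw [hg.1]; group
    rw [h2] at h1
    have h3 : pw r (α r + α r) * pw z (b r f.MF_r) = pw r 0 * pw z 0 := by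
      rw [← mul_right_inj r, ← h1]; simp [pw]
    exact (f.pwr_pwz_inj h3).2)
  obtain ⟨hk, hkc⟩ := f.lft_spec c
  set k := lft R β φ c
  refine ⟨k, hk, ?_⟩
  intro x hx
  have h1 := hb x hx
  have h2 := (f.InN_F hk).2 x hx
  have h3 := hc x hx
  simp only [dif_pos hx] at h3
  rw [hkc, ← h3] at h2
  have hkr : ∀ a, k * pw r a = pw r a * k := fun a => pw_comm (f.MF_comm hk) a
  generalize α (g * x * g⁻¹) + α x = A at *
  have h4 : k * (x * pw r A) * k⁻¹ = g * x * g⁻¹ := by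
    rw [h1]
    calc k * (x * pw r A) * k⁻¹ = k * x * k⁻¹ * (k * pw r A) * k⁻¹ := by group
      _ = x * (pw z (b x hx) * pw r A) := by rw [h2, hkr]; group
      _ = _ := by rw [f.zpwK]
  calc (k⁻¹ * g) * x * (k⁻¹ * g)⁻¹ = k⁻¹ * (g * x * g⁻¹) * k := by group
    _ = _ := by rw [← h4]; group

theorem InN_mul (f : Fr K R z r α β φ) {g k : K} (hg : InN R r β φ g) (hk : InN R r β φ k) :
    InN R r β φ (g * k) := by
  refine ⟨by rw [mul_assoc, hk.1, ← mul_assoc, hg.1, mul_assoc], ?_⟩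
  intro x hx
  have e : g * k * x * (g * k)⁻¹ = g * (k * x * k⁻¹) * g⁻¹ := by group
  rw [e, hg.2 _ (f.MF_conj hk.1 hx), hk.2 x hx]

theorem exists_θ (f : Fr K R z r α β φ) {g : K} (hg : InN R r β φ g) :
    ∃ c, ∀ x, MF R β x → α (g * x * g⁻¹) + α x = B4 c (φ x) := by
  apply f.exists_functional
  · intro x y hx hy
    have e4 : g * (x * y) * g⁻¹ = (g * x * g⁻¹) * (g * y * g⁻¹) := by group
    rw [e4, f.αmul _ (f.conjR g hx.1) _ (f.conjR g hy.1), f.αmul _ hx.1 _ hy.1]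
    ring
  · have h2 : g * z * g⁻¹ = z := by rw [← f.zK]; group
    rw [h2, zmod2_add_self]
  · have h2 : g * r * g⁻¹ = r := by rw [hg.1]; group
    rw [h2, zmod2_add_self]

theorem B4_ext {c d : WW} (h : ∀ w, B4 c w = B4 d w) : c = d := by
  have : c + d = 0 := by
    apply B4_nondeg
    intro w
    rw [B4_add_left, h, zmod2_add_self]
  rw [← neg_eq d]
  exact eq_neg_of_add_eq_zero_left this

open Classical in
/-- the map `θ` -/
noncomputable def θ (R : Subgroup K) (α β : K → ZMod 2) (φ : K → WW) (g : K) : WW :=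
  if h : ∃ c, ∀ x, MF R β x → α (g * x * g⁻¹) + α x = B4 c (φ x) then h.choose else 0

theorem θ_spec (f : Fr K R z r α β φ) {g x : K} (hg : InN R r β φ g) (hx : MF R β x) :
    α (g * x * g⁻¹) + α x = B4 (θ R α β φ g) (φ x) := by
  have h := f.exists_θ hg
  unfold θ
  rw [dif_pos h]
  exact h.choose_spec x hx

theorem θ_unique (f : Fr K R z r α β φ) {g : K} {c : WW} (hg : InN R r β φ g)
    (h : ∀ x, MF R β x → α (g * x * g⁻¹) + α x = B4 c (φ x)) : θ R α β φ g = c := by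
  apply B4_ext
  intro w
  obtain ⟨h1, h2⟩ := f.lft_spec w
  have h3 := f.θ_spec hg h1
  rw [h _ h1, h2] at h3
  exact h3.symm

theorem θ_mul (f : Fr K R z r α β φ) {g k : K} (hg : InN R r β φ g) (hk : InN R r β φ k) :
    θ R α β φ (g * k) = θ R α β φ g + θ R α β φ k := by
  apply f.θ_unique (f.InN_mul hg hk)
  intro x hx
  have e : g * k * x * (g * k)⁻¹ = g * (k * x * k⁻¹) * g⁻¹ := by group
  rw [e, B4_add_left, ← f.θ_spec hk hx, ← hk.2 x hx, ← f.θ_spec hg (f.MF_conj hk.1 hx)]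
  linear_combination (-1 : ZMod 2) * zmod2_add_self (α (k * x * k⁻¹))

theorem θ_eq_zero (f : Fr K R z r α β φ) {g : K} (hg : InN R r β φ g) :
    θ R α β φ g = 0 ↔ MF R β g := by
  constructor
  · intro h0
    obtain ⟨k, hk, hkx⟩ := f.mid hg
    have h1 : ∀ x, MF R β x → (k⁻¹ * g) * x = x * (k⁻¹ * g) := by
      intro x hx
      have := hkx x hx
      rw [f.θ_spec hg hx, h0, B4_zero_left] at this
      simp only [pw, if_true, mul_one] at this
      exact mul_inv_eq_iff_eq_mul.1 this
    have h2 := f.MF_mul hk (f.cent_F h1).1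
    rwa [mul_inv_cancel_left] at h2
  · intro h
    apply f.θ_unique hg
    intro x hx
    rw [(f.InN_F h).2 x hx, B4_zero_left]
    unfold pw
    split_ifs
    · rw [mul_one, zmod2_add_self]
    · rw [f.αmul _ hx.1 _ f.zR, f.αz, add_zero, zmod2_add_self]

theorem comm_inv {g r : K} (hg : g * r = r * g) : g⁻¹ * r = r * g⁻¹ := by
  rw [inv_mul_eq_iff_eq_mul, ← mul_assoc, hg, mul_inv_cancel_right]

theorem InN_conj (f : Fr K R z r α β φ) {g k : K} (hg : InN R r β φ g) (hk : k * r = r * k) :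
    InN R r β φ (k * g * k⁻¹) := by
  have hk' := comm_inv hk
  refine ⟨?_, ?_⟩
  · calc k * g * k⁻¹ * r = k * g * (k⁻¹ * r) := by group
      _ = k * (g * r) * k⁻¹ := by rw [hk']; group
      _ = (k * r) * g * k⁻¹ := by rw [hg.1]; group
      _ = _ := by rw [hk]; group
  · intro x hx
    have h1 : MF R β (k⁻¹ * x * k) := by simpa using f.MF_conj hk' hx
    have e : k * g * k⁻¹ * x * (k * g * k⁻¹)⁻¹ = k * (g * (k⁻¹ * x * k) * g⁻¹) * k⁻¹ := by group
    rw [e, ← f.wact_φ hk (f.MF_conj hg.1 h1), hg.2 _ h1, f.wact_φ hk h1]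
    congr 1; group

theorem θ_conj (f : Fr K R z r α β φ) {g k : K} (hg : InN R r β φ g) (hk : k * r = r * k) :
    θ R α β φ (k * g * k⁻¹) = wact R β φ k (θ R α β φ g) := by
  have hk' := comm_inv hk
  apply f.θ_unique (f.InN_conj hg hk)
  intro x hx
  have h1 : MF R β (k⁻¹ * x * k) := by simpa using f.MF_conj hk' hx
  have e : k * g * k⁻¹ * x * (k * g * k⁻¹)⁻¹ = k * (g * (k⁻¹ * x * k) * g⁻¹) * k⁻¹ := by group
  have e2 : x = k * (k⁻¹ * x * k) * k⁻¹ := by group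
  have e3 : φ x = wact R β φ k (φ (k⁻¹ * x * k)) := by rw [f.wact_φ hk h1, ← e2]
  rw [e, e3, f.wact_B hk, ← f.θ_spec hg h1]
  have h2 := (f.φ_congr hk (f.MF_conj hg.1 h1) h1 (hg.2 _ h1)).2
  rw [← e2] at h2
  generalize α (k * (g * (k⁻¹ * x * k) * g⁻¹) * k⁻¹) = a at *
  generalize α (g * (k⁻¹ * x * k) * g⁻¹) = b at *
  generalize α (k⁻¹ * x * k) = c at *
  generalize α x = d at *
  revert a b c d
  clear * -
  intro a b c d
  revert a b c d
  decide

end Fr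

end

section


set_option linter.all false

abbrev T5 := {w : WW // w ≠ 0 ∧ q4 w = 0}
theorem card_T5 : Fintype.card T5 = 5 := by decide
theorem T5_span : ∀ w : WW, ∃ a b : WW, q4 a = 0 ∧ q4 b = 0 ∧ a + b = w := by decide
/-- transvections -/
def tv (u w : WW) : WW := w + (B4 w u * u.1, B4 w u * u.2.1, B4 w u * u.2.2.1, B4 w u * u.2.2.2)
theorem tv_q : ∀ u w : WW, q4 u = 1 → q4 (tv u w) = q4 w := by decide
theorem tv_tv : ∀ u w : WW, q4 u = 1 → tv u (tv u w) = w := by decide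
theorem tv_zero : ∀ u : WW, tv u 0 = 0 := by decide
theorem tv_B1 : ∀ u w : WW, B4 w u = 1 → tv u w = w + u := by decide
theorem tv_add (u w w' : WW) : tv u (w + w') = tv u w + tv u w' := by
  simp only [tv, B4_add_left]
  ext <;> simp <;> ring
theorem ex_ns : ∀ c : WW, c ≠ 0 → ∃ u, q4 u = 1 ∧ B4 c u = 1 := by decide
set_option synthInstance.maxSize 2000 in
set_option synthInstance.maxHeartbeats 400000 in
theorem ns_conn : ∀ u v : WW, q4 u = 1 → q4 v = 1 → ∃ w, q4 w = 1 ∧ B4 u w = 1 ∧ B4 w v = 1 := by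
  have h : ∀ u v : WW, q4 u = 1 → q4 v = 1 →
      ¬ (∀ w, q4 w = 1 → B4 u w = 1 → ¬ B4 w v = 1) := by
    decide +kernel
  intro u v hu hv
  by_contra hc
  exact h u v hu hv fun w h1 h2 h3 => hc ⟨w, h1, h2, h3⟩
theorem ns_span : ∀ w : WW, ∃ a b : WW, q4 a = 1 ∧ q4 b = 1 ∧ a + b = w := by decide

theorem inv_sub_top (A : Set WW) (hadd : ∀ a ∈ A, ∀ b ∈ A, a + b ∈ A)
    (hA : ∃ c ∈ A, c ≠ 0) (hinv : ∀ u, q4 u = 1 → ∀ a ∈ A, tv u a ∈ A) : ∀ w, w ∈ A := by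
  have step : ∀ a ∈ A, ∀ u, q4 u = 1 → B4 a u = 1 → u ∈ A := by
    intro a ha u hu hau
    have h1 := hadd _ ha _ (hinv u hu a ha)
    rw [tv_B1 u a hau, ← add_assoc] at h1
    have : a + a = 0 := (by decide : ∀ a : WW, a + a = 0) a
    rwa [this, zero_add] at h1
  obtain ⟨c, hc, hc0⟩ := hA
  obtain ⟨u, hu, hcu⟩ := ex_ns c hc0
  have hu' := step c hc u hu hcu
  have hns : ∀ v, q4 v = 1 → v ∈ A := by
    intro v hv
    obtain ⟨w, hw, h1, h2⟩ := ns_conn u v hu hv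
    exact step w (step u hu' w hw h1) v hv h2
  intro w
  obtain ⟨a, b, ha, hb, rfl⟩ := ns_span w
  exact hadd _ (hns a ha) _ (hns b hb)

namespace Fr
variable {K : Type*} [Group K] {R : Subgroup K} {z r : K} {α β : K → ZMod 2} {φ : K → WW}

theorem memS {g : K} (hg : g ∈ Subgroup.centralizer ({r} : Set K)) : g * r = r * g :=
  Subgroup.mem_centralizer_singleton_iff.1 hg

/-- action on the five singular vectors -/
noncomputable def rho5 (f : Fr K R z r α β φ) :
    Subgroup.centralizer ({r} : Set K) →* Equiv.Perm T5 :=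
  MonoidHom.toHomPerm
    { toFun := fun g w => ⟨wact R β φ g.1 w.1, by
        refine ⟨?_, by rw [f.wact_q (memS g.2), w.2.2]⟩
        intro h
        apply w.2.1
        rw [← f.wact_one w.1, ← inv_mul_cancel g.1, f.wact_mul (comm_inv (memS g.2)) (memS g.2), h,
          f.wact_zero (comm_inv (memS g.2))]⟩
      map_one' := by
        funext w
        apply Subtype.ext
        exact f.wact_one w.1
      map_mul' := by
        intro g k
        funext w
        apply Subtype.ext
        exact f.wact_mul (memS g.2) (memS k.2) w.1 }

theorem rho5_apply (f : Fr K R z r α β φ) (g : Subgroup.centralizer ({r} : Set K)) (w : T5) :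
    (f.rho5 g w).1 = wact R β φ g.1 w.1 := rfl

theorem ext_T5 (t t' : WW → WW) (h0 : t 0 = 0) (h0' : t' 0 = 0)
    (ha : ∀ u v, t (u + v) = t u + t v) (ha' : ∀ u v, t' (u + v) = t' u + t' v)
    (h : ∀ w : T5, t w.1 = t' w.1) (w : WW) : t w = t' w := by
  have h1 : ∀ a, q4 a = 0 → t a = t' a := by
    intro a haq
    by_cases h2 : a = 0
    · rw [h2, h0, h0']
    · exact h ⟨a, h2, haq⟩
  obtain ⟨a, b, hq, hb, rfl⟩ := T5_span w
  rw [ha, ha', h1 a hq, h1 b hb]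

theorem mem_ker_rho5 (f : Fr K R z r α β φ) (g : Subgroup.centralizer ({r} : Set K)) :
    g ∈ f.rho5.ker ↔ InN R r β φ g.1 := by
  rw [MonoidHom.mem_ker]
  constructor
  · intro h
    refine ⟨memS g.2, fun x hx => ?_⟩
    rw [← f.wact_φ (memS g.2) hx]
    refine ext_T5 (wact R β φ g.1) id (f.wact_zero (memS g.2)) rfl (f.wact_add (memS g.2))
      (fun _ _ => rfl) ?_ _
    intro w
    rw [← f.rho5_apply, h]; rfl
  · intro h
    ext1 w
    apply Subtype.ext
    rw [f.rho5_apply]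
    exact (h.2 _ (f.lft_spec w.1).1).trans (f.lft_spec w.1).2

/-- `θ` as a homomorphism -/
noncomputable def thetaHom (f : Fr K R z r α β φ) : f.rho5.ker →* Multiplicative WW :=
  MonoidHom.mk' (fun g => Multiplicative.ofAdd (θ R α β φ g.1.1)) (by
    intro g k
    rw [← ofAdd_add, ← f.θ_mul ((f.mem_ker_rho5 _).1 g.2) ((f.mem_ker_rho5 _).1 k.2)]
    rfl)

theorem card_MF (f : Fr K R z r α β φ) (hR : Nat.card R = 128) : Nat.card {x // MF R β x} = 64 := by
  let F : R →* Multiplicative (ZMod 2) :=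
    MonoidHom.mk' (fun x => Multiplicative.ofAdd (β x.1)) (by
      intro x y; rw [← ofAdd_add, ← f.βmul _ x.2 _ y.2]; rfl)
  have hsurj : Function.Surjective F := by
    intro t
    obtain ⟨v, rfl⟩ := Multiplicative.ofAdd.surjective t
    obtain ⟨x, hx, h1, h2, h3⟩ := f.surj 0 v 0
    exact ⟨⟨x, hx⟩, by simp [F, h2]⟩
  have hcardk := F.ker.card_mul_index
  rw [Subgroup.index_ker, MonoidHom.range_eq_top.2 hsurj, hR] at hcardk
  have e8 : Nat.card (⊤ : Subgroup (Multiplicative (ZMod 2))) = 2 := by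
    rw [Subgroup.card_top]; simp
  rw [e8] at hcardk
  have : Nat.card {x // MF R β x} = Nat.card F.ker := by
    apply Nat.card_congr
    exact
    { toFun := fun x => ⟨⟨x.1, x.2.1⟩, x.2.2⟩
      invFun := fun x => ⟨x.1.1, x.1.2, x.2⟩
      left_inv := fun _ => rfl
      right_inv := fun _ => rfl }
  omega

theorem card_ker_theta (f : Fr K R z r α β φ) (hR : Nat.card R = 128) :
    Nat.card f.thetaHom.ker = 64 := by
  rw [← f.card_MF hR]
  apply Nat.card_congr
  exact
  { toFun := fun g => ⟨g.1.1.1, (f.θ_eq_zero ((f.mem_ker_rho5 _).1 g.1.2)).1 g.2⟩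
    invFun := fun x =>
      ⟨⟨⟨x.1, Subgroup.mem_centralizer_singleton_iff.2 (f.MF_comm x.2)⟩,
        (f.mem_ker_rho5 _).2 (f.InN_F x.2).1⟩, (f.θ_eq_zero (f.InN_F x.2).1).2 x.2⟩
    left_inv := fun _ => rfl
    right_inv := fun _ => rfl }

/-- stabilizer of `{r, rz}` -/
def MM (f : Fr K R z r α β φ) : Subgroup K where
  carrier := {g | ∃ a, g * r * g⁻¹ = r * pw z a}
  one_mem' := ⟨0, by simp [pw]⟩
  mul_mem' := by
    rintro g k ⟨a, ha⟩ ⟨b, hb⟩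
    refine ⟨a + b, ?_⟩
    calc g * k * r * (g * k)⁻¹ = g * (k * r * k⁻¹) * g⁻¹ := by group
      _ = g * r * (pw z b * g⁻¹) := by rw [hb]; group
      _ = (g * r * g⁻¹) * pw z b := by rw [f.zpwK]; group
      _ = _ := by rw [ha, pw_add f.zz]; group
  inv_mem' := by
    rintro g ⟨a, ha⟩
    refine ⟨a, ?_⟩
    have h1 : r = g⁻¹ * (r * pw z a) * g := by rw [← ha]; group
    have h2 : pw z a * pw z a = 1 := by
      rw [← pw_add f.zz, zmod2_add_self]; simp [pw]
    have h3 : r * pw z a = g⁻¹ * r * g := by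
      nth_rw 1 [h1]
      calc g⁻¹ * (r * pw z a) * g * pw z a = g⁻¹ * r * (pw z a * (g * pw z a)) := by group
        _ = g⁻¹ * r * g * (pw z a * pw z a) := by rw [← f.zpwK, ← mul_assoc (pw z a), h2]; group
        _ = _ := by rw [h2, mul_one]
    rw [h3, inv_inv]

theorem relIndex_MM (f : Fr K R z r α β φ) :
    (Subgroup.centralizer ({r} : Set K)).relIndex f.MM = 2 := by
  rw [Subgroup.relIndex_eq_two_iff_exists_notMem_and]
  obtain ⟨s, hs, hsα, hsβ, hsφ, hss, hrs⟩ := f.exists_s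
  have hs' : s⁻¹ = s := inv_eq_of_mul_eq_one_right hss
  have hc : s * r * s⁻¹ = r * pw z 1 := by
    rw [hs']
    simp only [pw, one_ne_zero, if_false]
    calc s * r * s = s * (r * s) := by group
      _ = (s * s) * r * z := by rw [hrs]; group
      _ = _ := by rw [hss, one_mul]
  refine ⟨s, ⟨1, hc⟩, ?_, ?_⟩
  · intro h
    have := memS h
    rw [this, hrs] at *
    have h2 := (f.commr_iff hs).1 (memS h)
    rw [hsβ] at h2
    exact one_ne_zero h2
  · rintro g ⟨a, ha⟩
    rw [Subgroup.mem_centralizer_singleton_iff, Subgroup.mem_centralizer_singleton_iff]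
    rcases zmod2_cases a with rfl | rfl
    · right
      simp only [pw, if_true, mul_one] at ha
      exact mul_inv_eq_iff_eq_mul.1 ha
    · left
      rw [← mul_inv_eq_iff_eq_mul]
      calc g * s * r * (g * s)⁻¹ = g * (s * r * s⁻¹) * g⁻¹ := by group
        _ = g * r * (pw z 1 * g⁻¹) := by rw [hc]; group
        _ = g * r * g⁻¹ * pw z 1 := by rw [f.zpwK]; group
        _ = r * (pw z 1 * pw z 1) := by rw [ha]; group
        _ = r := by simp [pw, f.zz]

theorem count27 : Fintype.card {v : ZMod 2 × ZMod 2 × WW // v ≠ 0 ∧ v.1 * v.2.1 + q4 v.2.2 = 0} = 27 := by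
  rw [Fintype.card_subtype]
  decide +kernel

theorem index_MM (f : Fr K R z r α β φ) : f.MM.index ≤ 27 := by
  rw [← count27, ← Nat.card_eq_fintype_card, Subgroup.index]
  have hΦ : ∀ g : K, ((α (g * r * g⁻¹), β (g * r * g⁻¹), φ (g * r * g⁻¹)) : ZMod 2 × ZMod 2 × WW) ≠ 0 ∧
      α (g * r * g⁻¹) * β (g * r * g⁻¹) + q4 (φ (g * r * g⁻¹)) = 0 := by
    intro g
    have hR := f.conjR g f.rR
    constructor
    · intro h
      simp only [Prod.mk_eq_zero] at h
      have hr : g * r * g⁻¹ = pw z 0 ∨ g * r * g⁻¹ = pw z 1 := by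
        simpa [pw] using f.ker _ hR h.1 h.2.1 h.2.2
      have key : ∀ a, g * r * g⁻¹ = pw z a → False := by
        intro a ha
        have h2 : r = pw z a := by
          calc r = g⁻¹ * (g * r * g⁻¹) * g := by group
            _ = _ := by rw [ha, mul_assoc, f.zpwK]; group
        have h3 : α r = 0 := by
          rw [h2]; unfold pw; split_ifs; exacts [f.α1, f.αz]
        rw [f.αr] at h3
        exact one_ne_zero h3
      exact hr.elim (key 0) (key 1)
    · have h1 := f.sq _ hR
      have h2 : g * r * g⁻¹ * (g * r * g⁻¹) = 1 := by
        calc g * r * g⁻¹ * (g * r * g⁻¹) = g * (r * r) * g⁻¹ := by group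
          _ = 1 := by rw [f.rr]; group
      rw [h2, f.zpw] at h1
      exact (f.pwz_inj (a := 0) (by rw [← h1]; simp [pw])).symm
  let Ψ : K → {v : ZMod 2 × ZMod 2 × WW // v ≠ 0 ∧ v.1 * v.2.1 + q4 v.2.2 = 0} :=
    fun g => ⟨(α (g * r * g⁻¹), β (g * r * g⁻¹), φ (g * r * g⁻¹)), hΦ g⟩
  let Ψ' : K ⧸ f.MM → {v : ZMod 2 × ZMod 2 × WW // v ≠ 0 ∧ v.1 * v.2.1 + q4 v.2.2 = 0} :=
    fun q => Ψ (Quotient.out q)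
  apply Nat.card_le_card_of_injective Ψ'
  intro p q hpq
  rw [← QuotientGroup.out_eq' p, ← QuotientGroup.out_eq' q, QuotientGroup.eq]
  have h := congrArg Subtype.val hpq
  simp only [Ψ', Ψ, Prod.mk.injEq] at h
  generalize Quotient.out p = g at h
  generalize Quotient.out q = k at h
  obtain ⟨h1, h2, h3⟩ := h
  have hg := f.conjR g f.rR
  have hk := f.conjR k f.rR
  have hx : g * r * g⁻¹ * (k * r * k⁻¹) = 1 ∨ g * r * g⁻¹ * (k * r * k⁻¹) = z := by
    apply f.ker _ (R.mul_mem hg hk)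
    · rw [f.αmul _ hg _ hk, h1, zmod2_add_self]
    · rw [f.βmul _ hg _ hk, h2, zmod2_add_self]
    · rw [f.φmul _ hg _ hk, h3]
      nth_rw 1 [← neg_eq (φ (k * r * k⁻¹))]
      exact neg_add_cancel _
  obtain ⟨a, ha⟩ : ∃ a, g * r * g⁻¹ * (k * r * k⁻¹) = pw z a := by
    rcases hx with h | h
    · exact ⟨0, by simp [h, pw]⟩
    · exact ⟨1, by simp [h, pw]⟩
  refine ⟨a, ?_⟩
  have h4 : k * r * k⁻¹ = g * r * g⁻¹ * pw z a := by
    have : (g * r * g⁻¹) * (g * r * g⁻¹) = 1 := by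
      calc g * r * g⁻¹ * (g * r * g⁻¹) = g * (r * r) * g⁻¹ := by group
          _ = 1 := by rw [f.rr]; group
    rw [← ha, ← mul_assoc, this, one_mul]
  calc g⁻¹ * k * r * (g⁻¹ * k)⁻¹ = g⁻¹ * (k * r * k⁻¹) * g := by group
    _ = r * g⁻¹ * (pw z a * g) := by rw [h4]; group
    _ = _ := by rw [f.zpwK]; group

end Fr

end

section


set_option linter.all false

theorem arith9 (a t m : ℕ) (ha : a ∣ 120) (ht : t ∣ 16) (hm : m ≤ 27) (h : a * t * m = 25920) :
    (a = 60 ∧ t = 16) ∨ (a = 120 ∧ t = 8) := by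
  have ht' : t = 1 ∨ t = 2 ∨ t = 4 ∨ t = 8 ∨ t = 16 := by
    have : t ≤ 16 := Nat.le_of_dvd (by norm_num) ht
    interval_cases t <;> revert ht <;> decide
  have ha' : a ≤ 120 := Nat.le_of_dvd (by norm_num) ha
  have h120 : a = 120 ∨ a ≤ 60 := by
    obtain ⟨c, hc⟩ := ha
    rcases Nat.lt_or_ge c 2 with h | h
    · interval_cases c <;> omega
    · right; nlinarith
  have h60 : a = 60 ∨ a ≤ 40 ∨ a = 120 := by
    obtain ⟨c, hc⟩ := ha
    rcases Nat.lt_or_ge c 3 with h | h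
    · interval_cases c <;> omega
    · right; left; nlinarith
  have e1 : a * t * m ≤ a * t * 27 := Nat.mul_le_mul_left _ hm
  rw [h] at e1
  rcases ht' with rfl | rfl | rfl | rfl | rfl <;> rcases h60 with rfl | h' | rfl <;> omega

namespace Fr
variable {K : Type*} [Group K] {R : Subgroup K} {z r : K} {α β : K → ZMod 2} {φ : K → WW}

theorem theta_surj (f : Fr K R z r α β φ) (hs : Function.Surjective f.rho5)
    (hn : ∃ g, f.thetaHom g ≠ 1) : Function.Surjective f.thetaHom := by
  let A : Set WW := {w | ∃ g : f.rho5.ker, θ R α β φ g.1.1 = w}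
  have hA : ∀ w, w ∈ A := by
    apply inv_sub_top
    · rintro _ ⟨g, rfl⟩ _ ⟨k, rfl⟩
      exact ⟨g * k, f.θ_mul ((f.mem_ker_rho5 _).1 g.2) ((f.mem_ker_rho5 _).1 k.2)⟩
    · obtain ⟨g, hg⟩ := hn
      exact ⟨_, ⟨g, rfl⟩, fun h => hg (congrArg Multiplicative.ofAdd h)⟩
    · rintro u hu _ ⟨g, rfl⟩
      let e : Equiv.Perm T5 := Function.Involutive.toPerm
        (fun w => ⟨tv u w.1, by
          refine ⟨?_, by rw [tv_q u _ hu, w.2.2]⟩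
          intro h
          apply w.2.1
          rw [← tv_tv u w.1 hu, h, tv_zero]⟩)
        (by
          intro w
          apply Subtype.ext
          exact tv_tv u w.1 hu)
      obtain ⟨k, hk⟩ := hs e
      have h1 : ∀ w, wact R β φ k.1 w = tv u w := by
        apply ext_T5 _ _ (f.wact_zero (memS k.2)) (tv_zero u) (f.wact_add (memS k.2)) (tv_add u)
        intro w
        rw [← f.rho5_apply, hk]; rfl
      refine ⟨⟨k * g.1 * k⁻¹, f.rho5.normal_ker.conj_mem _ g.2 k⟩, ?_⟩
      rw [← h1, ← f.θ_conj ((f.mem_ker_rho5 _).1 g.2) (memS k.2)]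
      rfl
  intro w
  obtain ⟨g, hg⟩ := hA (Multiplicative.toAdd w)
  exact ⟨g, congrArg Multiplicative.ofAdd hg⟩

theorem card_WW : Nat.card (Multiplicative WW) = 16 := by
  rw [Nat.card_congr Multiplicative.toAdd, Nat.card_eq_fintype_card]; decide

theorem exists_pi [Finite K] (f : Fr K R z r α β φ) (hR : Nat.card R = 128)
    (hK : Nat.card K = 128 * 25920) :
    ∃ π : Subgroup.centralizer ({r} : Set K) →* alternatingGroup (Fin 5),
      Function.Surjective π ∧ (∀ g, π g = 1 ↔ InN R r β φ g.1) ∧ Nat.card π.ker = 1024 := by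
  have h1 : Nat.card f.rho5.range ∣ 120 := by
    have := Subgroup.card_subgroup_dvd_card f.rho5.range
    rwa [Nat.card_perm, Nat.card_eq_fintype_card (α := T5), card_T5] at this
  have h2 : Nat.card f.thetaHom.range ∣ 16 := by
    have := Subgroup.card_subgroup_dvd_card f.thetaHom.range
    rwa [card_WW] at this
  have h3 := f.rho5.ker.card_mul_index
  rw [Subgroup.index_ker] at h3
  have h4 := f.thetaHom.ker.card_mul_index
  rw [Subgroup.index_ker, f.card_ker_theta hR] at h4
  have hle : Subgroup.centralizer ({r} : Set K) ≤ f.MM := by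
    intro g hg
    exact ⟨0, by simp [pw, memS hg]⟩
  have h5 := Subgroup.relIndex_mul_index hle
  rw [f.relIndex_MM] at h5
  have h6 := (Subgroup.centralizer ({r} : Set K)).card_mul_index
  rw [hK, ← h5, ← h3, ← h4] at h6
  have h7 : Nat.card f.rho5.range * Nat.card f.thetaHom.range * f.MM.index = 25920 := by
    have : 128 * (Nat.card f.rho5.range * Nat.card f.thetaHom.range * f.MM.index) = 128 * 25920 := by
      rw [← h6]; ring
    omega
  have h8 : Nat.card f.rho5.range = 60 ∧ Nat.card f.thetaHom.range = 16 := by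
    rcases arith9 _ _ _ h1 h2 f.index_MM h7 with h | h
    · exact h
    · exfalso
      have hs : Function.Surjective f.rho5 := by
        rw [← MonoidHom.range_eq_top]
        apply Subgroup.eq_top_of_card_eq
        rw [h.1, Nat.card_perm, Nat.card_eq_fintype_card (α := T5), card_T5]; rfl
      have ht := f.theta_surj hs (by
        by_contra hc
        push Not at hc
        have : f.thetaHom.range = ⊥ := by
          rw [eq_bot_iff]
          rintro _ ⟨g, rfl⟩
          exact hc g
        rw [this] at h
        simp at h)
      rw [← MonoidHom.range_eq_top] at ht
      rw [ht, Subgroup.card_top, card_WW] at h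
      omega
  have hcT : Nat.card T5 = 5 := by rw [Nat.card_eq_fintype_card, card_T5]
  have hidx : f.rho5.range.index = 2 := by
    have := f.rho5.range.card_mul_index
    rw [h8.1, Nat.card_perm, hcT] at this
    have e : Nat.factorial 5 = 120 := rfl
    omega
  have hr := Equiv.Perm.eq_alternatingGroup_of_index_eq_two hidx
  let e : T5 ≃ Fin 5 := Fintype.equivFinOfCardEq card_T5
  let ρ' : Subgroup.centralizer ({r} : Set K) →* alternatingGroup T5 :=
    f.rho5.codRestrict (alternatingGroup T5) (fun g => by rw [← hr]; exact ⟨g, rfl⟩)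
  have hker : ((e.altCongrHom).toMonoidHom.comp ρ').ker = f.rho5.ker := by
    ext g
    rw [MonoidHom.mem_ker, MonoidHom.mem_ker]
    simp [ρ']
  refine ⟨(e.altCongrHom).toMonoidHom.comp ρ', ?_, ?_, ?_⟩
  · rw [MonoidHom.coe_comp]
    refine (e.altCongrHom).surjective.comp ?_
    rintro ⟨x, hx⟩
    rw [← hr] at hx
    obtain ⟨g, rfl⟩ := hx
    exact ⟨g, rfl⟩
  · intro g
    rw [← f.mem_ker_rho5, ← hker, MonoidHom.mem_ker]
  · rw [hker, ← h4, h8.2]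

end Fr

end

section


set_option linter.all false

section
variable {K : Type*} [Group K] {V : Type*} [AddCommGroup V]

/-- fixed points -/
def fixV (ρ : K →* AddMonoid.End V) (g : K) : AddSubgroup V where
  carrier := {v | ρ g v = v}
  zero_mem' := map_zero _
  add_mem' := by
    intro a b ha hb
    show ρ g (a + b) = a + b
    rw [map_add, ha, hb]
  neg_mem' := by
    intro a ha
    show ρ g (-a) = -a
    rw [map_neg, ha]

theorem mem_fixV {ρ : K →* AddMonoid.End V} {g : K} {v : V} : v ∈ fixV ρ g ↔ ρ g v = v := Iff.rfl

theorem rho_mul (ρ : K →* AddMonoid.End V) (g k : K) (v : V) : ρ (g * k) v = ρ g (ρ k v) := by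
  rw [map_mul]; rfl
theorem rho_one (ρ : K →* AddMonoid.End V) (v : V) : ρ 1 v = v := by
  rw [map_one]; rfl
theorem rho_inv_self (ρ : K →* AddMonoid.End V) (g : K) (v : V) : ρ g⁻¹ (ρ g v) = v := by
  rw [← rho_mul, inv_mul_cancel, rho_one]
theorem rho_self_inv (ρ : K →* AddMonoid.End V) (g : K) (v : V) : ρ g (ρ g⁻¹ v) = v := by
  rw [← rho_mul, mul_inv_cancel, rho_one]

theorem fix_inv {ρ : K →* AddMonoid.End V} {g k : K} (h : g * k = k * g) {v : V} (hv : v ∈ fixV ρ k) :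
    ρ g v ∈ fixV ρ k := by
  rw [mem_fixV] at *
  rw [← rho_mul, ← h, rho_mul, hv]

/-- 3-torsion computations -/
theorem three_half (h3 : ∀ v : V, v + v + v = 0) (v w : V) : v = -(v + w) + -(v - w) := by
  have := h3 v
  have e : v = (v + v + v) + (-(v + w) + -(v - w)) := by abel
  rw [this, zero_add] at e
  exact e

theorem eq_zero_of_neg (h3 : ∀ v : V, v + v + v = 0) {v : V} (h : v = -v) : v = 0 := by
  have e : v + v = 0 := by nth_rw 1 [h]; simp
  have := h3 v
  rwa [e, zero_add] at this

theorem halving_dec (ρ : K →* AddMonoid.End V) (h3 : ∀ v : V, v + v + v = 0) {z s t : K}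
    (A : AddSubgroup V) (hA : ∀ g, (g = s ∨ g = t ∨ g = t⁻¹) → ∀ v ∈ A, ρ g v ∈ A)
    (hss : s * s = 1) (hst : s * t = t * s * z) (hz : ∀ v ∈ A, ρ z v = -v) :
    ∀ v ∈ A, ∃ a b, a ∈ A ⊓ fixV ρ s ∧ b ∈ A ⊓ fixV ρ s ∧ a + ρ t b = v := by
  intro v hv
  have hsv := hA s (Or.inl rfl) v hv
  have hss' : ∀ w, ρ s (ρ s w) = w := by
    intro w; rw [← rho_mul, hss, rho_one]
  have hst' : ∀ w ∈ A, ρ s (ρ t w) = -(ρ t (ρ s w)) := by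
    intro w hw
    rw [← rho_mul, hst, rho_mul, rho_mul, hz w hw, map_neg, map_neg]
  set c := -(v - ρ s v) with hc
  have hcA : c ∈ A := A.neg_mem (A.sub_mem hv hsv)
  refine ⟨-(v + ρ s v), ρ t⁻¹ c, ⟨A.neg_mem (A.add_mem hv hsv), ?_⟩,
    ⟨hA _ (Or.inr (Or.inr rfl)) _ hcA, ?_⟩, ?_⟩
  · show ρ s (-(v + ρ s v)) = _
    rw [map_neg, map_add, hss', add_comm]
  · show ρ s (ρ t⁻¹ c) = _
    have hb := hA _ (Or.inr (Or.inr rfl)) _ hcA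
    have h1 := hst' _ hb
    rw [rho_self_inv] at h1
    have h2 : ρ s c = -c := by
      rw [hc, map_neg, map_sub, hss']; abel
    rw [h2, neg_inj] at h1
    have h4 := congrArg (ρ t⁻¹) h1
    rw [rho_inv_self] at h4
    exact h4.symm
  · rw [rho_self_inv]
    exact (three_half h3 v _).symm

theorem halving (ρ : K →* AddMonoid.End V) (h3 : ∀ v : V, v + v + v = 0) {z s t : K}
    (A : AddSubgroup V) (hA : ∀ g, (g = s ∨ g = t ∨ g = t⁻¹) → ∀ v ∈ A, ρ g v ∈ A)
    (hss : s * s = 1) (hst : s * t = t * s * z) (hz : ∀ v ∈ A, ρ z v = -v) :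
    Nat.card A = Nat.card (A ⊓ fixV ρ s : AddSubgroup V) ^ 2 := by
  have hst' : ∀ w ∈ A, ρ s (ρ t w) = -(ρ t (ρ s w)) := by
    intro w hw
    rw [← rho_mul, hst, rho_mul, rho_mul, hz w hw, map_neg, map_neg]
  rw [pow_two, ← Nat.card_prod]
  symm
  let Φ : (A ⊓ fixV ρ s : AddSubgroup V) × (A ⊓ fixV ρ s : AddSubgroup V) → A :=
    fun p => ⟨p.1.1 + ρ t p.2.1, A.add_mem p.1.2.1 (hA _ (Or.inr (Or.inl rfl)) _ p.2.2.1)⟩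
  apply Nat.card_eq_of_bijective Φ
  constructor
  · rintro ⟨⟨a, ha, ha'⟩, ⟨b, hb, hb'⟩⟩ ⟨⟨c, hc, hc'⟩, ⟨d, hd, hd'⟩⟩ h
    have h1 : a + ρ t b = c + ρ t d := congrArg Subtype.val h
    replace ha' : ρ s a = a := ha'
    replace hb' : ρ s b = b := hb'
    replace hc' : ρ s c = c := hc'
    replace hd' : ρ s d = d := hd'
    have h2 := congrArg (ρ s) h1
    rw [map_add, map_add, hst' b hb, hst' d hd, ha', hb', hc', hd'] at h2
    have h5 : b = d := by
      have e1 : ρ t b - ρ t d = -(ρ t b - ρ t d) := by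
        rw [eq_neg_iff_add_eq_zero]
        have e : ρ t b - ρ t d + (ρ t b - ρ t d) =
          ((a + ρ t b) - (c + ρ t d)) - ((a + -ρ t b) - (c + -ρ t d)) := by abel
        rw [e, h1, h2]; simp
      have e2 := eq_zero_of_neg h3 e1
      rw [sub_eq_zero] at e2
      have := congrArg (ρ t⁻¹) e2
      rwa [rho_inv_self, rho_inv_self] at this
    subst h5
    have h6 : a = c := add_right_cancel h1
    subst h6
    rfl
  · rintro ⟨v, hv⟩
    obtain ⟨a, b, ha, hb, h⟩ := halving_dec ρ h3 A hA hss hst hz v hv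
    exact ⟨(⟨a, ha⟩, ⟨b, hb⟩), Subtype.ext h⟩

end

end

section


set_option linter.all false

namespace Fr
variable {K : Type*} [Group K] {R : Subgroup K} {z r : K} {α β : K → ZMod 2} {φ : K → WW}

theorem exists_w (f : Fr K R z r α β φ) : ∃ w1 w2 w3 w4, MF R β w1 ∧ MF R β w2 ∧ MF R β w3 ∧ MF R β w4 ∧
    w1 * w1 = 1 ∧ w1 * w2 = w2 * w1 * z ∧ w3 * w3 = z ∧ w3 * w4 = w4 * w3 * z ∧ w3 * w1 = w1 * w3 ∧
    w4 * w1 = w1 * w4 := by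
  obtain ⟨w1, h1, a1, b1, c1⟩ := f.surj 0 0 (1, 0, 0, 0)
  obtain ⟨w2, h2, a2, b2, c2⟩ := f.surj 0 0 (0, 1, 0, 0)
  obtain ⟨w3, h3, a3, b3, c3⟩ := f.surj 0 0 (0, 0, 1, 0)
  obtain ⟨w4, h4, a4, b4, c4⟩ := f.surj 0 0 (0, 0, 0, 1)
  refine ⟨w1, w2, w3, w4, ⟨h1, b1⟩, ⟨h2, b2⟩, ⟨h3, b3⟩, ⟨h4, b4⟩, ?_, ?_, ?_, ?_, ?_, ?_⟩
  · rw [f.sq _ h1, a1, b1, c1, if_pos (by decide)]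
  · rw [f.comm _ h1 _ h2, a1, b1, c1, a2, b2, c2, if_neg (by decide)]
  · rw [f.sq _ h3, a3, b3, c3, if_neg (by decide)]
  · rw [f.comm _ h3 _ h4, a3, b3, c3, a4, b4, c4, if_neg (by decide)]
  · rw [f.comm_iff h3 h1, a3, b3, c3, a1, b1, c1]; decide
  · rw [f.comm_iff h4 h1, a4, b4, c4, a1, b1, c1]; decide

theorem zc (f : Fr K R z r α β φ) {V : Type*} [AddCommGroup V] (ρ : K →* AddMonoid.End V) (g : K) (v : V) :
    ρ z (ρ g v) = ρ g (ρ z v) := by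
  rw [← rho_mul, f.zK, rho_mul]

/-- the `-1` eigenspace of `z` -/
def negV {K : Type*} [Group K] {V : Type*} [AddCommGroup V] (ρ : K →* AddMonoid.End V) (z : K) :
    AddSubgroup V where
  carrier := {v | ρ z v = -v}
  zero_mem' := by simp
  add_mem' := by
    intro a b ha hb
    show ρ z (a + b) = -(a + b)
    rw [map_add, ha, hb]; abel
  neg_mem' := by
    intro a ha
    show ρ z (-a) = - -a
    rw [map_neg, ha]

theorem rep_card (f : Fr K R z r α β φ) {V : Type*} [AddCommGroup V] (h3 : ∀ v : V, v + v + v = 0)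
    (hV : Nat.card V = 3 ^ 8) (ρ : K →* AddMonoid.End V) (hz : ∃ v, ρ z v ≠ v) :
    (∀ v, ρ z v = -v) ∧ Nat.card (fixV ρ r) = 81 ∧
    ∃ w1 w2 w3 w4, MF R β w1 ∧ MF R β w2 ∧ MF R β w3 ∧ MF R β w4 ∧
    w1 * w1 = 1 ∧ w1 * w2 = w2 * w1 * z ∧ w3 * w3 = z ∧ w3 * w4 = w4 * w3 * z ∧ w3 * w1 = w1 * w3 ∧
    w4 * w1 = w1 * w4 ∧ Nat.card (fixV ρ r ⊓ fixV ρ w1 : AddSubgroup V) = 9 := by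
  have : Finite V := Nat.finite_of_card_ne_zero (by rw [hV]; norm_num)
  obtain ⟨w1, w2, w3, w4, hw1, hw2, hw3, hw4, h11, h12, h33, h34, h31, h41⟩ := f.exists_w
  obtain ⟨s, hs, hsα, hsβ, hsφ, hss, hrs⟩ := f.exists_s
  have hU : ∀ g, ∀ v ∈ negV ρ z, ρ g v ∈ negV ρ z := by
    intro g v hv
    show ρ z (ρ g v) = -(ρ g v)
    rw [f.zc, show ρ z v = -v from hv, map_neg]
  have c1 := halving ρ h3 (negV ρ z) (fun g _ => hU g) f.rr hrs (fun v hv => hv)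
  have hinv : ∀ g, MF R β g → ∀ v ∈ negV ρ z ⊓ fixV ρ r, ρ g v ∈ negV ρ z ⊓ fixV ρ r := by
    intro g hg v hv
    exact ⟨hU g v hv.1, fix_inv (f.MF_comm hg) hv.2⟩
  have c2 := halving ρ h3 (negV ρ z ⊓ fixV ρ r) (by
    rintro g (rfl | rfl | rfl)
    · exact hinv _ hw1
    · exact hinv _ hw2
    · exact hinv _ (f.MF_inv hw2)) h11 h12 (fun v hv => hv.1)
  set n := Nat.card (negV ρ z ⊓ fixV ρ r ⊓ fixV ρ w1 : AddSubgroup V) with hn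
  have hn1 : Nat.card (negV ρ z) = n ^ 4 := by rw [c1, c2]; ring
  have hdvd : n ^ 4 ∣ 3 ^ 8 := by
    rw [← hn1, ← hV]
    exact AddSubgroup.card_addSubgroup_dvd_card _
  have hne : n ≠ 1 := by
    intro h1
    rw [h1] at hn1
    obtain ⟨v, hv⟩ := hz
    have hmem : v - ρ z v ∈ negV ρ z := by
      show ρ z (v - ρ z v) = -(v - ρ z v)
      rw [map_sub, ← rho_mul, f.zz, rho_one]; abel
    have hb := AddSubgroup.eq_bot_of_card_eq (negV ρ z) (by rw [hn1]; norm_num)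
    rw [hb, AddSubgroup.mem_bot, sub_eq_zero] at hmem
    exact hv hmem.symm
  obtain ⟨k, hk, hk'⟩ := (Nat.dvd_prime_pow Nat.prime_three).1 (dvd_trans (dvd_pow_self n (by norm_num)) hdvd)
  have hk2 : k = 1 ∨ k = 2 := by
    rw [hk', ← pow_mul] at hdvd
    have := (Nat.pow_dvd_pow_iff_le_right (by norm_num : 1 < 3)).1 hdvd
    have : k ≠ 0 := by rintro rfl; exact hne hk'
    omega
  have hk3 : k = 2 := by
    rcases hk2 with rfl | h
    · exfalso
      rw [pow_one] at hk'
      have hinv3 : ∀ v ∈ negV ρ z ⊓ fixV ρ r ⊓ fixV ρ w1, ρ w3 v ∈ negV ρ z ⊓ fixV ρ r ⊓ fixV ρ w1 := by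
        intro v hv
        exact ⟨hinv _ hw3 v hv.1, fix_inv h31 hv.2⟩
      set A := negV ρ z ⊓ fixV ρ r ⊓ fixV ρ w1 with hA
      have : A ≠ ⊥ := by
        intro h
        rw [h] at hn
        simp at hn
        omega
      obtain ⟨⟨u, hu⟩, hu0'⟩ := AddSubgroup.ne_bot_iff_exists_ne_zero.1 this
      have hu0 : u ≠ 0 := fun h => hu0' (Subtype.ext h)
      have hord : ∀ x : A, x ∈ AddSubgroup.zmultiples (⟨u, hu⟩ : A) := by
        haveI : Fact (Nat.Prime 3) := ⟨Nat.prime_three⟩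
        intro x
        exact mem_zmultiples_of_prime_card (p := 3) (by rw [← hk', hn]) (by
          intro h; exact hu0 (congrArg Subtype.val h))
      obtain ⟨m, hm⟩ := hord ⟨ρ w3 u, hinv3 u hu⟩
      have hm' : m • u = ρ w3 u := congrArg Subtype.val hm
      have h4 : ρ w3 (ρ w3 u) = -u := by
        rw [← rho_mul, h33]; exact hu.1.1
      rw [← hm', map_zsmul, ← hm', ← mul_smul] at h4
      have h5 : (m * m + 1) • u = 0 := by
        rw [add_smul, h4, one_smul]; simp
      have h6 : (3 : ℤ) • u = 0 := by
        have := h3 u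
        rw [← this]; abel
      have h7 : u = 0 := by
        have hcop : IsCoprime (m * m + 1) 3 := by
          rw [Int.isCoprime_iff_gcd_eq_one]
          have : (m * m + 1) % 3 = 1 ∨ (m * m + 1) % 3 = 2 := by
            have : m % 3 = 0 ∨ m % 3 = 1 ∨ m % 3 = 2 := by omega
            rcases this with h | h | h <;> simp [Int.add_emod, Int.mul_emod, h]
          rcases this with h | h
          · rw [← Int.gcd_emod, h]; rfl
          · rw [← Int.gcd_emod, h]; rfl
        obtain ⟨a, b, hab⟩ := hcop
        calc u = (1 : ℤ) • u := (one_smul _ _).symm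
          _ = a • ((m * m + 1) • u) + b • ((3 : ℤ) • u) := by rw [← mul_smul, ← mul_smul, ← add_smul, hab]
          _ = 0 := by rw [h5, h6]; simp
      exact hu0 h7
    · exact h
  subst hk3
  rw [hk'] at hn1
  have htop : negV ρ z = ⊤ := AddSubgroup.eq_top_of_card_eq _ (by rw [hn1, hV]; norm_num)
  rw [htop, top_inf_eq] at hn c2
  refine ⟨fun v => ?_, ?_, w1, w2, w3, w4, hw1, hw2, hw3, hw4, h11, h12, h33, h34, h31, h41, ?_⟩
  · have : v ∈ negV ρ z := by rw [htop]; trivial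
    exact this
  · rw [c2, hk']; norm_num
  · rw [← hn, hk']; norm_num

end Fr

end

section


set_option linter.all false

namespace Fr
variable {K : Type*} [Group K] {R : Subgroup K} {z r : K} {α β : K → ZMod 2} {φ : K → WW}

theorem schur (f : Fr K R z r α β φ) {V : Type*} [AddCommGroup V] (h3 : ∀ v : V, v + v + v = 0)
    (hV : Nat.card V = 3 ^ 8) (ρ : K →* AddMonoid.End V) (hz : ∃ v, ρ z v ≠ v) {g : K}
    (hgr : g * r = r * g) (hg : ∀ x, MF R β x → ∀ v ∈ fixV ρ r, ρ g (ρ x v) = ρ x (ρ g v)) :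
    (∀ v ∈ fixV ρ r, ρ g v = v) ∨ (∀ v ∈ fixV ρ r, ρ g v = -v) := by
  obtain ⟨hneg, hc, w1, w2, w3, w4, hw1, hw2, hw3, hw4, h11, h12, h33, h34, h31, h41, h9⟩ :=
    f.rep_card h3 hV ρ hz
  have : Finite V := Nat.finite_of_card_ne_zero (by rw [hV]; norm_num)
  letI : Module (ZMod 3) V := AddCommGroup.zmodModule (n := 3) (fun v => by
    rw [← h3 v]; abel)
  set A := fixV ρ r ⊓ fixV ρ w1 with hA
  have hAw : ∀ x, MF R β x → x * w1 = w1 * x → ∀ v ∈ A, ρ x v ∈ A := by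
    intro x hx hx1 v hv
    exact ⟨fix_inv (f.MF_comm hx) hv.1, fix_inv hx1 hv.2⟩
  have hAg : ∀ v ∈ A, ρ g v ∈ A := by
    intro v hv
    refine ⟨fix_inv hgr hv.1, ?_⟩
    show ρ w1 (ρ g v) = ρ g v
    rw [← hg w1 hw1 v hv.1, show ρ w1 v = v from hv.2]
  have hAs : ∀ (c : ZMod 3), ∀ v ∈ A, c • v ∈ A := by
    intro c v hv
    exact ZMod.smul_mem hv c
  have hne : A ≠ ⊥ := by
    intro h
    rw [h] at h9
    simp at h9
  obtain ⟨⟨u, hu⟩, hu0'⟩ := AddSubgroup.ne_bot_iff_exists_ne_zero.1 hne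
  have hu0 : u ≠ 0 := fun h => hu0' (Subtype.ext h)
  have h33' : ∀ v, ρ w3 (ρ w3 v) = -v := by
    intro v; rw [← rho_mul, h33, hneg]
  have hindep : ∀ c : ZMod 3, ρ w3 u ≠ c • u := by
    intro c h
    have h4 := h33' u
    rw [h, ZMod.map_smul, h, smul_smul] at h4
    have h5 : (c * c + 1) • u = 0 := by rw [add_smul, h4, one_smul]; simp
    have h6 : c * c + 1 ≠ 0 := (by decide : ∀ c : ZMod 3, c * c + 1 ≠ 0) c
    rcases smul_eq_zero.1 h5 with h | h
    · exact h6 h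
    · exact hu0 h
  let Φ : ZMod 3 × ZMod 3 → A := fun p =>
    ⟨p.1 • u + p.2 • ρ w3 u, A.add_mem (hAs _ _ hu) (hAs _ _ (hAw w3 hw3 h31 u hu))⟩
  have hΦ : Function.Bijective Φ := by
    apply (Nat.bijective_iff_injective_and_card Φ).2
    constructor
    · rintro ⟨a, b⟩ ⟨c, d⟩ h
      have h1 : a • u + b • ρ w3 u = c • u + d • ρ w3 u := congrArg Subtype.val h
      have h2 : (b - d) • ρ w3 u = (c - a) • u := by
        rw [sub_smul, sub_smul, sub_eq_sub_iff_add_eq_add, add_comm, h1]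
      have hbd : b - d = 0 := by
        by_contra hbd
        apply hindep ((b - d)⁻¹ * (c - a))
        rw [mul_smul, ← h2, smul_smul, inv_mul_cancel₀ hbd, one_smul]
      rw [hbd, zero_smul] at h2
      have hac : c - a = 0 := (smul_eq_zero.1 h2.symm).resolve_right hu0
      rw [sub_eq_zero] at hbd hac
      rw [hbd, hac]
    · rw [h9]; simp
  have hex : ∀ v ∈ A, ∃ a b : ZMod 3, v = a • u + b • ρ w3 u := by
    intro v hv
    obtain ⟨⟨a, b⟩, h⟩ := hΦ.2 ⟨v, hv⟩
    exact ⟨a, b, (congrArg Subtype.val h).symm⟩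
  obtain ⟨a, b, hab⟩ := hex _ (hAg u hu)
  have hgA : ∀ v ∈ A, ρ g v = a • v + b • ρ w3 v := by
    intro v hv
    obtain ⟨c, d, rfl⟩ := hex v hv
    simp only [map_add, ZMod.map_smul, hg w3 hw3 u hu.1, hab, smul_add, smul_smul]
    rw [mul_comm a c, mul_comm b c, mul_comm a d, mul_comm b d]
    abel
  have h43 : ∀ v, ρ w3 (ρ w4 v) = -(ρ w4 (ρ w3 v)) := by
    intro v
    rw [← rho_mul, h34, rho_mul, rho_mul, hneg, map_neg, map_neg]
  have hb : b = 0 := by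
    have h5 := hg w4 hw4 u hu.1
    rw [hgA _ (hAw w4 hw4 h41 u hu), hab, map_add, ZMod.map_smul, ZMod.map_smul, h43,
      add_right_inj, smul_neg] at h5
    have h6 := eq_zero_of_neg h3 h5.symm
    refine (smul_eq_zero.1 h6).resolve_right ?_
    intro h7
    apply hu0
    have h8 := congrArg (ρ w4⁻¹) h7
    rw [rho_inv_self, map_zero] at h8
    have h10 := congrArg (ρ w3⁻¹) h8
    rwa [rho_inv_self, map_zero] at h10
  have hall : ∀ v ∈ fixV ρ r, ρ g v = a • v := by
    intro v hv
    obtain ⟨p, q, hp, hq, rfl⟩ := halving_dec ρ h3 (fixV ρ r) (by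
      rintro k (rfl | rfl | rfl) v hv
      · exact fix_inv (f.MF_comm hw1) hv
      · exact fix_inv (f.MF_comm hw2) hv
      · exact fix_inv (f.MF_comm (f.MF_inv hw2)) hv) h11 h12 (fun v _ => hneg v) v hv
    rw [map_add, hg w2 hw2 q hq.1, hgA p hp, hgA q hq, hb, zero_smul, add_zero, zero_smul, add_zero,
      ZMod.map_smul, smul_add]
  have ha : a = 0 ∨ a = 1 ∨ a = -1 := (by decide : ∀ a : ZMod 3, a = 0 ∨ a = 1 ∨ a = -1) a
  rcases ha with rfl | rfl | rfl
  · exfalso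
    apply hu0
    have h8 := congrArg (ρ g⁻¹) (hall u hu.1)
    rwa [rho_inv_self, zero_smul, map_zero] at h8
  · left; intro v hv; rw [hall v hv, one_smul]
  · right; intro v hv; rw [hall v hv, neg_smul, one_smul]

theorem D_F (f : Fr K R z r α β φ) {V : Type*} [AddCommGroup V] (h3 : ∀ v : V, v + v + v = 0)
    (hV : Nat.card V = 3 ^ 8) (ρ : K →* AddMonoid.End V) (hz : ∃ v, ρ z v ≠ v) {x : K}
    (hx : MF R β x) (hD : ∀ v ∈ fixV ρ r, ρ x v = v) : x = 1 ∨ x = r := by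
  obtain ⟨hneg, hc, -⟩ := f.rep_card h3 hV ρ hz
  have hne : fixV ρ r ≠ ⊥ := by
    intro h
    rw [h] at hc
    simp at hc
  obtain ⟨⟨u, hu⟩, hu0'⟩ := AddSubgroup.ne_bot_iff_exists_ne_zero.1 hne
  have hu0 : u ≠ 0 := fun h => hu0' (Subtype.ext h)
  have hφ : φ x = 0 := by
    apply B4_nondeg
    intro w
    by_contra hw
    obtain ⟨h1, h2⟩ := f.lft_spec w
    have h4 := f.comm _ hx.1 _ h1.1
    rw [hx.2, h1.2, h2, mul_zero, zero_mul, zero_add, zero_add, if_neg hw] at h4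
    have h5 := congrArg (fun k => ρ k u) h4
    simp only [rho_mul] at h5
    rw [hneg, map_neg, map_neg, hD u hu, hD _ (fix_inv (f.MF_comm h1) hu)] at h5
    have h6 := eq_zero_of_neg h3 h5
    have h8 := congrArg (ρ (lft R β φ w)⁻¹) h6
    rw [rho_inv_self, map_zero] at h8
    exact hu0 h8
  obtain ⟨b, hb⟩ := f.Z4_eq hx hφ
  rcases zmod2_cases b with rfl | rfl
  · rcases zmod2_cases (α x) with h | h <;> rw [h] at hb
    · left; rw [hb]; simp [pw]
    · right; rw [hb]; simp [pw]
  · exfalso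
    have h5 := hD u hu
    have h6 : ρ x u = -u := by
      rw [hb, rho_mul]
      have : ρ (pw z 1) u = -u := by simp [pw, hneg]
      rw [this, map_neg]
      unfold pw
      split_ifs
      · rw [rho_one]
      · rw [show ρ r u = u from hu]
    rw [h6] at h5
    exact hu0 (eq_zero_of_neg h3 h5.symm)

/-- elements of `C(r)` acting trivially on the fixed points of `r` -/
def DD (r : K) {V : Type*} [AddCommGroup V] (ρ : K →* AddMonoid.End V) :
    Subgroup (Subgroup.centralizer ({r} : Set K)) where
  carrier := {g | ∀ v ∈ fixV ρ r, ρ g.1 v = v}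
  one_mem' := fun v _ => rho_one ρ v
  mul_mem' := by
    intro a b ha hb v hv
    show ρ (a.1 * b.1) v = v
    rw [rho_mul, hb v hv, ha v hv]
  inv_mem' := by
    intro a ha v hv
    show ρ (a.1⁻¹) v = v
    have := rho_inv_self ρ a.1 v
    rwa [ha v hv] at this

theorem mem_DD {V : Type*} [AddCommGroup V] {ρ : K →* AddMonoid.End V}
    {g : Subgroup.centralizer ({r} : Set K)} : g ∈ DD r ρ ↔ ∀ v ∈ fixV ρ r, ρ g.1 v = v := Iff.rfl

instance DD_normal {V : Type*} [AddCommGroup V] (ρ : K →* AddMonoid.End V) : (DD r ρ).Normal := by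
  constructor
  intro n hn g v hv
  show ρ (g.1 * n.1 * g.1⁻¹) v = v
  rw [rho_mul, rho_mul, hn _ (fix_inv (comm_inv (memS g.2)) hv), rho_self_inv]

theorem DD_InN (f : Fr K R z r α β φ) {V : Type*} [AddCommGroup V] (h3 : ∀ v : V, v + v + v = 0)
    (hV : Nat.card V = 3 ^ 8) (ρ : K →* AddMonoid.End V) (hz : ∃ v, ρ z v ≠ v)
    {g : Subgroup.centralizer ({r} : Set K)} (hg : g ∈ DD r ρ) : InN R r β φ g.1 := by
  refine ⟨memS g.2, fun x hx => ?_⟩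
  have h1 : MF R β (g.1 * x * g.1⁻¹ * x⁻¹) := f.MF_mul (f.MF_conj (memS g.2) hx) (f.MF_inv hx)
  have h2 := f.D_F h3 hV ρ hz h1 (by
    let y : Subgroup.centralizer ({r} : Set K) := ⟨x, Subgroup.mem_centralizer_singleton_iff.2 (f.MF_comm hx)⟩
    have : g * (y * g⁻¹ * y⁻¹) ∈ DD r ρ := (DD r ρ).mul_mem hg
      ((DD_normal ρ).conj_mem _ ((DD r ρ).inv_mem hg) y)
    have e : (g * (y * g⁻¹ * y⁻¹)).1 = g.1 * x * g.1⁻¹ * x⁻¹ := by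
      show g.1 * (x * g.1⁻¹ * x⁻¹) = _
      group
    intro v hv
    rw [← e]
    exact this v hv)
  have h4 : φ (g.1 * x * g.1⁻¹ * x⁻¹) = 0 := by
    rcases h2 with h | h <;> rw [h]
    exacts [f.φ1, f.φr]
  rw [f.φmul _ (f.conjR _ hx.1) _ (R.inv_mem hx.1), f.φinv hx.1] at h4
  rw [eq_neg_of_add_eq_zero_left h4, neg_eq]

theorem N_eq (f : Fr K R z r α β φ) {V : Type*} [AddCommGroup V] (h3 : ∀ v : V, v + v + v = 0)
    (hV : Nat.card V = 3 ^ 8) (ρ : K →* AddMonoid.End V) (hz : ∃ v, ρ z v ≠ v)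
    {g : Subgroup.centralizer ({r} : Set K)} (hg : InN R r β φ g.1) :
    ∃ k d : Subgroup.centralizer ({r} : Set K), MF R β k.1 ∧ d ∈ DD r ρ ∧ g = k * d := by
  obtain ⟨k, hk, hkx⟩ := f.mid hg
  obtain ⟨hneg, -⟩ := f.rep_card h3 hV ρ hz
  have hcr : (k⁻¹ * g.1) * r = r * (k⁻¹ * g.1) := by
    rw [mul_assoc, memS g.2, ← mul_assoc, f.MF_comm (f.MF_inv hk), mul_assoc]
  have := f.schur h3 hV ρ hz hcr (by
    intro x hx v hv
    have h1 := hkx x hx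
    rw [mul_inv_eq_iff_eq_mul] at h1
    rw [← rho_mul, h1, rho_mul, rho_mul]
    have h2 : ρ (k⁻¹ * g.1) v ∈ fixV ρ r := fix_inv hcr hv
    congr 1
    unfold pw
    split_ifs
    · rw [rho_one]
    · exact h2)
  have hzS : z ∈ Subgroup.centralizer ({r} : Set K) := Subgroup.mem_centralizer_singleton_iff.2 (f.zK r)
  have hkS : k ∈ Subgroup.centralizer ({r} : Set K) := Subgroup.mem_centralizer_singleton_iff.2 (f.MF_comm hk)
  rcases this with h | h
  · refine ⟨⟨k, hkS⟩, (⟨k, hkS⟩ : Subgroup.centralizer ({r} : Set K))⁻¹ * g, hk, h, by group⟩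
  · refine ⟨⟨k, hkS⟩ * ⟨z, hzS⟩, (⟨k, hkS⟩ * ⟨z, hzS⟩)⁻¹ * g, f.MF_mul hk f.MF_z, ?_, by group⟩
    intro v hv
    show ρ ((k * z)⁻¹ * g.1) v = v
    have e : (k * z)⁻¹ * g.1 = z * (k⁻¹ * g.1) := by
      rw [mul_inv_rev, inv_eq_of_mul_eq_one_right f.zz, mul_assoc]
    rw [e, rho_mul, h v hv, hneg, neg_neg]

end Fr

end

section


set_option linter.all false
open scoped commutatorElement

theorem Op_simple_bot (p : ℕ) [Fact p.Prime] (hp : ∀ k : ℕ, p ^ k ≠ 60) :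
    Op p (alternatingGroup (Fin 5)) = ⊥ := by
  rcases (Op.normal p (alternatingGroup (Fin 5))).eq_bot_or_eq_top with h | h
  · exact h
  · exfalso
    have h1 := isPGroup_Op p (alternatingGroup (Fin 5))
    obtain ⟨k, hk⟩ := IsPGroup.iff_card.1 h1
    rw [h, Subgroup.card_top, nat_card_alternatingGroup] at hk
    simp [Nat.factorial] at hk
    exact hp k hk.symm

namespace Fr
variable {K : Type*} [Group K] {R : Subgroup K} {z r : K} {α β : K → ZMod 2} {φ : K → WW}

/-- `C_R(r)` inside `C_K(r)` -/
def FF (f : Fr K R z r α β φ) : Subgroup (Subgroup.centralizer ({r} : Set K)) where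
  carrier := {g | MF R β g.1}
  one_mem' := f.MF_one
  mul_mem' := fun ha hb => f.MF_mul ha hb
  inv_mem' := fun ha => f.MF_inv ha

theorem FF_normal (f : Fr K R z r α β φ) : f.FF.Normal :=
  ⟨fun _ hn g => f.MF_conj (memS g.2) hn⟩

theorem card_FF (f : Fr K R z r α β φ) (hR : Nat.card R = 128) : Nat.card f.FF = 64 := by
  rw [← f.card_MF hR]
  apply Nat.card_congr
  exact
  { toFun := fun g => ⟨g.1.1, g.2⟩
    invFun := fun x => ⟨⟨x.1, Subgroup.mem_centralizer_singleton_iff.2 (f.MF_comm x.2)⟩, x.2⟩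
    left_inv := fun _ => rfl
    right_inv := fun _ => rfl }

theorem r1 (f : Fr K R z r α β φ) : r ≠ 1 := by
  intro h
  have h1 := f.αr
  rw [h, f.α1] at h1
  exact zero_ne_one h1

theorem zr (f : Fr K R z r α β φ) : z ≠ r := by
  intro h
  have h1 := f.αr
  rw [← h, f.αz] at h1
  exact zero_ne_one h1

theorem DD_two [Finite K] (f : Fr K R z r α β φ) {V : Type*} [AddCommGroup V] (h3 : ∀ v : V, v + v + v = 0)
    (hV : Nat.card V = 3 ^ 8) (ρ : K →* AddMonoid.End V) (hz : ∃ v, ρ z v ≠ v)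
    (hR : Nat.card R = 128) (hK : Nat.card K = 128 * 25920) : IsPGroup 2 (DD r ρ) := by
  obtain ⟨π, hπ, hπk, hπc⟩ := f.exists_pi hR hK
  have h1 : IsPGroup 2 π.ker := IsPGroup.of_card (n := 10) (by rw [hπc]; norm_num)
  refine h1.to_le ?_
  intro g hg
  rw [MonoidHom.mem_ker, hπk]
  exact f.DD_InN h3 hV ρ hz hg

theorem K_final [Finite K] (f : Fr K R z r α β φ) {V : Type*} [AddCommGroup V] (h3 : ∀ v : V, v + v + v = 0)
    (hV : Nat.card V = 3 ^ 8) (ρ : K →* AddMonoid.End V) (hz : ∃ v, ρ z v ≠ v)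
    (hR : Nat.card R = 128) (hK : Nat.card K = 128 * 25920) {Y : Type*} [Group Y] [Finite Y]
    (q : Subgroup.centralizer ({r} : Set K) →* Y) (hq : Function.Surjective q) (hqk : q.ker = DD r ρ) :
    IsExtraspecial 2 (Op 2 Y) ∧ Nat.card (Op 2 Y) = 2 ^ 5 ∧ Op 3 Y = ⊥ ∧
      Nonempty (Y ⧸ Op 2 Y ≃* alternatingGroup (Fin 5)) := by
  haveI : Fact (Nat.Prime 3) := ⟨Nat.prime_three⟩
  obtain ⟨π, hπ, hπk, hπc⟩ := f.exists_pi hR hK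
  have hzS : z ∈ Subgroup.centralizer ({r} : Set K) := Subgroup.mem_centralizer_singleton_iff.2 (f.zK r)
  have hrS : r ∈ Subgroup.centralizer ({r} : Set K) := Subgroup.mem_centralizer_singleton_iff.2 rfl
  set zS : Subgroup.centralizer ({r} : Set K) := ⟨z, hzS⟩ with hzSd
  set rS : Subgroup.centralizer ({r} : Set K) := ⟨r, hrS⟩ with hrSd
  have hq1 : ∀ g, q g = 1 ↔ g ∈ DD r ρ := by
    intro g; rw [← hqk, MonoidHom.mem_ker]
  have hqr : q rS = 1 := (hq1 _).2 (fun v hv => hv)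
  have hqz : q zS ≠ 1 := by
    rw [Ne, hq1]
    intro h
    rcases f.D_F h3 hV ρ hz f.MF_z h with h | h
    · exact f.z1 h
    · exact f.zr h
  set E := f.FF.map q with hE
  haveI hEn : E.Normal := f.FF_normal.map q hq
  -- card
  have hEc : Nat.card E = 2 ^ 5 := by
    set q' := q.comp f.FF.subtype with hq'
    have e1 : q'.range = E := by
      rw [hq', MonoidHom.range_comp, Subgroup.range_subtype]
    have e2 := q'.ker.card_mul_index
    rw [Subgroup.index_ker, e1, f.card_FF hR] at e2
    have e3 : Nat.card q'.ker = 2 := by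
      rw [Nat.card_eq_two_iff]
      refine ⟨1, ⟨⟨rS, f.MF_r⟩, hqr⟩, ?_, ?_⟩
      · intro h
        exact f.r1 (congrArg (fun x => x.1.1.1) h).symm
      · rw [Set.eq_univ_iff_forall]
        rintro ⟨⟨⟨x, hxS⟩, hx⟩, hxk⟩
        have hxD : (⟨x, hxS⟩ : Subgroup.centralizer ({r} : Set K)) ∈ DD r ρ := (hq1 _).1 hxk
        rcases f.D_F h3 hV ρ hz hx hxD with h | h
        · left; subst h; rfl
        · right; exact Subtype.ext (Subtype.ext (Subtype.ext h))
    rw [e3] at e2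
    omega
  have hEp : IsPGroup 2 E := IsPGroup.of_card hEc
  have hzE : q zS ∈ E := ⟨zS, f.MF_z, rfl⟩
  have hzz : q zS * q zS = 1 := by
    rw [← map_mul]
    have : zS * zS = 1 := Subtype.ext f.zz
    rw [this, map_one]
  have hpwz : ∀ b, ∀ h : pw z b ∈ Subgroup.centralizer ({r} : Set K), ∀ x : E, x.1 = q ⟨pw z b, h⟩ →
      x ∈ Subgroup.zpowers (⟨q zS, hzE⟩ : E) := by
    intro b h x hx
    rcases zmod2_cases b with rfl | rfl
    · have : x = 1 := by
        apply Subtype.ext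
        rw [hx]
        have : (⟨pw z 0, h⟩ : Subgroup.centralizer ({r} : Set K)) = 1 := Subtype.ext (by simp [pw])
        rw [this, map_one]; rfl
      rw [this]; exact one_mem _
    · have : x = ⟨q zS, hzE⟩ := by
        apply Subtype.ext
        rw [hx]
        have : (⟨pw z 1, h⟩ : Subgroup.centralizer ({r} : Set K)) = zS := Subtype.ext (by simp [pw, zS])
        rw [this]
      rw [this]; exact Subgroup.mem_zpowers _
  have hpwS : ∀ b, pw z b ∈ Subgroup.centralizer ({r} : Set K) := by
    intro b
    exact Subgroup.mem_centralizer_singleton_iff.2 (f.zpwK b r)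
  have hEx : IsExtraspecial 2 E := by
    apply extraspecial_crit hEp (⟨q zS, hzE⟩ : E)
    · intro h; exact hqz (congrArg Subtype.val h)
    · rw [pow_two]; exact Subtype.ext hzz
    · rintro ⟨_, a, ha, rfl⟩ ⟨_, b, hb, rfl⟩
      have h1 := (f.InN_F ha).2 b.1 hb
      apply hpwz (B4 (φ a.1) (φ b.1)) (hpwS _)
      show ⁅q a, q b⁆ = _
      rw [← map_commutatorElement]
      congr 1
      apply Subtype.ext
      show a.1 * b.1 * a.1⁻¹ * b.1⁻¹ = _
      rw [h1, mul_assoc, f.zpwK]; group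
    · rintro ⟨_, a, ha, rfl⟩
      apply hpwz (α a.1 * β a.1 + q4 (φ a.1)) (hpwS _)
      show (q a) ^ 2 = _
      rw [← map_pow]
      congr 1
      apply Subtype.ext
      show a.1 ^ 2 = _
      rw [pow_two]
      exact f.sq _ ha.1
    · rintro ⟨_, a, ha, rfl⟩
      apply Subtype.ext
      show q a * q zS = q zS * q a
      rw [← map_mul, ← map_mul]
      congr 1
      exact Subtype.ext (f.zK a.1).symm
    · rintro ⟨_, a, ha, rfl⟩ hx
      have hφ : φ a.1 ≠ 0 := by
        intro h
        obtain ⟨b, hb⟩ := f.Z4_eq ha h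
        apply hx
        apply hpwz b (hpwS b)
        show q a = _
        rcases zmod2_cases (α a.1) with h | h <;> rw [h] at hb
        · congr 1
          apply Subtype.ext
          rw [hb]; simp [pw]
        · have : a = rS * ⟨pw z b, hpwS b⟩ := by
            apply Subtype.ext
            rw [hb]
            simp [pw, rS]
          rw [this, map_mul, hqr, one_mul]
      have : ∃ w, B4 (φ a.1) w ≠ 0 := by
        by_contra hc
        push Not at hc
        exact hφ (B4_nondeg _ hc)
      obtain ⟨w, hw⟩ := this
      obtain ⟨hb, hbw⟩ := f.lft_spec w
      set bS : Subgroup.centralizer ({r} : Set K) :=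
        ⟨lft R β φ w, Subgroup.mem_centralizer_singleton_iff.2 (f.MF_comm hb)⟩ with hbS
      refine ⟨⟨q bS, bS, hb, rfl⟩, ?_⟩
      intro h
      have h1 : q a * q bS = q bS * q a := congrArg Subtype.val h
      have h2 : a * bS = bS * a * zS := by
        apply Subtype.ext
        have h4 := f.comm _ ha.1 _ hb.1
        rw [ha.2, hb.2, hbw, mul_zero, zero_mul, zero_add, zero_add, if_neg hw] at h4
        exact h4
      rw [← map_mul, h2, map_mul, map_mul, mul_eq_left] at h1
      exact hqz h1
    · by_contra hc
      push Not at hc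
      have h1 : Subgroup.zpowers (⟨q zS, hzE⟩ : E) = ⊤ := by
        rw [eq_top_iff]; intro x _; exact hc x
      have h2 : Nat.card (Subgroup.zpowers (⟨q zS, hzE⟩ : E)) = 32 := by
        rw [h1, Subgroup.card_top, hEc]; norm_num
      rw [Nat.card_zpowers] at h2
      have h4 : orderOf (⟨q zS, hzE⟩ : E) ∣ 2 := by
        apply orderOf_dvd_of_pow_eq_one
        rw [pow_two]; exact Subtype.ext hzz
      rw [h2] at h4
      norm_num at h4
  -- map to A5
  have hle : q.ker ≤ π.ker := by
    intro g hg
    rw [hqk] at hg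
    rw [MonoidHom.mem_ker, hπk]
    exact f.DD_InN h3 hV ρ hz hg
  let π' : Y →* alternatingGroup (Fin 5) := q.liftOfSurjective hq ⟨π, hle⟩
  have hπ' : ∀ g, π' (q g) = π g := fun g => MonoidHom.liftOfRightInverse_comp_apply _ _ _ ⟨π, hle⟩ g
  have hπs : Function.Surjective π' := by
    intro x
    obtain ⟨g, rfl⟩ := hπ x
    exact ⟨q g, hπ' g⟩
  have hπker : π'.ker = E := by
    ext y
    obtain ⟨g, rfl⟩ := hq y
    rw [MonoidHom.mem_ker, hπ', hπk]
    constructor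
    · intro h
      obtain ⟨k, d, hk, hd, rfl⟩ := f.N_eq h3 hV ρ hz h
      exact ⟨k, hk, by rw [map_mul, (hq1 d).2 hd, mul_one]⟩
    · rintro ⟨k, hk, hkg⟩
      rw [← hπk, ← hπ', ← hkg, hπ', hπk]
      exact (f.InN_F hk).1
  have hOp : ∀ p : ℕ, Fact p.Prime → (∀ k : ℕ, p ^ k ≠ 60) → Op p Y ≤ E := by
    intro p hp hk x hx
    rw [← hπker, MonoidHom.mem_ker]
    have := Op_map_le p π' hπs ⟨x, hx, rfl⟩
    rwa [Op_simple_bot p hk, Subgroup.mem_bot] at this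
  have h60 : ∀ k : ℕ, 2 ^ k ≠ 60 := by
    intro k hk
    have : k < 6 := by
      by_contra hc
      have := Nat.pow_le_pow_right (by norm_num : 0 < 2) (by omega : 6 ≤ k)
      omega
    interval_cases k <;> omega
  have h60' : ∀ k : ℕ, 3 ^ k ≠ 60 := by
    intro k hk
    have : k < 4 := by
      by_contra hc
      have := Nat.pow_le_pow_right (by norm_num : 0 < 3) (by omega : 4 ≤ k)
      omega
    interval_cases k <;> omega
  have hOp2 : Op 2 Y = E := le_antisymm (hOp 2 inferInstance h60) (le_Op hEn hEp)
  have hOp3 : Op 3 Y = ⊥ := by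
    have h1 := hOp 3 inferInstance h60'
    have h2 : Disjoint (Op 3 Y) E := IsPGroup.disjoint_of_ne 3 2 (by norm_num) _ _ (isPGroup_Op 3 Y) hEp
    exact h2.eq_bot_of_le h1
  refine ⟨?_, ?_, hOp3, ?_⟩
  · rw [hOp2]; exact hEx
  · rw [hOp2, hEc]
  · exact ⟨(QuotientGroup.quotientMulEquivOfEq (hOp2.trans hπker.symm)).trans
      (QuotientGroup.quotientKerEquivOfSurjective π' hπs)⟩

end Fr

end

section


set_option linter.all false
open scoped commutatorElement

section
variable {C : Type*} [Group C] [Finite C] {S : Type*} [Group S]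

theorem abs1 (P : Subgroup C) [hPn : P.Normal] (hP : IsPGroup 3 P) (σ : C →* S) (hσ : Function.Surjective σ)
    (hker : σ.ker = P) (D0 : Subgroup S) [hDn : D0.Normal] (hD0 : IsPGroup 2 D0)
    (hcent : ∀ t k, σ t ∈ D0 → t ^ (2 ^ k) = 1 → ∀ x ∈ P, t * x = x * t)
    (hcD : ∀ c, (∀ x ∈ P, c * x = x * c) → σ c ∈ D0) :
    (∀ d, σ d ∈ D0 → ∃ t ∈ Op 2 C, ∃ p ∈ P, d = t * p) ∧ (∀ c ∈ Op 2 C, σ c ∈ D0) ∧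
      Disjoint P (Op 2 C) := by
  haveI : Fact (Nat.Prime 3) := ⟨Nat.prime_three⟩
  have hdisj : Disjoint P (Op 2 C) := IsPGroup.disjoint_of_ne 3 2 (by norm_num) _ _ hP (isPGroup_Op 2 C)
  have hO : ∀ c ∈ Op 2 C, σ c ∈ D0 := by
    intro c hc
    apply hcD
    intro x hx
    have h1 : c * x * c⁻¹ * x⁻¹ ∈ P := P.mul_mem (hPn.conj_mem x hx c) (P.inv_mem hx)
    have h2 : c * x * c⁻¹ * x⁻¹ ∈ Op 2 C := by
      have e : c * x * c⁻¹ * x⁻¹ = c * (x * c⁻¹ * x⁻¹) := by group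
      rw [e]
      exact (Op 2 C).mul_mem hc ((Op.normal 2 C).conj_mem _ ((Op 2 C).inv_mem hc) x)
    have h3 := Subgroup.disjoint_def.1 hdisj h1 h2
    rwa [mul_inv_eq_one, mul_inv_eq_iff_eq_mul] at h3
  refine ⟨?_, hO, hdisj⟩
  set D := D0.comap σ with hD
  haveI : D.Normal := hDn.comap σ
  let σ' : D →* D0 := (σ.comp D.subtype).codRestrict D0 (fun d => d.2)
  have hσ' : Function.Surjective σ' := by
    rintro ⟨s, hs⟩
    obtain ⟨c, rfl⟩ := hσ s
    exact ⟨⟨c, hs⟩, rfl⟩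
  obtain ⟨T⟩ : Nonempty (Sylow 2 D) := inferInstance
  have hTtop : (T : Subgroup D).map σ' = ⊤ := by
    rw [← Sylow.coe_mapSurjective hσ']
    have h1 : IsPGroup 2 (⊤ : Subgroup D0) := hD0.to_subgroup ⊤
    exact ((T.mapSurjective hσ').3 h1 le_top).symm
  have hTP : ∀ d : D, ∃ t ∈ (T : Subgroup D), ∃ p ∈ P, d.1 = t.1 * p := by
    intro d
    have : σ' d ∈ (T : Subgroup D).map σ' := by rw [hTtop]; trivial
    obtain ⟨t, ht, htd⟩ := this
    refine ⟨t, ht, t.1⁻¹ * d.1, ?_, by group⟩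
    rw [← hker, MonoidHom.mem_ker, map_mul, map_inv, inv_mul_eq_one]
    exact congrArg Subtype.val htd
  have hTc : ∀ t ∈ (T : Subgroup D), ∀ x ∈ P, t.1 * x = x * t.1 := by
    intro t ht x hx
    obtain ⟨k, hk⟩ := T.2 ⟨t, ht⟩
    exact hcent t.1 k t.2 (congrArg (fun y => y.1.1) hk) x hx
  have hTn : (T : Subgroup D).Normal := by
    constructor
    intro n hn g
    obtain ⟨t, ht, p, hp, hg⟩ := hTP g
    have e : g * n * g⁻¹ = t * n * t⁻¹ := by
      apply Subtype.ext
      show g.1 * n.1 * g.1⁻¹ = t.1 * n.1 * t.1⁻¹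
      rw [hg]
      calc t.1 * p * n.1 * (t.1 * p)⁻¹ = t.1 * (p * n.1) * p⁻¹ * t.1⁻¹ := by group
        _ = _ := by rw [← hTc n hn p hp]; group
    rw [e]
    exact T.mul_mem (T.mul_mem ht hn) (T.inv_mem ht)
  have hTch : (T : Subgroup D).Characteristic := T.characteristic_of_normal hTn
  have hTC : ((T : Subgroup D).map D.subtype).Normal := inferInstance
  have hle := le_Op hTC (T.2.map D.subtype)
  intro d hd
  obtain ⟨t, ht, p, hp, h⟩ := hTP ⟨d, hd⟩
  exact ⟨t.1, hle ⟨t, ht, rfl⟩, p, hp, h⟩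

theorem abs2 (P : Subgroup C) [hPn : P.Normal] (hP : IsPGroup 3 P) (σ : C →* S) (hσ : Function.Surjective σ)
    (hker : σ.ker = P) (D0 : Subgroup S) [hDn : D0.Normal] (h3 : Op 3 (S ⧸ D0) = ⊥)
    (h1 : ∀ d, σ d ∈ D0 → ∃ t ∈ Op 2 C, ∃ p ∈ P, d = t * p) (h2 : ∀ c ∈ Op 2 C, σ c ∈ D0) :
    Op 3 (C ⧸ Op 2 C) = P.map (QuotientGroup.mk' (Op 2 C)) ∧
    ∃ q : S →* (C ⧸ Op 2 C) ⧸ Op 3 (C ⧸ Op 2 C), Function.Surjective q ∧ q.ker = D0 := by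
  have hOp : Op 3 (C ⧸ Op 2 C) = P.map (QuotientGroup.mk' (Op 2 C)) := by
    apply le_antisymm
    · let g : C ⧸ Op 2 C →* S ⧸ D0 := QuotientGroup.map (Op 2 C) D0 σ h2
      have hg : Function.Surjective g := by
        intro y
        obtain ⟨s, rfl⟩ := QuotientGroup.mk_surjective y
        obtain ⟨c, rfl⟩ := hσ s
        exact ⟨(c : C ⧸ Op 2 C), rfl⟩
      intro y hy
      obtain ⟨c, rfl⟩ := QuotientGroup.mk_surjective y
      have h4 := Op_map_le 3 g hg ⟨_, hy, rfl⟩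
      rw [h3, Subgroup.mem_bot] at h4
      have h5 : ((σ c : S) : S ⧸ D0) = 1 := h4
      rw [QuotientGroup.eq_one_iff] at h5
      obtain ⟨t, ht, p, hp, rfl⟩ := h1 c h5
      refine ⟨p, hp, ?_⟩
      have h6 : ((t : C) : C ⧸ Op 2 C) = 1 := (QuotientGroup.eq_one_iff t).2 ht
      show ((p : C) : C ⧸ Op 2 C) = ((t * p : C) : C ⧸ Op 2 C)
      rw [QuotientGroup.mk_mul, h6, one_mul]
    · exact le_Op (hPn.map _ (QuotientGroup.mk'_surjective _)) (hP.map _)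
  refine ⟨hOp, ?_⟩
  let m : C →* (C ⧸ Op 2 C) ⧸ Op 3 (C ⧸ Op 2 C) :=
    (QuotientGroup.mk' (Op 3 (C ⧸ Op 2 C))).comp (QuotientGroup.mk' (Op 2 C))
  have hm : ∀ c, m c = 1 ↔ σ c ∈ D0 := by
    intro c
    show ((c : C ⧸ Op 2 C) : (C ⧸ Op 2 C) ⧸ Op 3 (C ⧸ Op 2 C)) = 1 ↔ _
    rw [QuotientGroup.eq_one_iff, hOp]
    constructor
    · rintro ⟨p, hp, h⟩
      have h' : ((p : C) : C ⧸ Op 2 C) = c := h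
      rw [QuotientGroup.eq] at h'
      have h5 := h2 _ h'
      rw [← hker, SetLike.mem_coe, MonoidHom.mem_ker] at hp
      rwa [map_mul, map_inv, hp, inv_one, one_mul] at h5
    · intro h
      obtain ⟨t, ht, p, hp, rfl⟩ := h1 c h
      refine ⟨p, hp, ?_⟩
      have h6 : ((t : C) : C ⧸ Op 2 C) = 1 := (QuotientGroup.eq_one_iff t).2 ht
      show ((p : C) : C ⧸ Op 2 C) = ((t * p : C) : C ⧸ Op 2 C)
      rw [QuotientGroup.mk_mul, h6, one_mul]
  have hle : σ.ker ≤ m.ker := by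
    intro c hc
    rw [MonoidHom.mem_ker] at hc ⊢
    rw [hm, hc]; exact one_mem _
  let q := σ.liftOfSurjective hσ ⟨m, hle⟩
  have hq : ∀ c, q (σ c) = m c := fun g => MonoidHom.liftOfRightInverse_comp_apply _ _ _ ⟨m, hle⟩ g
  refine ⟨q, ?_, ?_⟩
  · intro y
    obtain ⟨x, rfl⟩ := QuotientGroup.mk_surjective y
    obtain ⟨c, rfl⟩ := QuotientGroup.mk_surjective x
    exact ⟨σ c, hq c⟩
  · ext s
    obtain ⟨c, rfl⟩ := hσ s
    rw [MonoidHom.mem_ker, hq, hm]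

end

end

section


set_option linter.all false
open scoped commutatorElement

namespace SimilarToF2Centralizer
variable {H : Type*} [Group H] [Finite H] {Q : Subgroup H} [hQn : Q.Normal]

theorem centQ (hH : SimilarToF2Centralizer H Q) {x : H} (h : ∀ y ∈ Q, x * y = y * x) :
    x ∈ Subgroup.center H := by
  rw [← hH.centralizer_eq, Subgroup.mem_centralizer_iff]
  intro y hy
  exact (h y hy).symm

theorem cZ (hH : SimilarToF2Centralizer H Q) (x : Q) : x ∈ Subgroup.center Q ↔ x.1 ∈ Subgroup.center H := by
  constructor
  · intro h
    apply hH.centQ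
    intro y hy
    exact congrArg Subtype.val (Subgroup.mem_center_iff.1 h ⟨y, hy⟩).symm
  · intro h
    rw [Subgroup.mem_center_iff]
    intro g
    exact Subtype.ext (Subgroup.mem_center_iff.1 h g.1)

theorem of_eq_one (hH : SimilarToF2Centralizer H Q) (x : Q) :
    Abelianization.of x = 1 ↔ x.1 ∈ Subgroup.center H := by
  rw [← hH.cZ, hH.extraspecial.2.1]
  exact QuotientGroup.eq_one_iff x

theorem comm_mem (hH : SimilarToF2Centralizer H Q) {x y : H} (hx : x ∈ Q) (hy : y ∈ Q) :
    x * y * x⁻¹ * y⁻¹ ∈ Subgroup.center H := by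
  have h := hH.of_eq_one (⟨x, hx⟩ * ⟨y, hy⟩ * ⟨x, hx⟩⁻¹ * ⟨y, hy⟩⁻¹)
  apply h.1
  simp only [map_mul, map_inv]
  rw [mul_comm (Abelianization.of _) (Abelianization.of _), mul_inv_cancel_right, mul_inv_cancel]

theorem card_center (hH : SimilarToF2Centralizer H Q) : Nat.card (Subgroup.center H) = 3 := by
  rw [← hH.extraspecial.2.2.2]
  apply Nat.card_congr
  exact
  { toFun := fun x => ⟨⟨x.1, hH.center_le x.2⟩, (hH.cZ _).2 x.2⟩
    invFun := fun x => ⟨x.1.1, (hH.cZ _).1 x.2⟩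
    left_inv := fun _ => rfl
    right_inv := fun _ => rfl }

theorem cop (hH : SimilarToF2Centralizer H Q) {t x : H} {k : ℕ} (ht : t ^ (2 ^ k) = 1)
    (h : x⁻¹ * (t * x * t⁻¹) ∈ Subgroup.center H) : t * x = x * t := by
  set ζ := x⁻¹ * (t * x * t⁻¹) with hζ
  have h1 : t * x * t⁻¹ = x * ζ := by rw [hζ]; group
  have hc : ∀ g, g * ζ = ζ * g := Subgroup.mem_center_iff.1 h
  have h2 : ∀ n : ℕ, t ^ n * x * (t ^ n)⁻¹ = x * ζ ^ n := by
    intro n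
    induction n with
    | zero => simp
    | succ n ih =>
      have hcn : Commute (t) (ζ ^ n) := Commute.pow_right (hc t) n
      calc t ^ (n + 1) * x * (t ^ (n + 1))⁻¹ = t * (t ^ n * x * (t ^ n)⁻¹) * t⁻¹ := by
            rw [pow_succ']; group
        _ = t * x * (ζ ^ n * t⁻¹) := by rw [ih]; group
        _ = t * x * t⁻¹ * ζ ^ n := by rw [← hcn.inv_left.eq]; group
        _ = x * ζ ^ (n + 1) := by rw [h1, pow_succ']; group
  have h3 := h2 (2 ^ k)
  rw [ht] at h3
  have h4 : ζ ^ (2 ^ k) = 1 := by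
    have : x * ζ ^ (2 ^ k) = x := by rw [← h3]; group
    exact mul_eq_left.1 this
  have h5 : ζ ^ 3 = 1 := hH.exponent3 _ (hH.center_le h)
  have h6 : ζ = 1 := by
    rw [← orderOf_eq_one_iff]
    have a1 := orderOf_dvd_of_pow_eq_one h4
    have a2 := orderOf_dvd_of_pow_eq_one h5
    have : Nat.Coprime (2 ^ k) 3 := Nat.Coprime.pow_left _ (by norm_num)
    exact Nat.eq_one_of_dvd_coprimes this a1 a2
  rw [h6, mul_one, mul_inv_eq_iff_eq_mul] at h1
  exact h1

theorem card_V (hH : SimilarToF2Centralizer H Q) : Nat.card (Additive (Abelianization Q)) = 3 ^ 8 := by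
  have h1 := (commutator Q).card_mul_index
  rw [← hH.extraspecial.2.1, hH.extraspecial.2.2.2, hH.card_eq, hH.extraspecial.2.1] at h1
  have h2 : Nat.card (Additive (Abelianization Q)) = (commutator Q).index := rfl
  rw [h2]
  omega

theorem three_V (hH : SimilarToF2Centralizer H Q) (v : Additive (Abelianization Q)) : v + v + v = 0 := by
  obtain ⟨x, rfl⟩ := QuotientGroup.mk_surjective (Additive.toMul v)
  show (Abelianization.of x) * Abelianization.of x * Abelianization.of x = 1
  rw [← map_mul, ← map_mul]
  have : x * x * x = 1 := by
    apply Subtype.ext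
    have := hH.exponent3 _ x.2
    rw [pow_succ, pow_two] at this
    exact this
  rw [this, map_one]

theorem V_ind {p : Additive (Abelianization Q) → Prop}
    (h : ∀ x : Q, p (Additive.ofMul (Abelianization.of x))) (v) : p v := by
  obtain ⟨x, hx⟩ := QuotientGroup.mk_surjective (Additive.toMul v)
  have := h x
  rwa [show Additive.ofMul (Abelianization.of x) = v from hx] at this

/-- conjugation action of `H` on `Q/[Q,Q]` -/
noncomputable def rhoH (Q : Subgroup H) [Q.Normal] : H →* AddMonoid.End (Additive (Abelianization Q)) where
  toFun h := MonoidHom.toAdditive (Abelianization.map (MulAut.conjNormal h : MulAut Q).toMonoidHom)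
  map_one' := by
    apply DFunLike.ext
    apply V_ind
    intro x
    show Additive.ofMul (Abelianization.of ((MulAut.conjNormal (1 : H) : MulAut Q) x)) = _
    rw [map_one]; rfl
  map_mul' := by
    intro g k
    apply DFunLike.ext
    apply V_ind
    intro x
    show Additive.ofMul (Abelianization.of ((MulAut.conjNormal (g * k) : MulAut Q) x)) = _
    rw [map_mul]; rfl

/-- conjugation action of `H/Q` on `Q/[Q,Q]` -/
noncomputable def rho (Q : Subgroup H) [Q.Normal] : H ⧸ Q →* AddMonoid.End (Additive (Abelianization Q)) :=
  QuotientGroup.lift Q (rhoH Q) (by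
    intro g hg
    apply DFunLike.ext
    apply V_ind
    intro x
    show Abelianization.of ((MulAut.conjNormal (g : H) : MulAut Q) x) = Abelianization.of x
    have : (MulAut.conjNormal (g : H) : MulAut Q) x = ⟨g, hg⟩ * x * ⟨g, hg⟩⁻¹ := by
      apply Subtype.ext
      simp
    rw [this, map_mul, map_mul, map_inv, mul_comm (Abelianization.of _), mul_inv_cancel_right])

theorem rho_iff (hH : SimilarToF2Centralizer H Q) (h : H) (x : Q) :
    rho Q (h : H ⧸ Q) (Additive.ofMul (Abelianization.of x)) = Additive.ofMul (Abelianization.of x) ↔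
      x.1⁻¹ * (h * x.1 * h⁻¹) ∈ Subgroup.center H := by
  have e : rho Q (h : H ⧸ Q) (Additive.ofMul (Abelianization.of x)) =
    Additive.ofMul (Abelianization.of ((MulAut.conjNormal (h : H) : MulAut Q) x)) := rfl
  rw [e]
  have e2 : (x⁻¹ * ((MulAut.conjNormal (h : H) : MulAut Q) x)).1 = x.1⁻¹ * (h * x.1 * h⁻¹) := by simp
  rw [← e2, ← hH.of_eq_one, map_mul, map_inv, inv_mul_eq_one]
  constructor
  · intro h; exact h.symm
  · intro h; exact congrArg Additive.ofMul h.symm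

theorem rho_z (hH : SimilarToF2Centralizer H Q) {z : H ⧸ Q} (hz1 : z ≠ 1) (hzz : z * z = 1) :
    ∃ v, rho Q z v ≠ v := by
  by_contra hc
  push Not at hc
  obtain ⟨h, rfl⟩ := QuotientGroup.mk_surjective z
  have h2 : h * h ∈ Q := (QuotientGroup.eq_one_iff _).1 hzz
  have h6 : (h ^ 3) ^ (2 ^ 1) = 1 := by
    rw [← hH.exponent3 _ h2, ← pow_two, ← pow_mul, ← pow_mul, pow_one]
  have h3 : ((h ^ 3 : H) : H ⧸ Q) = (h : H ⧸ Q) := by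
    rw [QuotientGroup.mk_pow, pow_succ, pow_two, hzz, one_mul]
  have h4 : h ^ 3 ∈ Subgroup.center H := by
    apply hH.centQ
    intro y hy
    apply hH.cop h6
    have := (hH.rho_iff (h ^ 3) ⟨y, hy⟩)
    rw [h3] at this
    exact this.1 (hc _)
  apply hz1
  rw [← h3]
  exact (QuotientGroup.eq_one_iff _).2 (hH.center_le h4)

theorem fix_iff (hH : SimilarToF2Centralizer H Q) {r : H} (hr : r * r = 1) (x : Q) :
    Additive.ofMul (Abelianization.of x) ∈ fixV (rho Q) (r : H ⧸ Q) ↔ r * x.1 = x.1 * r := by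
  rw [mem_fixV, hH.rho_iff]
  constructor
  · intro h
    exact hH.cop (k := 1) (by rw [pow_one, pow_two, hr]) h
  · intro h
    rw [h, mul_inv_cancel_right, inv_mul_cancel]
    exact one_mem _

/-- `C_Q(r)` as a subgroup of `C_H(r)` -/
def PP (Q : Subgroup H) (r : H) : Subgroup (Subgroup.centralizer ({r} : Set H)) :=
  Q.subgroupOf (Subgroup.centralizer ({r} : Set H))

instance (r : H) : (PP Q r).Normal := by unfold PP; infer_instance

theorem card_PP (hH : SimilarToF2Centralizer H Q) {r : H} (hr : r * r = 1)
    (hfix : Nat.card (fixV (rho Q) (r : H ⧸ Q)) = 81) : Nat.card (PP Q r) = 3 ^ 5 := by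
  have hS : ∀ x : PP Q r, r * x.1.1 = x.1.1 * r := fun x => (Fr.memS x.1.2).symm
  let F : PP Q r →* Multiplicative (fixV (rho Q) (r : H ⧸ Q)) :=
    { toFun := fun x => Multiplicative.ofAdd ⟨Additive.ofMul (Abelianization.of ⟨x.1.1, x.2⟩),
        (hH.fix_iff hr ⟨x.1.1, x.2⟩).2 (hS x)⟩
      map_one' := rfl
      map_mul' := fun _ _ => rfl }
  have hF : Function.Surjective F := by
    intro y
    obtain ⟨⟨v, hv⟩, rfl⟩ := Multiplicative.ofAdd.surjective y
    revert hv
    apply V_ind (p := fun v => ∀ hv : v ∈ fixV (rho Q) (r : H ⧸ Q), ∃ a, F a = Multiplicative.ofAdd ⟨v, hv⟩)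
    intro x hx
    exact ⟨⟨⟨x.1, Subgroup.mem_centralizer_singleton_iff.2 ((hH.fix_iff hr x).1 hx).symm⟩, x.2⟩, rfl⟩
  have h1 := F.ker.card_mul_index
  rw [Subgroup.index_ker, MonoidHom.range_eq_top.2 hF, Subgroup.card_top,
    Nat.card_congr Multiplicative.toAdd, hfix] at h1
  have h2 : Nat.card F.ker = 3 := by
    rw [← hH.card_center]
    apply Nat.card_congr
    have hk : ∀ x : PP Q r, x ∈ F.ker ↔ x.1.1 ∈ Subgroup.center H := by
      intro x
      rw [MonoidHom.mem_ker, ← hH.of_eq_one ⟨x.1.1, x.2⟩]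
      constructor
      · intro h
        exact congrArg Subtype.val h
      · intro h
        exact Subtype.ext h
    exact
    { toFun := fun x => ⟨x.1.1.1, (hk _).1 x.2⟩
      invFun := fun x => ⟨⟨⟨x.1, Subgroup.mem_centralizer_singleton_iff.2 (Subgroup.mem_center_iff.1 x.2 r).symm⟩, hH.center_le x.2⟩, (hk _).2 x.2⟩
      left_inv := fun _ => rfl
      right_inv := fun _ => rfl }
  rw [h2] at h1
  omega

/-- nondegeneracy on `C_Q(r)` -/
theorem PP_nd (hH : SimilarToF2Centralizer H Q) {r x : H} (hr : r * r = 1) (hx : x ∈ Q)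
    (hxr : r * x = x * r) (h : ∀ y ∈ Q, r * y = y * r → x * y = y * x) : x ∈ Subgroup.center H := by
  have hri : r⁻¹ = r := inv_eq_of_mul_eq_one_right hr
  have hrQ : ∀ y ∈ Q, r * y * r ∈ Q := by
    intro y hy
    have := hQn.conj_mem y hy r
    rwa [hri] at this
  have hxr' : r * x * r = x := by rw [hxr, mul_assoc, hr, mul_one]
  -- inverted elements
  have hinv : ∀ w ∈ Q, (w * (r * w * r)) ∈ Subgroup.center H → x * w = w * x := by
    intro w hw hc
    set ζ := x * w * x⁻¹ * w⁻¹ with hζ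
    have hζc := hH.comm_mem hx hw
    rw [← hζ] at hζc
    have hcom : ∀ g, g * ζ = ζ * g := Subgroup.mem_center_iff.1 hζc
    set c := w * (r * w * r) with hcd
    have hcc : ∀ g, g * c = c * g := Subgroup.mem_center_iff.1 hc
    have e1 : x * w = ζ * w * x := by rw [hζ]; group
    have e2 : x * (r * w * r) = ζ * (r * w * r) * x := by
      calc x * (r * w * r) = (r * x * r) * (r * w * r) := by rw [hxr']
        _ = r * x * (r * r) * w * r := by group
        _ = r * (x * w) * r := by rw [hr]; group
        _ = r * ζ * w * x * r := by rw [e1]; group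
        _ = ζ * r * w * 1 * x * r := by rw [hcom r]; group
        _ = ζ * (r * w * r) * (r * x * r) := by rw [← hr]; group
        _ = _ := by rw [hxr']
    have e3 : x * c = ζ * ζ * c * x := by
      calc x * c = (x * w) * (r * w * r) := by rw [hcd]; group
        _ = ζ * w * (x * (r * w * r)) := by rw [e1]; group
        _ = ζ * (w * ζ) * (r * w * r) * x := by rw [e2]; group
        _ = _ := by rw [hcom w, hcd]; group
    have e4 : ζ * ζ = 1 := by
      rw [hcc x] at e3
      have : c * x = (ζ * ζ) * (c * x) := by rw [← mul_assoc]; exact e3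
      exact (right_eq_mul.1 this)
    have e5 : ζ ^ 3 = 1 := hH.exponent3 _ (hH.center_le hζc)
    have e6 : ζ = 1 := by
      rw [pow_succ, pow_two, e4, one_mul] at e5
      exact e5
    rw [e6, one_mul] at e1
    exact e1
  apply hH.centQ
  intro y hy
  -- y = y^4 = (y^2)^2, y^2 = (y * y^r) * (y^r⁻¹ * y)
  have hfx : x * (y * (r * y * r)) = (y * (r * y * r)) * x := by
    have hm : y * (r * y * r) ∈ Q := Q.mul_mem hy (hrQ y hy)
    apply h _ hm
    apply hH.cop (k := 1) (by rw [pow_one, pow_two, hr])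
    have e : r * (y * (r * y * r)) * r⁻¹ = (r * y * r) * y := by
      rw [hri]
      calc r * (y * (r * y * r)) * r = r * y * r * y * (r * r) := by group
        _ = _ := by rw [hr, mul_one]
    rw [e]
    have := hH.comm_mem (Q.inv_mem (hrQ y hy)) (Q.inv_mem hy)
    convert this using 1
    group
  have hiv : x * ((r * y * r)⁻¹ * y) = ((r * y * r)⁻¹ * y) * x := by
    apply hinv _ (Q.mul_mem (Q.inv_mem (hrQ y hy)) hy)
    have e' : r * ((r * y * r)⁻¹ * y) * r = y⁻¹ * (r * y * r) := by
      rw [mul_inv_rev, mul_inv_rev, hri]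
      calc r * (r * (y⁻¹ * r) * y) * r = (r * r) * y⁻¹ * r * y * r := by group
        _ = _ := by rw [hr]; group
    rw [e']
    have e : (r * y * r)⁻¹ * y * (y⁻¹ * (r * y * r)) = 1 := by
      rw [mul_assoc, mul_inv_cancel_left, inv_mul_cancel]
    rw [e]
    exact one_mem _
  have c1 : Commute x (y * (r * y * r)) := hfx
  have c2 : Commute x ((r * y * r)⁻¹ * y) := hiv
  have c3 := c1.mul_right c2
  have e5 : (y * (r * y * r)) * ((r * y * r)⁻¹ * y) = y * y := by
    rw [mul_assoc, mul_inv_cancel_left]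
  rw [e5] at c3
  have c4 := c3.mul_right c3
  have e6 : y * y * (y * y) = y := by
    have h3 := hH.exponent3 y hy
    calc y * y * (y * y) = y ^ 3 * y := by rw [pow_succ, pow_two]; simp only [mul_assoc]
      _ = y := by rw [h3, one_mul]
  rw [e6] at c4
  exact c4

end SimilarToF2Centralizer

end

section


set_option linter.all false
open scoped commutatorElement

namespace SimilarToF2Centralizer
variable {H : Type*} [Group H] [Finite H] {Q : Subgroup H} [hQn : Q.Normal]

/-- the natural map `C_H(r) → C_{H/Q}(r)` -/
def sg (Q : Subgroup H) [Q.Normal] (r : H) : Subgroup.centralizer ({r} : Set H) →*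
    Subgroup.centralizer ({(r : H ⧸ Q)} : Set (H ⧸ Q)) :=
  ((QuotientGroup.mk' Q).comp (Subgroup.subtype _)).codRestrict _ (by
    intro c
    rw [Subgroup.mem_centralizer_singleton_iff]
    exact congrArg (QuotientGroup.mk' Q) (Subgroup.mem_centralizer_singleton_iff.1 c.2))

theorem sg_val (r : H) (c : Subgroup.centralizer ({r} : Set H)) :
    (sg Q r c).1 = ((c.1 : H) : H ⧸ Q) := rfl

theorem sg_ker (r : H) : (sg Q r).ker = PP Q r := by
  ext c
  rw [MonoidHom.mem_ker]
  constructor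
  · intro h
    exact (QuotientGroup.eq_one_iff (N := Q) (c.1 : H)).1 (congrArg Subtype.val h)
  · intro h
    exact Subtype.ext ((QuotientGroup.eq_one_iff (N := Q) (c.1 : H)).2 h)

theorem sg_surj (hH : SimilarToF2Centralizer H Q) {r : H} (hr : r * r = 1) :
    Function.Surjective (sg Q r) := by
  rintro ⟨y, hy⟩
  obtain ⟨h, rfl⟩ := QuotientGroup.mk_surjective y
  have hy' := Subgroup.mem_centralizer_singleton_iff.1 hy
  set s := h * r * h⁻¹ with hs
  have hss : s * s = 1 := by
    calc s * s = h * (r * r) * h⁻¹ := by rw [hs]; group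
      _ = 1 := by rw [hr]; group
  have hsq : ((s : H) : H ⧸ Q) = (r : H ⧸ Q) := by
    rw [hs, QuotientGroup.mk_mul, QuotientGroup.mk_mul, QuotientGroup.mk_inv, hy',
      mul_inv_cancel_right]
  have ht : r * s ∈ Q := by
    rw [← QuotientGroup.eq_one_iff, QuotientGroup.mk_mul, hsq, ← QuotientGroup.mk_mul, hr,
      QuotientGroup.mk_one]
  have h3 := hH.exponent3 _ ht
  have e : s * (r * s) = (r * s) * r := by
    have h4 : (r * s) * r * (s * (r * s)) = 1 := by
      rw [← h3, pow_succ, pow_two]; simp only [mul_assoc]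
    have h5 : (r * s * r) * (r * s * r) = 1 := by
      calc (r * s * r) * (r * s * r) = r * s * (r * r) * s * r := by group
        _ = r * (s * s) * r := by rw [hr]; group
        _ = 1 := by rw [hss, mul_one, hr]
    exact mul_left_cancel (h4.trans h5.symm)
  have e2 : h * r = s * h := by rw [hs]; group
  have hc : (r * s)⁻¹ * h ∈ Subgroup.centralizer ({r} : Set H) := by
    rw [Subgroup.mem_centralizer_singleton_iff]
    have e3 : (r * s)⁻¹ * s = r * (r * s)⁻¹ := by
      rw [inv_mul_eq_iff_eq_mul, ← mul_assoc, ← e, mul_inv_cancel_right]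
    rw [mul_assoc, e2, ← mul_assoc, e3, mul_assoc]
  refine ⟨⟨_, hc⟩, ?_⟩
  apply Subtype.ext
  rw [sg_val]
  show (((r * s)⁻¹ * h : H) : H ⧸ Q) = (h : H ⧸ Q)
  rw [QuotientGroup.mk_mul, QuotientGroup.mk_inv, (QuotientGroup.eq_one_iff _).2 ht, inv_one, one_mul]

theorem hcent (hH : SimilarToF2Centralizer H Q) {r : H} (hr : r * r = 1)
    (t : Subgroup.centralizer ({r} : Set H)) (k : ℕ) (h : sg Q r t ∈ Fr.DD (r : H ⧸ Q) (rho Q))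
    (ht : t ^ (2 ^ k) = 1) (x) (hx : x ∈ PP Q r) : t * x = x * t := by
  apply Subtype.ext
  show t.1 * x.1 = x.1 * t.1
  apply hH.cop (k := k) (by exact congrArg Subtype.val ht)
  have h1 := (hH.fix_iff hr ⟨x.1, hx⟩).2 (Fr.memS x.2).symm
  exact (hH.rho_iff t.1 ⟨x.1, hx⟩).1 (Fr.mem_DD.1 h _ h1)

theorem hcD (hH : SimilarToF2Centralizer H Q) {r : H} (hr : r * r = 1)
    (c : Subgroup.centralizer ({r} : Set H)) (h : ∀ x ∈ PP Q r, c * x = x * c) :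
    sg Q r c ∈ Fr.DD (r : H ⧸ Q) (rho Q) := by
  rw [Fr.mem_DD]
  apply V_ind
  intro x hx
  have hxr := (hH.fix_iff hr x).1 hx
  have h1 : c.1 * x.1 = x.1 * c.1 := congrArg Subtype.val
    (h ⟨x.1, Subgroup.mem_centralizer_singleton_iff.2 hxr.symm⟩ x.2)
  apply (hH.rho_iff c.1 x).2
  rw [h1, mul_inv_cancel_right, inv_mul_cancel]
  exact one_mem _

theorem map_PP (hH : SimilarToF2Centralizer H Q) {r : H} (hr : r * r = 1)
    (hfix : Nat.card (fixV (rho Q) (r : H ⧸ Q)) = 81)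
    (O : Subgroup (Subgroup.centralizer ({r} : Set H))) [O.Normal] (hd : Disjoint (PP Q r) O) :
    IsExtraspecial 3 ((PP Q r).map (QuotientGroup.mk' O)) ∧
      Nat.card ((PP Q r).map (QuotientGroup.mk' O)) = 3 ^ 5 := by
  haveI : Fact (Nat.Prime 3) := ⟨Nat.prime_three⟩
  have hinj : ∀ x ∈ PP Q r, ∀ y ∈ PP Q r, QuotientGroup.mk' O x = QuotientGroup.mk' O y → x = y := by
    intro x hx y hy h
    have h1 : x⁻¹ * y ∈ O := QuotientGroup.eq.1 h
    have h2 := Subgroup.disjoint_def.1 hd ((PP Q r).mul_mem ((PP Q r).inv_mem hx) hy) h1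
    exact (inv_mul_eq_one.1 h2)
  have hcard : Nat.card ((PP Q r).map (QuotientGroup.mk' O)) = 3 ^ 5 := by
    rw [← hH.card_PP hr hfix]
    refine (Nat.card_congr (Equiv.ofBijective
      (fun x : PP Q r => (⟨QuotientGroup.mk' O x.1, Subgroup.mem_map_of_mem _ x.2⟩ :
        (PP Q r).map (QuotientGroup.mk' O))) ⟨?_, ?_⟩)).symm
    · intro x y h
      exact Subtype.ext (hinj _ x.2 _ y.2 (congrArg Subtype.val h))
    · rintro ⟨_, x, hx, rfl⟩
      exact ⟨⟨x, hx⟩, rfl⟩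
  refine ⟨?_, hcard⟩
  have hcc := hH.card_center
  obtain ⟨ζ, hζ⟩ : ∃ ζ : Subgroup.center H, ζ ≠ 1 := by
    haveI : Nontrivial (Subgroup.center H) := Finite.one_lt_card_iff_nontrivial.1 (by rw [hcc]; norm_num)
    exact exists_ne 1
  have hgen : ∀ y ∈ Subgroup.center H, ∃ n : ℤ, ζ.1 ^ n = y := by
    intro y hy
    obtain ⟨n, hn⟩ := Subgroup.mem_zpowers_iff.1 (mem_zpowers_of_prime_card (g' := ⟨y, hy⟩) hcc hζ)
    exact ⟨n, congrArg Subtype.val hn⟩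
  have hcenC : ∀ y ∈ Subgroup.center H, y ∈ Subgroup.centralizer ({r} : Set H) := fun y hy =>
    Subgroup.mem_centralizer_singleton_iff.2 (Subgroup.mem_center_iff.1 hy r).symm
  set zC : Subgroup.centralizer ({r} : Set H) := ⟨ζ.1, hcenC _ ζ.2⟩ with hzC
  have hzP : zC ∈ PP Q r := hH.center_le ζ.2
  set F : PP Q r → (PP Q r).map (QuotientGroup.mk' O) := fun x =>
    ⟨QuotientGroup.mk' O x.1, Subgroup.mem_map_of_mem _ x.2⟩ with hF
  have Finj : Function.Injective F := by
    intro x y h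
    exact Subtype.ext (hinj _ x.2 _ y.2 (congrArg Subtype.val h))
  have Fsurj : Function.Surjective F := by
    rintro ⟨_, x, hx, rfl⟩
    exact ⟨⟨x, hx⟩, rfl⟩
  have Fmul : ∀ x y, F (x * y) = F x * F y := fun x y => rfl
  have Finv : ∀ x, F (x⁻¹) = (F x)⁻¹ := fun x => rfl
  have Fone : F 1 = 1 := rfl
  set zP : PP Q r := ⟨zC, hzP⟩ with hzPd
  have hz : ∀ x : PP Q r, x.1.1 ∈ Subgroup.center H → F x ∈ Subgroup.zpowers (F zP) := by
    intro x hx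
    obtain ⟨n, hn⟩ := hgen _ hx
    have : x = zP ^ n := by
      apply Subtype.ext; apply Subtype.ext
      rw [← hn]
      simp [zP, zC]
    rw [this, Subgroup.mem_zpowers_iff]
    refine ⟨n, ?_⟩
    apply Subtype.ext
    simp [F]
  have hp3 : IsPGroup 3 ((PP Q r).map (QuotientGroup.mk' O)) := IsPGroup.of_card hcard
  have hz3 : F zP ^ 3 = 1 := by
    have : zP ^ 3 = 1 := by
      apply Subtype.ext; apply Subtype.ext
      exact hH.exponent3 _ (hH.center_le ζ.2)
    rw [← Fone, ← this]; rfl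
  refine extraspecial_crit hp3 (F zP) ?_ hz3 ?_ ?_ ?_ ?_ ?_
  · intro h
    rw [← Fone] at h
    have := Finj h
    apply hζ
    apply Subtype.ext
    exact congrArg (fun x : PP Q r => x.1.1) this
  · intro a b
    obtain ⟨x, rfl⟩ := Fsurj a
    obtain ⟨y, rfl⟩ := Fsurj b
    rw [commutatorElement_def, ← Finv, ← Finv, ← Fmul, ← Fmul, ← Fmul]
    apply hz
    exact hH.comm_mem x.2 y.2
  · intro a
    obtain ⟨x, rfl⟩ := Fsurj a
    have : x ^ 3 = 1 := by
      apply Subtype.ext; apply Subtype.ext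
      exact hH.exponent3 _ x.2
    have h2 : F x ^ 3 = 1 := by rw [← Fone, ← this]; rfl
    rw [h2]
    exact one_mem _
  · intro a
    obtain ⟨x, rfl⟩ := Fsurj a
    rw [← Fmul, ← Fmul]
    congr 1
    apply Subtype.ext; apply Subtype.ext
    exact Subgroup.mem_center_iff.1 ζ.2 _
  · intro a ha
    obtain ⟨x, rfl⟩ := Fsurj a
    by_contra hc
    push Not at hc
    apply ha
    apply hz
    apply hH.PP_nd hr x.2 (Fr.memS x.1.2).symm
    intro y hy hry
    have h1 := hc (F ⟨⟨y, Subgroup.mem_centralizer_singleton_iff.2 hry.symm⟩, hy⟩)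
    rw [← Fmul, ← Fmul] at h1
    exact congrArg (fun x : PP Q r => x.1.1) (Finj h1)
  · by_contra hc
    push Not at hc
    have h1 : Subgroup.zpowers (F zP) = ⊤ := (Subgroup.eq_top_iff' _).2 hc
    have h2 := Nat.card_zpowers (F zP)
    rw [h1, Subgroup.card_top, hcard] at h2
    have h3 := Nat.le_of_dvd (by norm_num) (orderOf_dvd_of_pow_eq_one hz3)
    omega

end SimilarToF2Centralizer

theorem quot_comap_equiv {X A : Type*} [Group X] [Group A] (N : Subgroup X) [N.Normal]
    (M : Subgroup (X ⧸ N)) [M.Normal] (e : Nonempty ((X ⧸ N) ⧸ M ≃* A)) :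
    Nonempty (X ⧸ Subgroup.comap (QuotientGroup.mk' N) M ≃* A) := by
  obtain ⟨e⟩ := e
  let F : X →* (X ⧸ N) ⧸ M := (QuotientGroup.mk' M).comp (QuotientGroup.mk' N)
  have hF : Function.Surjective F :=
    (QuotientGroup.mk'_surjective M).comp (QuotientGroup.mk'_surjective N)
  have hk : Subgroup.comap (QuotientGroup.mk' N) M = F.ker := by
    ext x
    rw [MonoidHom.mem_ker]
    exact (QuotientGroup.eq_one_iff (N := M) (x : X ⧸ N)).symm
  exact ⟨(QuotientGroup.quotientMulEquivOfEq hk).trans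
    ((QuotientGroup.quotientKerEquivOfSurjective F hF).trans e)⟩

end

/-- **Lemma 4.7(ii).** Let `H` be similar to a 3-centralizer in a group of type `F₂` with
`Q = O₃(H)`, and let `r ∈ H` be an involution whose image in `H/Q` lies in
`O₂(H/Q) ∖ Z(O₂(H/Q))`.  Set `X = C_H(r)/O₂(C_H(r))`.  Then `O₃(X)` is extraspecial of
order 3⁵, `O₂(X/O₃(X))` is extraspecial of order 2⁵, and `X/O_{3,2}(X) ≅ Alt(5)`; that is,
`X` is similar to a 3-centralizer in `Co₂`. -/
theorem stmt_15 {H : Type*} [Group H] [Finite H] (Q : Subgroup H) [Q.Normal]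
    (hH : SimilarToF2Centralizer H Q) (r : H) (hr : orderOf r = 2)
    (hrO2 : (r : H ⧸ Q) ∈ Op 2 (H ⧸ Q))
    (hrnc : (r : H ⧸ Q) ∉ Subgroup.centralizer ((Op 2 (H ⧸ Q)) : Set (H ⧸ Q))) :
    IsExtraspecial 3
      (Op 3 (Subgroup.centralizer ({r} : Set H) ⧸
        Op 2 (Subgroup.centralizer ({r} : Set H)))) ∧
    Nat.card
      (Op 3 (Subgroup.centralizer ({r} : Set H) ⧸
        Op 2 (Subgroup.centralizer ({r} : Set H)))) = 3 ^ 5 ∧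
    IsExtraspecial 2
      (Op 2 ((Subgroup.centralizer ({r} : Set H) ⧸
          Op 2 (Subgroup.centralizer ({r} : Set H))) ⧸
        Op 3 (Subgroup.centralizer ({r} : Set H) ⧸
          Op 2 (Subgroup.centralizer ({r} : Set H))))) ∧
    Nat.card
      (Op 2 ((Subgroup.centralizer ({r} : Set H) ⧸
          Op 2 (Subgroup.centralizer ({r} : Set H))) ⧸
        Op 3 (Subgroup.centralizer ({r} : Set H) ⧸
          Op 2 (Subgroup.centralizer ({r} : Set H))))) = 2 ^ 5 ∧
    Nonempty
      (((Subgroup.centralizer ({r} : Set H) ⧸ Op 2 (Subgroup.centralizer ({r} : Set H))) ⧸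
          Subgroup.comap
            (QuotientGroup.mk' (Op 3 (Subgroup.centralizer ({r} : Set H) ⧸
              Op 2 (Subgroup.centralizer ({r} : Set H)))))
            (Op 2 ((Subgroup.centralizer ({r} : Set H) ⧸
                Op 2 (Subgroup.centralizer ({r} : Set H))) ⧸
              Op 3 (Subgroup.centralizer ({r} : Set H) ⧸
                Op 2 (Subgroup.centralizer ({r} : Set H)))))) ≃*
        alternatingGroup (Fin 5)) := by
  have hr2 : r * r = 1 := by
    rw [← pow_two, ← hr]; exact pow_orderOf_eq_one r
  have hrb : (r : H ⧸ Q) * (r : H ⧸ Q) = 1 := by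
    rw [← QuotientGroup.mk_mul, hr2, QuotientGroup.mk_one]
  obtain ⟨z, α, β, φ, f⟩ := exists_Fr (Op 2 (H ⧸ Q)) hH.O2_extraspecial hH.O2_card hH.O2_minusType
    hH.O2_selfCentralizing (r : H ⧸ Q) hrO2 hrb hrnc
  have hR : Nat.card (Op 2 (H ⧸ Q)) = 128 := hH.O2_card
  have hK : Nat.card (H ⧸ Q) = 128 * 25920 := by
    have h1 := (Op 2 (H ⧸ Q)).card_mul_index
    obtain ⟨e⟩ := hH.quotient_iso
    have h2 : (Op 2 (H ⧸ Q)).index = 25920 := by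
      rw [← card_psp43]
      exact Nat.card_congr e.toEquiv
    rw [← h1, hR, h2]
  have hz := hH.rho_z f.z1 f.zz
  have hV := hH.card_V
  have h3 := hH.three_V
  obtain ⟨-, hfix, -⟩ := f.rep_card h3 hV (SimilarToF2Centralizer.rho Q) hz
  have : Fact (Nat.Prime 3) := ⟨Nat.prime_three⟩
  have hP3 : IsPGroup 3 (SimilarToF2Centralizer.PP Q r) := IsPGroup.of_card (hH.card_PP hr2 hfix)
  have hσ := hH.sg_surj hr2
  have hker := SimilarToF2Centralizer.sg_ker (Q := Q) r
  obtain ⟨a1, a2, a3⟩ := abs1 (SimilarToF2Centralizer.PP Q r) hP3 (SimilarToF2Centralizer.sg Q r) hσ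
    hker (Fr.DD (r : H ⧸ Q) (SimilarToF2Centralizer.rho Q))
    (f.DD_two h3 hV (SimilarToF2Centralizer.rho Q) hz hR hK) (hH.hcent hr2) (hH.hcD hr2)
  obtain ⟨-, -, b3, -⟩ := f.K_final h3 hV (SimilarToF2Centralizer.rho Q) hz hR hK
    (QuotientGroup.mk' (Fr.DD (r : H ⧸ Q) (SimilarToF2Centralizer.rho Q)))
    (QuotientGroup.mk'_surjective _) (QuotientGroup.ker_mk' _)
  obtain ⟨c1, q, hq, hqk⟩ := abs2 (SimilarToF2Centralizer.PP Q r) hP3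
    (SimilarToF2Centralizer.sg Q r) hσ hker
    (Fr.DD (r : H ⧸ Q) (SimilarToF2Centralizer.rho Q)) b3 a1 a2
  obtain ⟨d1, d2, -, d4⟩ := f.K_final h3 hV (SimilarToF2Centralizer.rho Q) hz hR hK q hq hqk
  obtain ⟨m1, m2⟩ := hH.map_PP hr2 hfix (Op 2 (Subgroup.centralizer ({r} : Set H))) a3
  rw [← c1] at m1 m2
  exact ⟨m1, m2, d1, d2, quot_comap_equiv _ _ d4⟩
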